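/- Assume GRH. For each ε > 0 there exists a constant c > 0 such that for every positive integer s, the number N(S_s*) of triples (X,Y,Z) of positive integers with X+Y = Z, gcd(X,Y,Z) = 1, and every prime factor of XYZ among the first s primes, satisfies N(S_s*) ≥ c·exp(s^{1/8−ε}). -/

import Mathlib

noncomputable section

/-- The Generalized Riemann Hypothesis. -/
def GRH : Prop :=
  (∀ s : ℂ, 0 < s.re → s.re < 1 → riemannZeta s = 0 → s.re = 1 / 2) ∧
  (∀ (N : ℕ) [NeZero N] (χ : DirichletCharacter ℂ N) (s : ℂ),
    0 < s.re → s.re < 1 → DirichletCharacter.LFunction χ s = 0 → s.re = 1 / 2)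

/-- `N(S_s^*)`: the number of primitive solutions of `X+Y=Z` in positive integers
all of whose prime factors are among the first `s` primes. -/
def NSunit (s : ℕ) : ℕ :=
  Nat.card {T : ℕ × ℕ × ℕ | 0 < T.1 ∧ 0 < T.2.1 ∧ T.1 + T.2.1 = T.2.2 ∧
    Nat.gcd T.1 (Nat.gcd T.2.1 T.2.2) = 1 ∧
    ∀ p : ℕ, p.Prime → p ∣ T.1 * T.2.1 * T.2.2 → ∃ i < s, Nat.nth Nat.Prime i = p}

open Polynomial Finset in
/-- Alternating binomial sums of values of a polynomial of small degree vanish. -/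
theorem alternating_sum_eval_eq_zero (Q : ℚ[X]) (m : ℕ) (h : Q.natDegree < m) (x : ℚ) :
    ∑ q ∈ range (m + 1), (-1 : ℚ) ^ q * (m.choose q : ℚ) * Q.eval (x - q) = 0 := by
  have h1 := Polynomial.fwdDiff_iter_eq_zero_of_degree_lt h
  have h2 := congrFun h1 (x - m)
  rw [fwdDiff_iter_eq_sum_shift, ← Finset.sum_range_reflect] at h2
  refine Eq.trans ?_ h2
  apply Finset.sum_congr rfl
  intro j hj
  have hj' : j ≤ m := by simpa [Nat.lt_succ_iff] using hj
  have e1 : m + 1 - 1 - j = m - j := by omega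
  rw [e1, Nat.sub_sub_self hj', Nat.choose_symm hj']
  simp only [zsmul_eq_mul, nsmul_eq_mul, mul_one, Int.cast_mul, Int.cast_pow, Int.cast_neg,
    Int.cast_one, Int.cast_natCast]
  rw [Nat.cast_sub hj']
  congr 2
  ring

namespace PadeUnit
open Polynomial Finset

/-- The polynomial interpolating the Padé coefficients. -/
noncomputable def interp (N : ℕ) : ℚ[X] :=
  C (1 / ((N.factorial : ℚ) ^ 2)) * ((∏ l ∈ Icc 1 N, (X + C (l : ℚ))) *
    ∏ l ∈ Icc 1 N, (C (2 * N + 1 - l : ℚ) - X))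

theorem natDegree_interp_lt (N : ℕ) : (interp N).natDegree < 2 * N + 1 := by
  have a1 : (∏ l ∈ Icc 1 N, (X + C (l : ℚ))).natDegree ≤ N := by
    refine (natDegree_prod_le _ _).trans ?_
    refine (Finset.sum_le_card_nsmul _ _ 1 ?_).trans (by simp)
    intro i _
    exact (natDegree_X_add_C _).le
  have a2 : (∏ l ∈ Icc 1 N, (C (2 * N + 1 - l : ℚ) - X)).natDegree ≤ N := by
    refine (natDegree_prod_le _ _).trans ?_
    refine (Finset.sum_le_card_nsmul _ _ 1 ?_).trans (by simp)
    intro i _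
    refine (natDegree_sub_le _ _).trans (by rw [natDegree_C]; simp)
  have := (natDegree_C_mul_le (1 / ((N.factorial : ℚ) ^ 2)) ((∏ l ∈ Icc 1 N, (X + C (l : ℚ))) *
    ∏ l ∈ Icc 1 N, (C (2 * N + 1 - l : ℚ) - X))).trans (natDegree_mul_le.trans (add_le_add a1 a2))
  unfold interp
  omega

theorem interp_eval_eq_zero (N : ℕ) (j : ℤ) (h1 : -N ≤ j) (h2 : j ≤ 2 * N)
    (h : j < 0 ∨ (N : ℤ) < j) : (interp N).eval (j : ℚ) = 0 := by
  unfold interp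
  rw [eval_mul, eval_mul, eval_prod, eval_prod]
  rcases h with h | h
  · have : ∏ l ∈ Icc 1 N, (X + C (l : ℚ) : ℚ[X]).eval (j : ℚ) = 0 := by
      apply Finset.prod_eq_zero (i := (-j).toNat)
      · rw [mem_Icc]; omega
      · have : (((-j).toNat : ℤ) : ℚ) = ((-j : ℤ) : ℚ) := by
          rw [Int.toNat_of_nonneg (by omega)]
        rw [Int.cast_natCast] at this
        simp [this]
    rw [this]; ring
  · have : ∏ l ∈ Icc 1 N, (C (2 * N + 1 - l : ℚ) - X : ℚ[X]).eval (j : ℚ) = 0 := by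
      apply Finset.prod_eq_zero (i := (2 * N + 1 - j).toNat)
      · rw [mem_Icc]; omega
      · have : (((2 * N + 1 - j).toNat : ℤ) : ℚ) = ((2 * N + 1 - j : ℤ) : ℚ) := by
          rw [Int.toNat_of_nonneg (by omega)]
        rw [Int.cast_natCast] at this
        simp [this]
    rw [this]; ring

theorem prod_Icc_add_eq (N j : ℕ) :
    (∏ l ∈ Icc 1 N, ((j : ℚ) + l)) = (N + j).choose N * N.factorial := by
  have h1 : ∀ N : ℕ, (∏ l ∈ Icc 1 N, (j + l)) * j.factorial = (N + j).factorial := by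
    intro N
    induction N with
    | zero => simp
    | succ N ih =>
      rw [Finset.prod_Icc_succ_top (by omega), mul_right_comm, ih,
        show N + 1 + j = (N + j) + 1 by ring, Nat.factorial_succ]
      ring
  have h2 := h1 N
  rw [← Nat.add_choose_mul_factorial_mul_factorial N j, ← Nat.choose_symm_add] at h2
  have h3 : (∏ l ∈ Icc 1 N, (j + l)) = (N + j).choose N * N.factorial :=
    Nat.eq_of_mul_eq_mul_right (Nat.factorial_pos j) h2
  exact_mod_cast h3

/-- Coefficients of the middle Padé polynomial. -/
def bcoef (N j : ℕ) : ℚ := (N + j).choose N * (2 * N - j).choose N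

theorem interp_eval_eq (N j : ℕ) (h : j ≤ N) : (interp N).eval (j : ℚ) = bcoef N j := by
  unfold interp bcoef
  rw [eval_mul, eval_mul, eval_prod, eval_prod, eval_C]
  have e1 : ∏ l ∈ Icc 1 N, (X + C (l : ℚ) : ℚ[X]).eval (j : ℚ) = (N + j).choose N * N.factorial := by
    rw [← prod_Icc_add_eq]; simp
  have e2 : ∏ l ∈ Icc 1 N, (C (2 * N + 1 - l : ℚ) - X : ℚ[X]).eval (j : ℚ) =
      (2 * N - j).choose N * N.factorial := by
    have := prod_Icc_add_eq N (N - j)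
    rw [show N + (N - j) = 2 * N - j by omega] at this
    rw [← this]
    apply Finset.prod_bij' (fun l _ => N + 1 - l) (fun l _ => N + 1 - l)
    · intro a ha; rw [mem_Icc] at *; omega
    · intro a ha; rw [mem_Icc] at *; omega
    · intro a ha; rw [mem_Icc] at *; omega
    · intro a ha; rw [mem_Icc] at *; omega
    · intro a ha
      rw [mem_Icc] at ha
      rw [Nat.cast_sub h, Nat.cast_sub (by omega)]
      simp
      ring
  rw [e1, e2]
  have : (N.factorial : ℚ) ≠ 0 := by exact_mod_cast N.factorial_ne_zero
  field_simp

/-- The middle Padé polynomial. -/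
noncomputable def midPoly (N : ℕ) : ℚ[X] := ∑ j ∈ range (N + 1), C (bcoef N j) * X ^ j

theorem coeff_midPoly (N j : ℕ) : (midPoly N).coeff j = if j ≤ N then bcoef N j else 0 := by
  simp [midPoly, coeff_C_mul, coeff_X_pow]

theorem natDegree_midPoly_le (N : ℕ) : (midPoly N).natDegree ≤ N := by
  rw [natDegree_le_iff_coeff_eq_zero]
  intro j hj
  rw [coeff_midPoly, if_neg (by omega)]

theorem coeff_one_sub_X_pow (m q : ℕ) :
    ((1 - X : ℚ[X]) ^ m).coeff q = (-1) ^ q * m.choose q := by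
  have : (1 - X : ℚ[X]) ^ m = ((1 + X : ℚ[X]) ^ m).comp (C (-1) * X) := by
    simp [sub_eq_add_neg]
  rw [this, comp_C_mul_X_coeff, coeff_one_add_X_pow, mul_comm]

theorem coeff_full (N i : ℕ) : ((1 - X) ^ (2 * N + 1) * midPoly N : ℚ[X]).coeff i =
    ∑ q ∈ range (i + 1), (-1) ^ q * ((2 * N + 1).choose q : ℚ) * (midPoly N).coeff (i - q) := by
  rw [coeff_mul, Finset.Nat.sum_antidiagonal_eq_sum_range_succ_mk]
  simp only [coeff_one_sub_X_pow]

theorem coeff_gap (N i : ℕ) (h1 : N < i) (h2 : i ≤ 2 * N) :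
    ((1 - X) ^ (2 * N + 1) * midPoly N : ℚ[X]).coeff i = 0 := by
  rw [coeff_full]
  have := alternating_sum_eval_eq_zero (interp N) (2 * N + 1) (natDegree_interp_lt N) (i : ℚ)
  rw [← this]
  have hsub : range (i + 1) ⊆ range (2 * N + 1 + 1) := by
    intro a; simp only [mem_range]; omega
  rw [← Finset.sum_subset hsub]
  · apply Finset.sum_congr rfl
    intro q hq
    rw [mem_range] at hq
    congr 1
    rw [coeff_midPoly, ← Nat.cast_sub (by omega)]
    split_ifs with h
    · rw [interp_eval_eq _ _ h]
    · have := interp_eval_eq_zero N ((i - q : ℕ) : ℤ) (by omega) (by omega) (by omega)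
      rw [Int.cast_natCast] at this
      rw [this]
  · intro q hq hq'
    rw [mem_range] at hq hq'
    have := interp_eval_eq_zero N ((i : ℤ) - q) (by omega) (by omega) (by omega)
    push_cast at this
    rw [this, mul_zero]

/-- The full product polynomial. -/
noncomputable def fullPoly (N : ℕ) : ℚ[X] := (1 - X) ^ (2 * N + 1) * midPoly N

/-- The low part. -/
noncomputable def lowPoly (N : ℕ) : ℚ[X] := ∑ j ∈ range (N + 1), C ((fullPoly N).coeff j) * X ^ j

/-- The high part, divided by the appropriate power of the variable. -/
noncomputable def highPoly (N : ℕ) : ℚ[X] :=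
  ∑ j ∈ range (N + 1), C ((fullPoly N).coeff (2 * N + 1 + j)) * X ^ j

theorem coeff_lowPoly (N j : ℕ) :
    (lowPoly N).coeff j = if j ≤ N then (fullPoly N).coeff j else 0 := by
  simp [lowPoly, coeff_C_mul, coeff_X_pow]

theorem coeff_highPoly (N j : ℕ) :
    (highPoly N).coeff j = if j ≤ N then (fullPoly N).coeff (2 * N + 1 + j) else 0 := by
  simp [highPoly, coeff_C_mul, coeff_X_pow]

theorem natDegree_lowPoly_le (N : ℕ) : (lowPoly N).natDegree ≤ N := by
  rw [natDegree_le_iff_coeff_eq_zero]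
  intro j hj
  rw [coeff_lowPoly, if_neg (by omega)]

theorem natDegree_highPoly_le (N : ℕ) : (highPoly N).natDegree ≤ N := by
  rw [natDegree_le_iff_coeff_eq_zero]
  intro j hj
  rw [coeff_highPoly, if_neg (by omega)]

theorem natDegree_one_sub_X_pow_le (m : ℕ) : ((1 - X : ℚ[X]) ^ m).natDegree ≤ m := by
  refine natDegree_pow_le.trans ?_
  have : (1 - X : ℚ[X]).natDegree ≤ 1 := (natDegree_sub_le _ _).trans (by simp)
  nlinarith

theorem natDegree_fullPoly_le (N : ℕ) : (fullPoly N).natDegree ≤ 3 * N + 1 := by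
  have := natDegree_midPoly_le N
  have h2 := natDegree_one_sub_X_pow_le (2 * N + 1)
  have h3 := (natDegree_mul_le (p := (1 - X : ℚ[X]) ^ (2 * N + 1)) (q := midPoly N))
  unfold fullPoly
  omega

theorem fullPoly_eq (N : ℕ) : fullPoly N = lowPoly N + X ^ (2 * N + 1) * highPoly N := by
  ext i
  rw [coeff_add, coeff_X_pow_mul', coeff_lowPoly]
  by_cases h1 : i ≤ N
  · rw [if_pos h1, if_neg (by omega), add_zero]
  · rw [if_neg h1, zero_add]
    split_ifs with h2
    · rw [coeff_highPoly]
      split_ifs with h3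
      · congr 1; omega
      · rw [coeff_eq_zero_of_natDegree_lt]
        have := natDegree_fullPoly_le N
        omega
    · exact coeff_gap N i (by omega) (by omega)

theorem coeff_zero_lowPoly_ne (N : ℕ) : (lowPoly N).coeff 0 ≠ 0 := by
  rw [coeff_lowPoly, if_pos (Nat.zero_le _)]
  unfold fullPoly
  rw [coeff_full]
  simp [coeff_midPoly, bcoef]
  exact Nat.ne_of_gt (Nat.choose_pos (by omega))

/-- The polynomial Wronskian-type determinant of the two Padé relations. -/
noncomputable def detPoly (N : ℕ) : ℚ[X] :=
  lowPoly N * ((1 - X) * derivative (midPoly N) - C (2 * N + 1 : ℚ) * midPoly N) -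
    derivative (lowPoly N) * ((1 - X) * midPoly N)

theorem derivative_fullPoly (N : ℕ) : derivative (fullPoly N) = (1 - X) ^ (2 * N) *
    ((1 - X) * derivative (midPoly N) - C (2 * N + 1 : ℚ) * midPoly N) := by
  unfold fullPoly
  rw [derivative_mul, derivative_pow]
  simp
  ring

theorem one_sub_pow_mul_detPoly (N : ℕ) : (1 - X) ^ (2 * N) * detPoly N =
    lowPoly N * derivative (fullPoly N) - derivative (lowPoly N) * fullPoly N := by
  rw [derivative_fullPoly]
  unfold detPoly fullPoly
  ring

theorem detPoly_ne_zero (N : ℕ) : detPoly N ≠ 0 := by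
  intro h
  have h1 := one_sub_pow_mul_detPoly N
  rw [h, mul_zero] at h1
  have hA : lowPoly N ≠ 0 := fun h => coeff_zero_lowPoly_ne N (by rw [h]; simp)
  have hB : midPoly N ≠ 0 := by
    intro h
    have := coeff_midPoly N N
    rw [h, if_pos le_rfl] at this
    simp [bcoef] at this
    have h3 := (Nat.choose_pos (show N ≤ N + N by omega)).ne'
    have h4 := (Nat.choose_pos (show N ≤ 2 * N - N by omega)).ne'
    simp_all
  have hu : (1 - X : ℚ[X]) ≠ 0 := by
    intro h
    have := congrArg (fun p => coeff p 0) h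
    simp at this
  have hW : fullPoly N ≠ 0 := mul_ne_zero (pow_ne_zero _ hu) hB
  have hdeg1 : (1 - X : ℚ[X]).natDegree = 1 := by
    rw [← neg_sub, natDegree_neg]; exact natDegree_X_sub_C 1
  have hdW : (lowPoly N).natDegree < (fullPoly N).natDegree := by
    unfold fullPoly
    rw [natDegree_mul (pow_ne_zero _ hu) hB, natDegree_pow, hdeg1]
    have := natDegree_lowPoly_le N
    omega
  set a := (lowPoly N).natDegree
  set b := (fullPoly N).natDegree with hb
  have h2 : lowPoly N * derivative (fullPoly N) = derivative (lowPoly N) * fullPoly N :=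
    (sub_eq_zero.mp h1.symm)
  obtain ⟨b', hb'⟩ : ∃ b', b = b' + 1 := ⟨b - 1, by omega⟩
  have h3 := congrArg (fun p => coeff p (a + b')) h2
  rw [coeff_mul_add_eq_of_natDegree_le le_rfl
    ((natDegree_derivative_le _).trans (by omega)), coeff_derivative] at h3
  rcases Nat.eq_zero_or_pos a with ha | ha
  · have : derivative (lowPoly N) = 0 := derivative_of_natDegree_zero ha
    rw [this, zero_mul, coeff_zero, ← hb'] at h3
    have l1 : (lowPoly N).coeff a ≠ 0 := by simpa [a] using hA
    have l2 : (fullPoly N).coeff b ≠ 0 := by simpa [hb] using hW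
    have l3 : (b' : ℚ) + 1 ≠ 0 := by positivity
    exact mul_ne_zero l1 (mul_ne_zero l2 l3) h3
  · obtain ⟨a', ha'⟩ : ∃ a', a = a' + 1 := ⟨a - 1, by omega⟩
    rw [show a + b' = a' + b by omega, coeff_mul_add_eq_of_natDegree_le
      ((natDegree_derivative_le _).trans (by omega)) le_rfl, coeff_derivative,
      ← hb', ← ha'] at h3
    have l1 : (lowPoly N).coeff a ≠ 0 := by simpa [a] using hA
    have l2 : (fullPoly N).coeff b ≠ 0 := by simpa [hb] using hW
    have h4 : (lowPoly N).coeff a * (fullPoly N).coeff b * ((b' : ℚ) - a') = 0 := by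
      linear_combination h3
    have l3 : (b' : ℚ) - a' ≠ 0 := by
      have : (a' : ℚ) < b' := by exact_mod_cast (by omega : a' < b')
      linarith
    exact mul_ne_zero (mul_ne_zero l1 l2) l3 h4

theorem natDegree_detPoly_le (N : ℕ) : (detPoly N).natDegree ≤ 2 * N := by
  have hd : (1 - X : ℚ[X]).natDegree ≤ 1 := (natDegree_sub_le _ _).trans (by simp)
  have hA := natDegree_lowPoly_le N
  have hB := natDegree_midPoly_le N
  have hA' : (derivative (lowPoly N)).natDegree ≤ N - 1 :=
    (natDegree_derivative_le _).trans (by omega)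
  have hB' : (derivative (midPoly N)).natDegree ≤ N - 1 :=
    (natDegree_derivative_le _).trans (by omega)
  rcases Nat.eq_zero_or_pos N with h | h
  · subst h
    have e1 : derivative (lowPoly 0) = 0 := derivative_of_natDegree_zero (by omega)
    have e2 : derivative (midPoly 0) = 0 := derivative_of_natDegree_zero (by omega)
    unfold detPoly
    rw [e1, e2]
    simp only [mul_zero, zero_mul, sub_zero, zero_sub]
    refine natDegree_mul_le.trans ?_
    rw [natDegree_neg]
    have := natDegree_C_mul_le (2 * (0 : ℕ) + 1 : ℚ) (midPoly 0)
    omega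
  · unfold detPoly
    refine (natDegree_sub_le _ _).trans (max_le ?_ ?_)
    · refine natDegree_mul_le.trans ?_
      have : ((1 - X) * derivative (midPoly N) - C (2 * N + 1 : ℚ) * midPoly N).natDegree ≤ N := by
        refine (natDegree_sub_le _ _).trans (max_le ?_ ?_)
        · exact natDegree_mul_le.trans (by omega)
        · exact (natDegree_C_mul_le _ _).trans (by omega)
      omega
    · refine natDegree_mul_le.trans ?_
      have : ((1 - X) * midPoly N).natDegree ≤ N + 1 := natDegree_mul_le.trans (by omega)
      omega

theorem X_pow_dvd_detPoly (N : ℕ) : X ^ (2 * N) ∣ detPoly N := by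
  have hcop : IsCoprime ((X : ℚ[X]) ^ (2 * N)) ((1 - X) ^ (2 * N)) := by
    apply IsCoprime.pow
    exact ⟨1, 1, by ring⟩
  refine hcop.dvd_of_dvd_mul_left ?_
  rw [one_sub_pow_mul_detPoly, fullPoly_eq]
  refine ⟨lowPoly N * (C (2 * N + 1 : ℚ) * highPoly N + X * derivative (highPoly N)) -
    derivative (lowPoly N) * (X * highPoly N), ?_⟩
  simp
  ring

theorem detPoly_eval_ne_zero (N : ℕ) (t : ℚ) (ht : t ≠ 0) : (detPoly N).eval t ≠ 0 := by
  obtain ⟨q, hq⟩ := X_pow_dvd_detPoly N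
  have hq0 : q ≠ 0 := by
    rintro rfl
    exact detPoly_ne_zero N (by rw [hq, mul_zero])
  have hd := natDegree_detPoly_le N
  rw [hq, natDegree_X_pow_mul _ hq0] at hd
  have : q.natDegree = 0 := by omega
  rw [natDegree_eq_zero] at this
  obtain ⟨c, rfl⟩ := this
  rw [hq]
  have hc : c ≠ 0 := by
    rintro rfl
    simp at hq0
  simp [ht, hc]

end PadeUnit

namespace PadeUnit
open Polynomial Finset

/-- A rational polynomial with integer coefficients bounded by `K` and degree at most `d`. -/
def IntBound (p : ℚ[X]) (d K : ℕ) : Prop :=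
  p.natDegree ≤ d ∧ ∀ i, ∃ c : ℤ, p.coeff i = c ∧ |c| ≤ K

theorem IntBound.mono {p : ℚ[X]} {d d' K K' : ℕ} (h : IntBound p d K) (hd : d ≤ d')
    (hK : K ≤ K') : IntBound p d' K' := by
  refine ⟨h.1.trans hd, fun i => ?_⟩
  obtain ⟨c, h1, h2⟩ := h.2 i
  exact ⟨c, h1, h2.trans (by exact_mod_cast hK)⟩

theorem IntBound.add {p q : ℚ[X]} {d K L : ℕ} (h : IntBound p d K) (h' : IntBound q d L) :
    IntBound (p + q) d (K + L) := by
  refine ⟨(natDegree_add_le _ _).trans (max_le h.1 h'.1), fun i => ?_⟩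
  obtain ⟨c, h1, h2⟩ := h.2 i
  obtain ⟨c', h1', h2'⟩ := h'.2 i
  refine ⟨c + c', by simp [h1, h1'], (abs_add_le _ _).trans (by push_cast; linarith)⟩

theorem IntBound.sub {p q : ℚ[X]} {d K L : ℕ} (h : IntBound p d K) (h' : IntBound q d L) :
    IntBound (p - q) d (K + L) := by
  refine ⟨(natDegree_sub_le _ _).trans (max_le h.1 h'.1), fun i => ?_⟩
  obtain ⟨c, h1, h2⟩ := h.2 i
  obtain ⟨c', h1', h2'⟩ := h'.2 i
  refine ⟨c - c', by simp [h1, h1'], (abs_sub _ _).trans (by push_cast; linarith)⟩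

theorem IntBound.X_mul {p : ℚ[X]} {d K : ℕ} (h : IntBound p d K) :
    IntBound (X * p) (d + 1) K := by
  refine ⟨natDegree_mul_le.trans (by have := h.1; rw [natDegree_X]; omega), fun i => ?_⟩
  cases i with
  | zero => exact ⟨0, by simp⟩
  | succ i =>
    obtain ⟨c, h1, h2⟩ := h.2 i
    exact ⟨c, by rw [coeff_X_mul, h1], h2⟩

theorem IntBound.nat_mul {p : ℚ[X]} {d K : ℕ} (h : IntBound p d K) (n : ℕ) :
    IntBound (C (n : ℚ) * p) d (n * K) := by
  refine ⟨(natDegree_C_mul_le _ _).trans h.1, fun i => ?_⟩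
  obtain ⟨c, h1, h2⟩ := h.2 i
  refine ⟨n * c, by rw [coeff_C_mul, h1]; push_cast; ring, ?_⟩
  rw [abs_mul, Nat.abs_cast]
  push_cast
  gcongr

theorem IntBound.derivative {p : ℚ[X]} {d K : ℕ} (h : IntBound p d K) :
    IntBound (derivative p) d (d * K) := by
  refine ⟨(natDegree_derivative_le _).trans (by have := h.1; omega), fun i => ?_⟩
  by_cases hi : i + 1 ≤ d
  · obtain ⟨c, h1, h2⟩ := h.2 (i + 1)
    refine ⟨c * (i + 1 : ℕ), by rw [coeff_derivative, h1]; push_cast; ring, ?_⟩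
    rw [abs_mul, Nat.abs_cast, mul_comm]
    push_cast
    have : ((i : ℤ) + 1) ≤ d := by exact_mod_cast hi
    gcongr
  · refine ⟨0, ?_, by simp; positivity⟩
    rw [coeff_derivative, coeff_eq_zero_of_natDegree_lt (by have := h.1; omega)]
    simp

theorem IntBound.eval {p : ℚ[X]} {d K : ℕ} (h : IntBound p d K) {x z : ℕ} (hxz : x ≤ z)
    (hz : 0 < z) : ∃ n : ℤ, (n : ℚ) = z ^ d * p.eval ((x : ℚ) / z) ∧
      |n| ≤ (d + 1) * K * z ^ d := by
  choose c hc hK using h.2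
  refine ⟨∑ i ∈ range (d + 1), c i * x ^ i * z ^ (d - i), ?_, ?_⟩
  · rw [eval_eq_sum_range' (Nat.lt_succ_of_le h.1), Finset.mul_sum]
    push_cast
    apply Finset.sum_congr rfl
    intro i hi
    have hz' : (z : ℚ) ≠ 0 := by positivity
    have : d = i + (d - i) := by rw [mem_range] at hi; omega
    rw [hc i, div_pow]
    conv_rhs => rw [this, pow_add]
    field_simp
  · refine (abs_sum_le_sum_abs _ _).trans ?_
    have : ∀ i ∈ range (d + 1), |c i * (x : ℤ) ^ i * (z : ℤ) ^ (d - i)| ≤ K * z ^ d := by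
      intro i hi
      have hid : d = i + (d - i) := by rw [mem_range] at hi; omega
      rw [abs_mul, abs_mul, abs_pow, abs_pow, Nat.abs_cast, Nat.abs_cast]
      calc |c i| * (x : ℤ) ^ i * (z : ℤ) ^ (d - i) ≤ K * (z : ℤ) ^ i * (z : ℤ) ^ (d - i) := by
            have : (x : ℤ) ≤ z := by exact_mod_cast hxz
            gcongr
            exact hK i
        _ = K * z ^ d := by
            conv_rhs => rw [hid, pow_add]
            ring
    refine (Finset.sum_le_card_nsmul _ _ _ this).trans ?_
    simp [mul_assoc]

theorem intBound_midPoly (N : ℕ) : IntBound (midPoly N) N (2 ^ (3 * N)) := by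
  refine ⟨natDegree_midPoly_le N, fun i => ?_⟩
  rw [coeff_midPoly]
  split_ifs with h
  · refine ⟨((N + i).choose N * (2 * N - i).choose N : ℕ), by simp [bcoef], ?_⟩
    rw [Nat.abs_cast]
    have h1 := Nat.choose_le_two_pow (N + i) N
    have h2 := Nat.choose_le_two_pow (2 * N - i) N
    have h3 := Nat.mul_le_mul h1 h2
    rw [← pow_add, show N + i + (2 * N - i) = 3 * N by omega] at h3
    exact_mod_cast h3
  · exact ⟨0, by simp, by simp⟩

theorem full_coeff_bound (N i : ℕ) :
    ∃ c : ℤ, (fullPoly N).coeff i = c ∧ |c| ≤ (2 ^ (5 * N + 1) : ℕ) := by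
  choose c hc hK using (intBound_midPoly N).2
  by_cases hi : 3 * N + 1 < i
  · refine ⟨0, ?_, by simp⟩
    rw [coeff_eq_zero_of_natDegree_lt (by have := natDegree_fullPoly_le N; omega)]; simp
  refine ⟨∑ q ∈ range (i + 1), (-1) ^ q * ((2 * N + 1).choose q : ℤ) * c (i - q), ?_, ?_⟩
  · unfold fullPoly
    rw [coeff_full]
    push_cast
    simp only [hc]
  · refine (abs_sum_le_sum_abs _ _).trans ?_
    have : ∀ q ∈ range (i + 1), |(-1) ^ q * ((2 * N + 1).choose q : ℤ) * c (i - q)| ≤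
        ((2 * N + 1).choose q : ℤ) * 2 ^ (3 * N) := by
      intro q _
      rw [abs_mul, abs_mul, abs_pow, abs_neg, abs_one, one_pow, one_mul, Nat.abs_cast]
      have := hK (i - q)
      push_cast at this
      gcongr
    refine (Finset.sum_le_sum this).trans ?_
    rw [← Finset.sum_mul]
    have h2 : ∑ q ∈ range (i + 1), ((2 * N + 1).choose q) ≤ 2 ^ (2 * N + 1) := by
      rw [← Nat.sum_range_choose]
      by_cases hle : i + 1 ≤ 2 * N + 1 + 1
      · exact Finset.sum_le_sum_of_subset (by intro a; simp only [mem_range]; omega)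
      · apply le_of_eq
        symm
        apply Finset.sum_subset (by intro a; simp only [mem_range]; omega)
        intro q _ hq
        rw [mem_range] at hq
        exact Nat.choose_eq_zero_of_lt (by omega)
    have h3 : (∑ q ∈ range (i + 1), ((2 * N + 1).choose q : ℤ)) ≤ 2 ^ (2 * N + 1) := by
      exact_mod_cast h2
    calc _ ≤ (2 : ℤ) ^ (2 * N + 1) * 2 ^ (3 * N) := by gcongr
      _ = _ := by push_cast; rw [← pow_add]; congr 1; ring

theorem intBound_lowPoly (N : ℕ) : IntBound (lowPoly N) N (2 ^ (5 * N + 1)) := by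
  refine ⟨natDegree_lowPoly_le N, fun i => ?_⟩
  rw [coeff_lowPoly]
  split_ifs with h
  · exact full_coeff_bound N i
  · exact ⟨0, by simp, by simp⟩

theorem intBound_highPoly (N : ℕ) : IntBound (highPoly N) N (2 ^ (5 * N + 1)) := by
  refine ⟨natDegree_highPoly_le N, fun i => ?_⟩
  rw [coeff_highPoly]
  split_ifs with h
  · exact full_coeff_bound N _
  · exact ⟨0, by simp, by simp⟩

/-- Two independent integral relations between `z ^ (2 * N)`, `y ^ (2 * N)`, `x ^ (2 * N)`. -/
theorem two_relations (N : ℕ) {x y z : ℕ} (hx : 0 < x) (hz : 0 < z) (h : x + y = z) :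
    ∃ u v : Fin 3 → ℤ, (∀ i, |u i| ≤ 2 ^ (8 * N + 5) * z ^ (N + 1)) ∧
      (∀ i, |v i| ≤ 2 ^ (8 * N + 5) * z ^ (N + 1)) ∧
      u 0 * (x : ℤ) ^ (2 * N) + u 1 * (y : ℤ) ^ (2 * N) + u 2 * (z : ℤ) ^ (2 * N) = 0 ∧
      v 0 * (x : ℤ) ^ (2 * N) + v 1 * (y : ℤ) ^ (2 * N) + v 2 * (z : ℤ) ^ (2 * N) = 0 ∧
      u 2 * v 1 - v 2 * u 1 ≠ 0 := by
  have hxz : x ≤ z := by omega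
  have hzQ : (z : ℚ) ≠ 0 := by positivity
  have hK : (N + 2) * ((4 * N + 3) * 2 ^ (5 * N + 1)) ≤ 2 ^ (8 * N + 5) := by
    have h1 : N + 2 ≤ 2 ^ (N + 1) := Nat.lt_two_pow_self
    have h2 : 4 * N + 3 ≤ 2 ^ (2 * N + 3) := by
      have : N < 2 ^ N := Nat.lt_two_pow_self
      have h4 : 1 ≤ 2 ^ N := Nat.one_le_two_pow
      rw [show 2 * N + 3 = N + N + 3 by ring, pow_add, pow_add]
      nlinarith
    calc _ ≤ 2 ^ (N + 1) * (2 ^ (2 * N + 3) * 2 ^ (5 * N + 1)) := by gcongr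
      _ = _ := by rw [← pow_add, ← pow_add]; congr 1; ring
  set K := (4 * N + 3) * 2 ^ (5 * N + 1) with hKdef
  have h35 : 2 ^ (3 * N) ≤ 2 ^ (5 * N) := Nat.pow_le_pow_right (by norm_num) (by omega)
  have h51 : 2 ^ (5 * N + 1) = 2 * 2 ^ (5 * N) := by rw [pow_succ]; ring
  have b1 : IntBound (lowPoly N) (N + 1) K :=
    (intBound_lowPoly N).mono (by omega) (by rw [hKdef]; nlinarith)
  have b2 : IntBound ((1 - X) * midPoly N) (N + 1) K := by
    rw [sub_mul, one_mul]
    exact (((intBound_midPoly N).mono (Nat.le_succ N) le_rfl).sub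
      (intBound_midPoly N).X_mul).mono le_rfl (by rw [hKdef]; nlinarith)
  have b3 : IntBound (X * highPoly N) (N + 1) K :=
    (intBound_highPoly N).X_mul.mono le_rfl (by rw [hKdef]; nlinarith)
  have c1 : IntBound (Polynomial.derivative (lowPoly N)) (N + 1) K :=
    (intBound_lowPoly N).derivative.mono (by omega) (by rw [hKdef]; nlinarith)
  have c2 : IntBound ((1 - X) * Polynomial.derivative (midPoly N) -
      C (2 * N + 1 : ℚ) * midPoly N) (N + 1) K := by
    rw [sub_mul, one_mul]
    have hm := intBound_midPoly N
    have := ((hm.derivative.mono (Nat.le_succ N) le_rfl).sub hm.derivative.X_mul).sub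
      ((hm.nat_mul (2 * N + 1)).mono (Nat.le_succ N) le_rfl)
    push_cast at this
    refine this.mono le_rfl ?_
    have := Nat.mul_le_mul (show 4 * N + 1 ≤ 4 * N + 3 by omega)
      (show 2 ^ (3 * N) ≤ 2 ^ (5 * N + 1) by omega)
    rw [hKdef]
    linarith
  have c3 : IntBound (C (2 * N + 1 : ℚ) * highPoly N + X * Polynomial.derivative (highPoly N))
      (N + 1) K := by
    have hm := intBound_highPoly N
    have := ((hm.nat_mul (2 * N + 1)).mono (Nat.le_succ N) le_rfl).add hm.derivative.X_mul
    push_cast at this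
    exact this.mono le_rfl (by rw [hKdef]; nlinarith)
  obtain ⟨u2, hu2, hu2'⟩ := b1.eval hxz hz
  obtain ⟨u1, hu1, hu1'⟩ := b2.eval hxz hz
  obtain ⟨u0, hu0, hu0'⟩ := b3.eval hxz hz
  obtain ⟨v2, hv2, hv2'⟩ := c1.eval hxz hz
  obtain ⟨v1, hv1, hv1'⟩ := c2.eval hxz hz
  obtain ⟨v0, hv0, hv0'⟩ := c3.eval hxz hz
  have hbd : (((N + 1 : ℕ) : ℤ) + 1) * K * z ^ (N + 1) ≤ 2 ^ (8 * N + 5) * z ^ (N + 1) := by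
    have : (((N + 1 : ℕ) : ℤ) + 1) * K ≤ 2 ^ (8 * N + 5) := by exact_mod_cast hK
    gcongr
  have hyz : (1 : ℚ) - x / z = y / z := by
    have : (z : ℚ) = x + y := by exact_mod_cast h.symm
    field_simp
    linarith
  have r1 := congrArg (Polynomial.eval ((x : ℚ) / z)) (fullPoly_eq N)
  have r2 := congrArg (Polynomial.eval ((x : ℚ) / z)) (derivative_fullPoly N)
  rw [fullPoly_eq] at r2
  have m1 : (z : ℚ) ^ (2 * N) * (1 - x / z) ^ (2 * N) = y ^ (2 * N) := by
    rw [hyz, ← mul_pow]; congr 1; field_simp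
  have m2 : (z : ℚ) ^ (2 * N) * (x / z) ^ (2 * N) = x ^ (2 * N) := by
    rw [← mul_pow]; congr 1; field_simp
  refine ⟨![u0, -u1, u2], ![v0, -v1, v2], ?_, ?_, ?_, ?_, ?_⟩
  · intro i; fin_cases i
    · exact hu0'.trans hbd
    · simpa using hu1'.trans hbd
    · exact hu2'.trans hbd
  · intro i; fin_cases i
    · exact hv0'.trans hbd
    · simpa using hv1'.trans hbd
    · exact hv2'.trans hbd
  · have : ((u0 * (x : ℤ) ^ (2 * N) + -u1 * (y : ℤ) ^ (2 * N) + u2 * (z : ℤ) ^ (2 * N) : ℤ) : ℚ)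
        = 0 := by
      push_cast
      rw [hu0, hu1, hu2, ← m1, ← m2]
      unfold fullPoly at r1
      simp only [eval_mul, eval_add, eval_pow, eval_sub, eval_one, eval_X] at r1 ⊢
      linear_combination -(z : ℚ) ^ (N + 1) * z ^ (2 * N) * r1
    exact_mod_cast this
  · have : ((v0 * (x : ℤ) ^ (2 * N) + -v1 * (y : ℤ) ^ (2 * N) + v2 * (z : ℤ) ^ (2 * N) : ℤ) : ℚ)
        = 0 := by
      push_cast
      rw [hv0, hv1, hv2, ← m1, ← m2]
      simp only [derivative_mul, derivative_X_pow, eval_mul, eval_add, eval_pow,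
        eval_sub, eval_one, eval_X, eval_C, map_add, map_mul] at r2 ⊢
      simp at r2
      linear_combination (z : ℚ) ^ (N + 1) * z ^ (2 * N) * r2
    exact_mod_cast this
  · have hx' : (x : ℚ) / z ≠ 0 := by positivity
    have hd := detPoly_eval_ne_zero N _ hx'
    intro h0
    have h1 : ((u2 * -v1 - v2 * -u1 : ℤ) : ℚ) = 0 := by
      have h0' : u2 * -v1 - v2 * -u1 = 0 := h0
      rw [h0']; simp
    push_cast at h1
    rw [hu1, hu2, hv1, hv2] at h1
    have h2 : (z : ℚ) ^ (N + 1) * z ^ (N + 1) * (detPoly N).eval ((x : ℚ) / z) = 0 := by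
      unfold detPoly
      simp only [eval_mul, eval_sub] at h1 ⊢
      linear_combination -h1
    have hzp : (z : ℚ) ^ (N + 1) ≠ 0 := pow_ne_zero _ hzQ
    exact (mul_ne_zero (mul_ne_zero hzp hzp) hd) h2

/-- If a third independent relation has small coefficients, then `z` is bounded. -/
theorem height_bound (N : ℕ) {x y z : ℕ} (hx : 0 < x) (hy : 0 < y) (h : x + y = z)
    (hcop : Nat.Coprime x z) (w : Fin 3 → ℤ) (hw : w 0 ≠ 0)
    (W : ℤ) (hW : ∀ i, |w i| ≤ W)
    (hrel : w 0 * (x : ℤ) ^ (2 * N) + w 1 * (y : ℤ) ^ (2 * N) + w 2 * (z : ℤ) ^ (2 * N) = 0) :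
    (z : ℤ) ^ (2 * N) ≤ 2 ^ (8 * N + 6) * z ^ (N + 1) * W := by
  have hz : 0 < z := by omega
  obtain ⟨u, v, hu, hv, ru, rv, hne⟩ := two_relations N hx hz h
  set a : ℤ := (x : ℤ) ^ (2 * N) with ha
  set b : ℤ := (y : ℤ) ^ (2 * N) with hb
  set c : ℤ := (z : ℤ) ^ (2 * N) with hc
  have ha0 : a ≠ 0 := by positivity
  have hc0 : c ≠ 0 := by positivity
  have hac : IsCoprime a c := (Nat.isCoprime_iff_coprime.mpr hcop).pow
  have key : ∀ t : Fin 3 → ℤ, (∀ i, |t i| ≤ 2 ^ (8 * N + 5) * z ^ (N + 1)) →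
      t 0 * a + t 1 * b + t 2 * c = 0 → t 0 * w 1 - t 1 * w 0 ≠ 0 →
      c ≤ 2 ^ (8 * N + 6) * z ^ (N + 1) * W := by
    intro t ht rt hn
    have hdiv : c ∣ t 0 * w 1 - t 1 * w 0 := by
      have : c ∣ a * (t 0 * w 1 - t 1 * w 0) :=
        ⟨t 1 * w 2 - t 2 * w 1, by linear_combination w 1 * rt - t 1 * hrel⟩
      exact hac.symm.dvd_of_dvd_mul_left this
    have h1 := Int.le_of_dvd (abs_pos.mpr hn) ((dvd_abs _ _).mpr hdiv)
    have h2 : |t 0 * w 1 - t 1 * w 0| ≤ |t 0| * |w 1| + |t 1| * |w 0| := by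
      rw [← abs_mul, ← abs_mul]; exact abs_sub _ _
    have hW0 : 0 ≤ W := (abs_nonneg _).trans (hW 0)
    have h3 : |t 0| * |w 1| ≤ 2 ^ (8 * N + 5) * z ^ (N + 1) * W := by
      gcongr; exacts [ht 0, hW 1]
    have h4 : |t 1| * |w 0| ≤ 2 ^ (8 * N + 5) * z ^ (N + 1) * W := by
      gcongr; exacts [ht 1, hW 0]
    calc c ≤ _ := h1
      _ ≤ _ := h2
      _ ≤ 2 ^ (8 * N + 5) * z ^ (N + 1) * W + 2 ^ (8 * N + 5) * z ^ (N + 1) * W :=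
        add_le_add h3 h4
      _ = _ := by ring
  by_cases h1 : u 0 * w 1 - u 1 * w 0 = 0
  · by_cases h2 : v 0 * w 1 - v 1 * w 0 = 0
    · exfalso
      have h3 : w 0 * (u 0 * v 1 - v 0 * u 1) = 0 := by
        linear_combination v 0 * h1 - u 0 * h2
      have h4 : u 0 * v 1 - v 0 * u 1 = 0 := (mul_eq_zero.mp h3).resolve_left hw
      have h5 : c * (u 2 * v 1 - v 2 * u 1) = 0 := by
        linear_combination v 1 * ru - u 1 * rv - a * h4
      exact (mul_ne_zero hc0 hne) h5
    · exact key v hv rv h2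
  · exact key u hu ru h1

end PadeUnit

namespace PadeUnit
open Finset

theorem eq_prod_of_primes_mem {S : Finset ℕ} {n : ℕ} (hn : n ≠ 0)
    (h : ∀ p, p.Prime → p ∣ n → p ∈ S) : ∏ p ∈ S, p ^ n.factorization p = n := by
  conv_rhs => rw [← Nat.prod_factorization_pow_eq_self hn]
  rw [Finsupp.prod]
  symm
  apply Finset.prod_subset
  · intro p hp
    rw [Nat.support_factorization, Nat.mem_primeFactors] at hp
    exact h p hp.1 hp.2.1
  · intro p _ hp
    rw [Finsupp.notMem_support_iff] at hp
    rw [hp, pow_zero]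

/-- Comparing two integers composed of the primes of `S` whose exponents are almost proportional. -/
theorem exists_cofactor {S : Finset ℕ} (hS : ∀ p ∈ S, 0 < p) {n m : ℕ} (hn : n ≠ 0) (hm : m ≠ 0)
    (hnS : ∀ p, p.Prime → p ∣ n → p ∈ S) (hmS : ∀ p, p.Prime → p ∣ m → p ∈ S) (k L : ℕ)
    (h1 : ∀ p ∈ S, k * n.factorization p ≤ L + m.factorization p)
    (h2 : ∀ p ∈ S, m.factorization p ≤ L + k * n.factorization p) :
    ∃ ξ : ℕ, 0 < ξ ∧ ξ ≤ (∏ p ∈ S, p) ^ (2 * L) ∧ (∏ p ∈ S, p) ^ L * m = n ^ k * ξ := by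
  refine ⟨∏ p ∈ S, p ^ (L + m.factorization p - k * n.factorization p), ?_, ?_, ?_⟩
  · exact Finset.prod_pos fun p hp => pow_pos (hS p hp) _
  · rw [← Finset.prod_pow]
    apply Finset.prod_le_prod'
    intro p hp
    have := h2 p hp
    exact Nat.pow_le_pow_right (hS p hp) (by omega)
  · have en : n ^ k = ∏ p ∈ S, p ^ (k * n.factorization p) := by
      conv_lhs => rw [← eq_prod_of_primes_mem hn hnS]
      rw [← Finset.prod_pow]
      exact Finset.prod_congr rfl fun p _ => by rw [← pow_mul, mul_comm]
    have em := eq_prod_of_primes_mem hm hmS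
    calc (∏ p ∈ S, p) ^ L * m = (∏ p ∈ S, p ^ L) * ∏ p ∈ S, p ^ m.factorization p := by
          rw [em, Finset.prod_pow]
      _ = _ := by
        rw [en, ← Finset.prod_mul_distrib, ← Finset.prod_mul_distrib]
        apply Finset.prod_congr rfl
        intro p hp
        have := h1 p hp
        rw [← pow_add, ← pow_add]
        congr 1
        omega

/-- The solutions of the `S`-unit equation. -/
def unitSolutions (S : Finset ℕ) : Set (ℕ × ℕ × ℕ) :=
  {T | 0 < T.1 ∧ 0 < T.2.1 ∧ T.1 + T.2.1 = T.2.2 ∧ Nat.gcd T.1 (Nat.gcd T.2.1 T.2.2) = 1 ∧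
    ∀ p : ℕ, p.Prime → p ∣ T.1 * T.2.1 * T.2.2 → p ∈ S}

theorem exists_large {A S : Set (ℕ × ℕ × ℕ)} (hA : A.Infinite) (hAS : A ⊆ S)
    (hS : ∀ T ∈ S, T.1 + T.2.1 = T.2.2) (H : ℝ) : ∃ T ∈ A, H ≤ Real.log T.2.2 := by
  by_contra hcon
  push Not at hcon
  apply hA
  obtain ⟨n, hn⟩ := exists_nat_ge (Real.exp H)
  apply Set.Finite.subset (s := ↑((range (n + 1)) ×ˢ ((range (n + 1)) ×ˢ (range (n + 1)))))
    (Finset.finite_toSet _)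
  intro T hT
  have h1 := hS T (hAS hT)
  have h2 : T.2.2 ≤ n := by
    rcases Nat.eq_zero_or_pos T.2.2 with h0 | h0
    · omega
    have h3 := hcon T hT
    rw [Real.log_lt_iff_lt_exp (by exact_mod_cast h0)] at h3
    exact_mod_cast (h3.le.trans hn)
  simp only [coe_product, Set.mem_prod, mem_coe, mem_range]
  omega

theorem factorization_le_log {p n : ℕ} {h : ℝ} (hn : n ≠ 0) (hnh : Real.log n ≤ h)
    (hp : p.Prime) : (n.factorization p : ℝ) ≤ 2 * h := by
  have h1 : 2 ^ n.factorization p ≤ n :=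
    (Nat.pow_le_pow_left hp.two_le _).trans (Nat.ordProj_le p hn)
  have h2 : (n.factorization p : ℝ) * Real.log 2 ≤ Real.log n := by
    rw [← Real.log_pow]
    exact Real.log_le_log (by positivity) (by exact_mod_cast h1)
  have := Real.log_two_gt_d9
  have h3 : (0 : ℝ) ≤ n.factorization p := by positivity
  nlinarith

/-- The `S`-unit equation has finitely many primitive solutions. -/
theorem unitSolutions_finite (S : Finset ℕ) (hS : ∀ p ∈ S, p.Prime) :
    (unitSolutions S).Finite := by
  by_contra hinf
  have hinf : (unitSolutions S).Infinite := hinf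
  set P : ℕ := ∏ p ∈ S, p with hP
  have hPpos : 0 < P := Finset.prod_pos fun p hp => (hS p hp).pos
  set M : ℝ := Real.log P + 1 with hM
  have hlogP : 0 ≤ Real.log P := Real.log_natCast_nonneg _
  obtain ⟨K, hK⟩ := exists_nat_ge (16 * M)
  have hKpos : (0 : ℝ) < K := by linarith
  -- elementary facts on solutions
  have basic : ∀ T ∈ unitSolutions S, 1 / 2 < Real.log T.2.2 := by
    intro T hT
    have h2 : 2 ≤ T.2.2 := by have := hT.1; have := hT.2.1; have := hT.2.2.1; omega
    have := Real.log_le_log (by norm_num) (show (2 : ℝ) ≤ T.2.2 by exact_mod_cast h2)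
    have := Real.log_two_gt_d9
    linarith
  let comp : ℕ × ℕ × ℕ → Fin 3 → ℕ := fun T => ![T.1, T.2.1, T.2.2]
  have cpos : ∀ T ∈ unitSolutions S, ∀ i, comp T i ≠ 0 := by
    intro T hT i
    have := hT.1; have := hT.2.1; have := hT.2.2.1
    fin_cases i <;> simp [comp] <;> omega
  have cS : ∀ T ∈ unitSolutions S, ∀ i, ∀ p, p.Prime → p ∣ comp T i → p ∈ S := by
    intro T hT i p hp hd
    apply hT.2.2.2.2 p hp
    fin_cases i <;> simp [comp] at hd
    · exact Dvd.dvd.mul_right (Dvd.dvd.mul_right hd _) _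
    · exact Dvd.dvd.mul_right (Dvd.dvd.mul_left hd _) _
    · exact Dvd.dvd.mul_left hd _
  have clog : ∀ T ∈ unitSolutions S, ∀ i, Real.log (comp T i) ≤ Real.log T.2.2 := by
    intro T hT i
    have h0 := Nat.pos_of_ne_zero (cpos T hT i)
    apply Real.log_le_log (by exact_mod_cast h0)
    have := hT.2.2.1
    have : comp T i ≤ T.2.2 := by fin_cases i <;> simp [comp] <;> omega
    exact_mod_cast this
  -- the classification map
  let cls : unitSolutions S → (S × Fin 3 → Fin (2 * K + 1)) := fun T q =>
    ⟨⌊K * ((comp T.1 q.2).factorization q.1 : ℝ) / Real.log T.1.2.2⌋₊, by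
      have h1 := factorization_le_log (p := q.1) (cpos T.1 T.2 q.2) (clog T.1 T.2 q.2)
        (hS _ q.1.2)
      have h2 := basic T.1 T.2
      rw [Nat.lt_succ_iff]
      apply Nat.floor_le_of_le
      rw [div_le_iff₀ (by linarith)]
      push_cast
      nlinarith⟩
  have : Infinite (unitSolutions S) := hinf.to_subtype
  obtain ⟨y, hy⟩ := Finite.exists_infinite_fiber cls
  have hAinf : (Subtype.val '' (cls ⁻¹' {y})).Infinite :=
    (Set.infinite_coe_iff.mp hy).image Subtype.val_injective.injOn
  have hAsub : Subtype.val '' (cls ⁻¹' {y}) ⊆ unitSolutions S := by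
    rintro _ ⟨T, _, rfl⟩; exact T.2
  have hsum : ∀ T ∈ unitSolutions S, T.1 + T.2.1 = T.2.2 := fun T hT => hT.2.2.1
  obtain ⟨_, ⟨v, hv, rfl⟩, hv32⟩ := exists_large hAinf hAsub hsum 32
  set h := Real.log (v.1.2.2) with hh
  obtain ⟨_, ⟨V, hV, rfl⟩, hVbig⟩ := exists_large hAinf hAsub hsum (2 * h * (5 + 24 * M))
  set h' := Real.log (V.1.2.2) with hh'
  have hpos : 0 < h := by linarith
  have hh'pos : 0 < h' := by nlinarith
  set N := ⌊h' / (2 * h)⌋₊ with hN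
  have hN1 : (N : ℝ) ≤ h' / (2 * h) := Nat.floor_le (by positivity)
  have hN2 : h' / (2 * h) < N + 1 := Nat.lt_floor_add_one _
  rw [le_div_iff₀ (by positivity)] at hN1
  rw [div_lt_iff₀ (by positivity)] at hN2
  have hNbig : 4 + 24 * M ≤ N := by nlinarith
  -- exponents are almost proportional
  have hclose : ∀ i, ∀ p ∈ S, |((comp V.1 i).factorization p : ℝ) -
      (2 * N) * (comp v.1 i).factorization p| ≤ h' / K + 4 * h := by
    intro i p hp
    have hc : cls v = cls V := by
      rw [Set.mem_preimage, Set.mem_singleton_iff] at hv hV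
      rw [hv, hV]
    have hc2 := congrArg Fin.val (congrFun hc (⟨p, hp⟩, i))
    simp only [cls] at hc2
    set e : ℝ := ((comp v.1 i).factorization p : ℝ)
    set e' : ℝ := ((comp V.1 i).factorization p : ℝ)
    have he : 0 ≤ e := by positivity
    have he' : 0 ≤ e' := by positivity
    have he2 : e ≤ 2 * h := factorization_le_log (cpos v.1 v.2 i) (clog v.1 v.2 i) (hS p hp)
    have f1 := Nat.floor_le (show 0 ≤ K * e / h by positivity)
    have f2 := Nat.lt_floor_add_one (K * e / h)
    have f3 := Nat.floor_le (show 0 ≤ K * e' / h' by positivity)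
    have f4 := Nat.lt_floor_add_one (K * e' / h')
    rw [hc2] at f1 f2
    have g1 : |e' / h' - e / h| ≤ 1 / K := by
      rw [abs_le]
      constructor
      · have : K * e / h - K * e' / h' ≤ 1 := by linarith
        have h3 : K * (e / h - e' / h') ≤ 1 := by rw [mul_sub, ← mul_div_assoc, ← mul_div_assoc]; exact this
        have : e / h - e' / h' ≤ 1 / K := by rw [le_div_iff₀ hKpos]; linarith
        linarith
      · have : K * e' / h' - K * e / h ≤ 1 := by linarith
        have h3 : K * (e' / h' - e / h) ≤ 1 := by rw [mul_sub, ← mul_div_assoc, ← mul_div_assoc]; exact this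
        rw [le_div_iff₀ hKpos]; linarith
    have g2 : e' - 2 * N * e = h' * (e' / h' - e / h) + (h' / h - 2 * N) * e := by
      field_simp; ring
    have g3 : |h' / h - 2 * N| ≤ 2 := by
      rw [abs_le]
      constructor
      · have : 2 * (N : ℝ) ≤ h' / h := by rw [le_div_iff₀ hpos]; linarith
        linarith
      · have : h' / h ≤ 2 * (N : ℝ) + 2 := by rw [div_le_iff₀ hpos]; linarith
        linarith
    rw [g2]
    refine (abs_add_le _ _).trans ?_
    rw [abs_mul, abs_mul, abs_of_pos hh'pos, abs_of_nonneg he]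
    have k1 : h' * |e' / h' - e / h| ≤ h' / K := by
      have := mul_le_mul_of_nonneg_left g1 hh'pos.le
      rwa [mul_one_div] at this
    have k2 : |h' / h - 2 * N| * e ≤ 2 * (2 * h) := by gcongr
    linarith
  set L := ⌈h' / K + 4 * h⌉₊ with hL
  have hL1 : h' / K + 4 * h ≤ L := Nat.le_ceil _
  have hL2 : (L : ℝ) < h' / K + 4 * h + 1 := Nat.ceil_lt_add_one (by positivity)
  have cof : ∀ i, ∃ ξ : ℕ, 0 < ξ ∧ ξ ≤ P ^ (2 * L) ∧
      P ^ L * comp V.1 i = (comp v.1 i) ^ (2 * N) * ξ := by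
    intro i
    apply exists_cofactor (fun p hp => (hS p hp).pos) (cpos v.1 v.2 i) (cpos V.1 V.2 i)
      (cS v.1 v.2 i) (cS V.1 V.2 i)
    · intro p hp
      have := (abs_le.mp (hclose i p hp)).1
      have h3 : (2 * N : ℝ) * (comp v.1 i).factorization p ≤ L + (comp V.1 i).factorization p := by
        linarith
      exact_mod_cast h3
    · intro p hp
      have := (abs_le.mp (hclose i p hp)).2
      have h3 : ((comp V.1 i).factorization p : ℝ) ≤
        L + (2 * N : ℝ) * (comp v.1 i).factorization p := by linarith
      exact_mod_cast h3
  choose ξ hξ0 hξle hξ using cof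
  have hcop : Nat.Coprime v.1.1 v.1.2.2 := by
    have h1 := v.2.2.2.2.1
    have h2 := v.2.2.2.1
    have : Nat.gcd v.1.1 v.1.2.2 ∣ Nat.gcd v.1.1 (Nat.gcd v.1.2.1 v.1.2.2) := by
      apply Nat.dvd_gcd (Nat.gcd_dvd_left _ _)
      apply Nat.dvd_gcd _ (Nat.gcd_dvd_right _ _)
      have h3 : v.1.2.1 = v.1.2.2 - v.1.1 := by omega
      rw [h3]
      exact Nat.dvd_sub (Nat.gcd_dvd_right _ _) (Nat.gcd_dvd_left _ _)
    rw [h1] at this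
    exact Nat.dvd_one.mp this
  have e0 : P ^ L * V.1.1 = v.1.1 ^ (2 * N) * ξ 0 := hξ 0
  have e1 : P ^ L * V.1.2.1 = v.1.2.1 ^ (2 * N) * ξ 1 := hξ 1
  have e2 : P ^ L * V.1.2.2 = v.1.2.2 ^ (2 * N) * ξ 2 := hξ 2
  have hfin := height_bound N v.2.1 v.2.2.1 v.2.2.2.1 hcop ![(ξ 0 : ℤ), ξ 1, -ξ 2]
    (by have := hξ0 0; simp; omega) (P ^ (2 * L) : ℕ)
    (by
      intro i
      fin_cases i
      · simpa using (by exact_mod_cast hξle 0 : (ξ 0 : ℤ) ≤ P ^ (2 * L))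
      · simpa using (by exact_mod_cast hξle 1 : (ξ 1 : ℤ) ≤ P ^ (2 * L))
      · simpa using (by exact_mod_cast hξle 2 : (ξ 2 : ℤ) ≤ P ^ (2 * L)))
    (by
      have hs := V.2.2.2.1
      have h3 : ((ξ 0 * v.1.1 ^ (2 * N) + ξ 1 * v.1.2.1 ^ (2 * N) : ℕ) : ℤ) =
          ((ξ 2 * v.1.2.2 ^ (2 * N) : ℕ) : ℤ) := by
        congr 1
        rw [mul_comm, ← e0, mul_comm (ξ 1), ← e1, mul_comm (ξ 2), ← e2, ← hs]
        ring
      push_cast at h3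
      simp
      linarith)
  have hz : (0 : ℝ) < v.1.2.2 := by
    have := cpos v.1 v.2 2
    exact_mod_cast Nat.pos_of_ne_zero this
  have hfinR : (v.1.2.2 : ℝ) ^ (2 * N) ≤
      2 ^ (8 * N + 6) * (v.1.2.2 : ℝ) ^ (N + 1) * (P : ℝ) ^ (2 * L) := by
    exact_mod_cast hfin
  have hPR : (0 : ℝ) < P := by exact_mod_cast hPpos
  have hlog := Real.log_le_log (by positivity) hfinR
  rw [Real.log_mul (by positivity) (by positivity), Real.log_mul (by positivity) (by positivity),
    Real.log_pow, Real.log_pow, Real.log_pow, Real.log_pow, ← hh] at hlog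
  push_cast at hlog
  have hl2 : Real.log 2 ≤ 1 := by have := Real.log_two_lt_d9; linarith
  have hMpos : 0 < M := by linarith
  have hKh : h' / K * M ≤ h' / 16 := by
    rw [div_mul_eq_mul_div, div_le_iff₀ hKpos]
    nlinarith
  have hLM : (L : ℝ) * Real.log P ≤ h' / 16 + 5 * h * M := by
    calc (L : ℝ) * Real.log P ≤ (h' / K + 4 * h + 1) * M := by
          apply mul_le_mul hL2.le (by linarith) hlogP (by positivity)
      _ ≤ h' / 16 + 5 * h * M := by nlinarith
  have hl3 : (8 * (N : ℝ) + 6) * Real.log 2 ≤ 8 * N + 6 := by nlinarith [show (0:ℝ) ≤ N by positivity]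
  nlinarith [show (0:ℝ) ≤ N by positivity]

end PadeUnit

namespace LGrowth
open Complex Filter Asymptotics Topology MeasureTheory Set

/-- The integral `∫_1^∞ g(u) u^{-(s+1)} du`. -/
noncomputable def abelInt (g : ℝ → ℂ) (s : ℂ) : ℂ := ∫ u in Ioi (1 : ℝ), g u * (u : ℂ) ^ (-(s + 1))

theorem norm_abelInt_le {g : ℝ → ℂ} {K : ℝ} (hK : ∀ u, 1 < u → ‖g u‖ ≤ K) {s : ℂ} (hs : 0 < s.re) :
    ‖abelInt g s‖ ≤ K / s.re := by
  have h1 : ∀ u ∈ Ioi (1 : ℝ), ‖g u * (u : ℂ) ^ (-(s + 1))‖ ≤ K * u ^ (-s.re - 1) := by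
    intro u hu
    have hu0 : (0 : ℝ) < u := lt_trans zero_lt_one hu
    rw [norm_mul, norm_cpow_eq_rpow_re_of_pos hu0]
    have : (-(s + 1)).re = -s.re - 1 := by simp; ring
    rw [this]
    gcongr
    exact hK u hu
  have hInt : IntegrableOn (fun u : ℝ => K * u ^ (-s.re - 1)) (Ioi 1) :=
    (integrableOn_Ioi_rpow_of_lt (by linarith) zero_lt_one).const_mul K
  refine (norm_integral_le_of_norm_le hInt ?_).trans ?_
  · exact (ae_restrict_mem measurableSet_Ioi).mono h1
  · rw [integral_const_mul, integral_Ioi_rpow_of_lt (by linarith) zero_lt_one]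
    rw [Real.one_rpow]
    apply le_of_eq
    rw [show -s.re - 1 + 1 = -s.re by ring, neg_div_neg_eq, mul_one_div]

theorem abelInt_eq_mellin (g : ℝ → ℂ) (s : ℂ) :
    abelInt g s = mellin ((Ioi (1 : ℝ)).indicator g) (-s) := by
  unfold abelInt mellin
  rw [← integral_indicator measurableSet_Ioi, ← integral_indicator measurableSet_Ioi]
  congr 1
  ext u
  by_cases hu : u ∈ Ioi (1 : ℝ)
  · have hu0 : u ∈ Ioi (0 : ℝ) := mem_Ioi.mpr (lt_trans zero_lt_one (mem_Ioi.mp hu))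
    rw [indicator_of_mem hu, indicator_of_mem hu0, indicator_of_mem hu, smul_eq_mul, mul_comm]
    congr 2; ring
  · rw [indicator_of_notMem hu]
    have hu' : ¬ (1 : ℝ) < u := hu
    simp [Set.indicator, hu']

theorem differentiableAt_abelInt {g : ℝ → ℂ} {K : ℝ} (hg : Measurable g) (hK : ∀ u, 1 < u → ‖g u‖ ≤ K)
    {s : ℂ} (hs : 0 < s.re) : DifferentiableAt ℂ (abelInt g) s := by
  have hbound : ∀ u, ‖(Ioi (1 : ℝ)).indicator g u‖ ≤ |K| := by
    intro u
    by_cases hu : u ∈ Ioi (1 : ℝ)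
    · rw [indicator_of_mem hu]; exact (hK u hu).trans (le_abs_self _)
    · rw [indicator_of_notMem hu, norm_zero]; positivity
  have h1 : DifferentiableAt ℂ (mellin ((Ioi (1 : ℝ)).indicator g)) (-s) := by
    apply mellin_differentiableAt_of_isBigO_rpow (a := 0) (b := -s.re - 1)
    · apply LocallyIntegrable.locallyIntegrableOn
      apply (locallyIntegrable_const |K|).mono
      · exact (hg.indicator measurableSet_Ioi).aestronglyMeasurable
      · exact Eventually.of_forall fun u => (hbound u).trans (by simp)
    · apply IsBigO.of_bound |K|
      filter_upwards with u
      simpa using hbound u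
    · simpa using hs
    · apply IsBigO.of_bound 0
      have : Iio (1 : ℝ) ∈ 𝓝[>] (0 : ℝ) := mem_nhdsWithin_of_mem_nhds (Iio_mem_nhds zero_lt_one)
      filter_upwards [this] with u hu
      rw [indicator_of_notMem (by simpa using hu.le)]
      simp
    · simp
  have : abelInt g = fun s => mellin ((Ioi (1 : ℝ)).indicator g) (-s) :=
    funext (abelInt_eq_mellin g)
  rw [this]
  exact h1.comp s differentiable_neg.differentiableAt

theorem isPreconnected_halfPlane : IsPreconnected {s : ℂ | 0 < s.re} :=
  (convex_halfSpace_re_gt 0).isPreconnected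

theorem isOpen_halfPlane (a : ℝ) : IsOpen {s : ℂ | a < s.re} :=
  isOpen_lt continuous_const continuous_re

/-- Identity theorem from `Re s > 1` to `Re s > 0`. -/
theorem eq_of_eq_on_re_gt_one {f g : ℂ → ℂ} (hf : ∀ s : ℂ, 0 < s.re → DifferentiableAt ℂ f s)
    (hg : ∀ s : ℂ, 0 < s.re → DifferentiableAt ℂ g s) (h : ∀ s : ℂ, 1 < s.re → f s = g s)
    {s : ℂ} (hs : 0 < s.re) : f s = g s := by
  have hfa : AnalyticOnNhd ℂ f {s : ℂ | 0 < s.re} :=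
    DifferentiableOn.analyticOnNhd (fun z hz => (hf z hz).differentiableWithinAt)
      (isOpen_halfPlane 0)
  have hga : AnalyticOnNhd ℂ g {s : ℂ | 0 < s.re} :=
    DifferentiableOn.analyticOnNhd (fun z hz => (hg z hz).differentiableWithinAt)
      (isOpen_halfPlane 0)
  refine hfa.eqOn_of_preconnected_of_eventuallyEq hga isPreconnected_halfPlane
    (show (2 : ℂ) ∈ {s : ℂ | 0 < s.re} by simp) ?_ hs
  filter_upwards [(isOpen_halfPlane 1).mem_nhds (show (2 : ℂ) ∈ {s : ℂ | 1 < s.re} by simp)]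
    with z hz using h z hz

theorem sum_range_periodic {r : ℕ} (hr : 0 < r) (f : ℕ → ℂ) (hp : ∀ k, f (r + k) = f k)
    (h0 : ∑ k ∈ Finset.range r, f k = 0) (n : ℕ) :
    ∑ k ∈ Finset.range n, f k = ∑ k ∈ Finset.range (n % r), f k := by
  induction n using Nat.strong_induction_on with
  | _ n ih =>
    by_cases h : n < r
    · rw [Nat.mod_eq_of_lt h]
    · obtain ⟨m, rfl⟩ := Nat.exists_eq_add_of_le (not_lt.mp h)
      rw [Finset.sum_range_add, h0, zero_add]
      simp only [hp]
      rw [ih m (by omega), Nat.add_mod_left]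

theorem norm_sum_char_le {r : ℕ} [NeZero r] {χ : DirichletCharacter ℂ r} (hχ : χ ≠ 1) (n : ℕ) :
    ‖∑ k ∈ Finset.Icc 1 n, χ k‖ ≤ r := by
  have hr1 : r ≠ 1 := by
    rintro rfl
    exact hχ (Subsingleton.elim _ _)
  have h00 : χ ((0 : ℕ) : ZMod r) = 0 := by
    have : Nontrivial (ZMod r) := ZMod.nontrivial_iff.mpr hr1
    rw [Nat.cast_zero]
    exact MulChar.map_nonunit χ (by simp)
  have e1 : ∑ k ∈ Finset.Icc 1 n, χ (k : ZMod r) = ∑ k ∈ Finset.range (n + 1), χ (k : ZMod r) := by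
    induction n with
    | zero => simpa using h00.symm
    | succ n ih => rw [Finset.sum_Icc_succ_top (by omega), ih, Finset.sum_range_succ _ (n + 1)]
  have hz : ∑ k ∈ Finset.range r, χ (k : ZMod r) = 0 := by
    rw [← MulChar.sum_eq_zero_of_ne_one hχ]
    obtain ⟨m, rfl⟩ := Nat.exists_eq_succ_of_ne_zero (NeZero.ne r)
    rw [← Fin.sum_univ_eq_sum_range (fun k => χ (k : ZMod (m + 1)))]
    apply Finset.sum_congr rfl
    intro a _
    congr 1
    exact Fin.cast_val_eq_self a
  rw [e1, sum_range_periodic (NeZero.pos r) (fun k => χ (k : ZMod r)) (by intro k; simp) hz]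
  refine (norm_sum_le _ _).trans ?_
  refine (Finset.sum_le_card_nsmul _ _ 1 fun k _ => χ.norm_le_one _).trans ?_
  simp only [Finset.card_range, nsmul_eq_mul, mul_one]
  exact_mod_cast (Nat.mod_lt _ (NeZero.pos r)).le

theorem measurable_floor_comp (f : ℕ → ℂ) : Measurable fun u : ℝ => f ⌊u⌋₊ :=
  (measurable_from_nat (f := f)).comp Nat.measurable_floor

theorem LFunction_eq_abelInt {r : ℕ} [NeZero r] {χ : DirichletCharacter ℂ r} (hχ : χ ≠ 1) {s : ℂ}
    (hs : 0 < s.re) : DirichletCharacter.LFunction χ s =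
      s * abelInt (fun u => ∑ k ∈ Finset.Icc 1 ⌊u⌋₊, χ k) s := by
  have hm := measurable_floor_comp (fun n => ∑ k ∈ Finset.Icc 1 n, χ k)
  refine eq_of_eq_on_re_gt_one (f := DirichletCharacter.LFunction χ)
    (g := fun s => s * abelInt (fun u => ∑ k ∈ Finset.Icc 1 ⌊u⌋₊, χ k) s) ?_ ?_ ?_ hs
  · intro z _
    exact (DirichletCharacter.differentiable_LFunction hχ) z
  · intro z hz
    exact differentiableAt_id.mul
      (differentiableAt_abelInt hm (fun u _ => norm_sum_char_le hχ _) hz)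
  · intro z hz
    rw [DirichletCharacter.LFunction_eq_LSeries χ hz]
    refine LSeries_eq_mul_integral _ (r := 0) le_rfl (by linarith)
      (DirichletCharacter.LSeriesSummable_of_one_lt_re χ hz) ?_
    apply IsBigO.of_bound r
    filter_upwards with n
    simpa using norm_sum_char_le hχ n

theorem norm_LFunction_le {r : ℕ} [NeZero r] {χ : DirichletCharacter ℂ r} (hχ : χ ≠ 1) {s : ℂ}
    (hs : 1 / 2 ≤ s.re) : ‖DirichletCharacter.LFunction χ s‖ ≤ 2 * r * ‖s‖ := by
  rw [LFunction_eq_abelInt hχ (by linarith), norm_mul]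
  have := norm_abelInt_le (g := fun u => ∑ k ∈ Finset.Icc 1 ⌊u⌋₊, χ k)
    (fun u _ => norm_sum_char_le hχ _) (s := s) (by linarith)
  have h2 : (r : ℝ) / s.re ≤ 2 * r := by
    rw [div_le_iff₀ (by linarith)]
    have : (0 : ℝ) ≤ r := by positivity
    nlinarith
  calc _ ≤ ‖s‖ * (2 * r) := by gcongr; exact this.trans h2
    _ = _ := by ring

/-- `(s - 1) ζ(s)`, an entire function. -/
noncomputable abbrev zetaMul : ℂ → ℂ := DirichletCharacter.LFunctionTrivChar₁ 1

theorem zetaMul_eq {s : ℂ} (hs : s ≠ 1) : zetaMul s = (s - 1) * riemannZeta s := by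
  unfold zetaMul DirichletCharacter.LFunctionTrivChar₁
  rw [Function.update_of_ne hs]
  unfold DirichletCharacter.LFunctionTrivChar
  rw [DirichletCharacter.LFunction_modOne_eq]

theorem norm_floor_sub_le (u : ℝ) (hu : 1 < u) : ‖((⌊u⌋₊ : ℂ) - u)‖ ≤ 1 := by
  have h1 := Nat.floor_le (show 0 ≤ u by linarith)
  have h2 := Nat.lt_floor_add_one u
  rw [show ((⌊u⌋₊ : ℂ) - u) = (((⌊u⌋₊ : ℝ) - u : ℝ) : ℂ) by push_cast; rfl, norm_real,
    Real.norm_eq_abs, abs_le]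
  constructor <;> linarith

theorem zetaMul_eq_abelInt {s : ℂ} (hs : 0 < s.re) :
    zetaMul s = s + s * (s - 1) * abelInt (fun u => (⌊u⌋₊ : ℂ) - u) s := by
  have hm : Measurable fun u : ℝ => (⌊u⌋₊ : ℂ) - u :=
    (measurable_floor_comp (fun n => (n : ℂ))).sub measurable_ofReal
  refine eq_of_eq_on_re_gt_one (f := zetaMul)
    (g := fun s => s + s * (s - 1) * abelInt (fun u => (⌊u⌋₊ : ℂ) - u) s) ?_ ?_ ?_ hs
  · intro z _
    exact DirichletCharacter.differentiable_LFunctionTrivChar₁ 1 z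
  · intro z hz
    exact differentiableAt_id.add ((differentiableAt_id.mul
      (differentiableAt_id.sub_const 1)).mul (differentiableAt_abelInt hm norm_floor_sub_le hz))
  · intro z hz
    have hz1 : z ≠ 1 := by rintro rfl; simp at hz
    rw [zetaMul_eq hz1]
    have h1 : riemannZeta z = z * ∫ t in Ioi (1 : ℝ), (∑ k ∈ Finset.Icc 1 ⌊t⌋₊, (1 : ℕ → ℂ) k) *
        (t : ℂ) ^ (-(z + 1)) := by
      rw [← LSeries_one_eq_riemannZeta hz]
      refine LSeries_eq_mul_integral _ (r := 1) zero_le_one hz (LSeriesSummable_one_iff.mpr hz) ?_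
      apply IsBigO.of_bound 1
      filter_upwards with n
      simp
    have h2 : abelInt (fun u => (⌊u⌋₊ : ℂ) - u) z =
        (∫ t in Ioi (1 : ℝ), (∑ k ∈ Finset.Icc 1 ⌊t⌋₊, (1 : ℕ → ℂ) k) *
        (t : ℂ) ^ (-(z + 1))) - ∫ t in Ioi (1 : ℝ), (t : ℂ) ^ (-z) := by
      have i2 : IntegrableOn (fun t : ℝ => (t : ℂ) ^ (-z)) (Ioi 1) :=
        integrableOn_Ioi_cpow_of_lt (by simpa using hz) zero_lt_one
      rw [← integral_sub _ i2]
      · unfold abelInt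
        apply setIntegral_congr_fun measurableSet_Ioi
        intro t ht
        have ht0 : (t : ℂ) ≠ 0 := by
          have : (0 : ℝ) < t := lt_trans zero_lt_one ht
          exact_mod_cast this.ne'
        simp only [Pi.one_apply, Finset.sum_const, Nat.card_Icc, nsmul_eq_mul, mul_one,
          Nat.add_sub_cancel]
        rw [sub_mul, neg_add, ← sub_eq_add_neg, cpow_sub _ _ ht0, cpow_one]
        congr 1
        field_simp
      · apply Integrable.mono i2.norm
        · apply Measurable.aestronglyMeasurable
          apply Measurable.mul
          · exact measurable_floor_comp (fun n => ∑ k ∈ Finset.Icc 1 n, (1 : ℕ → ℂ) k)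
          · exact measurable_ofReal.pow_const _
        · refine (ae_restrict_mem measurableSet_Ioi).mono fun t ht => ?_
          have ht0 : (0 : ℝ) < t := lt_trans zero_lt_one ht
          simp only [Pi.one_apply, Finset.sum_const, Nat.card_Icc, nsmul_eq_mul, mul_one,
            Nat.add_sub_cancel, norm_mul, norm_norm]
          rw [norm_cpow_eq_rpow_re_of_pos ht0, norm_cpow_eq_rpow_re_of_pos ht0]
          have e : (-(z + 1)).re = (-z).re - 1 := by simp; ring
          rw [e, Real.rpow_sub_one ht0.ne', norm_natCast]
          have := Nat.floor_le ht0.le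
          have h3 : 0 ≤ t ^ (-z).re := Real.rpow_nonneg ht0.le _
          calc (⌊t⌋₊ : ℝ) * (t ^ (-z).re / t) ≤ t * (t ^ (-z).re / t) := by gcongr
            _ = _ := by field_simp
    rw [h2, mul_sub, integral_Ioi_cpow_of_lt (by simpa using hz) zero_lt_one, h1]
    have : (-z + 1) ≠ 0 := by
      intro h
      apply hz1
      linear_combination -h
    simp only [ofReal_one, one_cpow]
    field_simp
    ring

theorem norm_zetaMul_le {s : ℂ} (hs : 1 / 2 ≤ s.re) :
    ‖zetaMul s‖ ≤ ‖s‖ * (2 * ‖s‖ + 3) := by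
  rw [zetaMul_eq_abelInt (by linarith)]
  have h1 := norm_abelInt_le norm_floor_sub_le (s := s) (by linarith)
  have h2 : (1 : ℝ) / s.re ≤ 2 := by
    rw [div_le_iff₀ (by linarith)]; linarith
  have h3 : ‖s - 1‖ ≤ ‖s‖ + 1 := (norm_sub_le _ _).trans (by simp)
  calc _ ≤ ‖s‖ + ‖s * (s - 1) * abelInt (fun u => (⌊u⌋₊ : ℂ) - u) s‖ := norm_add_le _ _
    _ ≤ ‖s‖ + ‖s‖ * (‖s‖ + 1) * 2 := by
      rw [norm_mul, norm_mul]
      gcongr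
      exact h1.trans h2
    _ = _ := by ring

end LGrowth

namespace LGrowth
open Complex Filter Asymptotics Topology MeasureTheory Set Metric

/-- A Borel–Carathéodory bound for the logarithmic derivative of a nonvanishing function. -/
theorem norm_logDeriv_le {h : ℂ → ℂ} {c : ℂ} {R M δ : ℝ} (hM : 0 < M) (hδ : 0 < δ)
    (hd : DifferentiableOn ℂ h (ball c R)) (hne : ∀ z ∈ ball c R, h z ≠ 0)
    (hb : ∀ z ∈ ball c R, ‖h z‖ ≤ Real.exp M * ‖h c‖) {s : ℂ} (hs : dist s c ≤ R - δ) :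
    ‖deriv h s / h s‖ ≤ 8 * M * R / δ ^ 2 := by
  have hR : 0 < R := by have := dist_nonneg (x := s) (y := c); linarith
  have hcR : c ∈ ball c R := mem_ball_self hR
  have hdd : DifferentiableOn ℂ (fun z => deriv h z / h z) (ball c R) :=
    (hd.deriv isOpen_ball).div hd hne
  obtain ⟨g, hg0, hg⟩ := hdd.isExactOn_ball.with_val_at c 0
  have hconst : ∀ z ∈ ball c R, h z * exp (-g z) = h c := by
    intro z hz
    have key : ∀ w ∈ ball c R, HasDerivAt (fun z => h z * exp (-g z)) 0 w := by
      intro w hw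
      have h1 : HasDerivAt h (deriv h w) w :=
        (hd.differentiableAt (isOpen_ball.mem_nhds hw)).hasDerivAt
      have h2 := h1.mul ((hg w hw).neg.cexp)
      have h3 : deriv h w * exp (-g w) + h w * (exp (-g w) * -(deriv h w / h w)) = 0 := by
        have := hne w hw
        field_simp
        ring
      rw [← h3]
      exact h2
    have := (convex_ball c R).is_const_of_fderivWithin_eq_zero (𝕜 := ℂ)
      (f := fun z => h z * exp (-g z))
      (fun w hw => (key w hw).differentiableAt.differentiableWithinAt) (fun w hw => by
        rw [fderivWithin_of_isOpen isOpen_ball hw, (key w hw).hasFDerivAt.fderiv]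
        ext; simp) hz hcR
    simpa [hg0] using this
  have hre : ∀ z ∈ ball c R, (g z).re ≤ M := by
    intro z hz
    have h1 : h z = h c * exp (g z) := by
      rw [← hconst z hz, mul_assoc, ← exp_add]; simp
    have h2 := hb z hz
    rw [h1, norm_mul, norm_exp, mul_comm] at h2
    exact Real.exp_le_exp.mp (le_of_mul_le_mul_right h2 (norm_pos_iff.mpr (hne c hcR)))
  have hgd : DifferentiableOn ℂ g (ball c R) :=
    fun w hw => (hg w hw).differentiableAt.differentiableWithinAt
  have hbound : ∀ z, dist z c ≤ R - δ / 2 → ‖g z‖ ≤ 4 * M * R / δ := by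
    intro z hz
    have hzR : dist z c < R := by linarith
    have hmap : ∀ w ∈ ball (0 : ℂ) R, c + w ∈ ball c R := by
      intro w hw
      simpa [mem_ball, dist_eq_norm] using hw
    have := borelCaratheodory_zero (f := fun w => g (c + w)) (z := z - c) hM (R := R)
      (hgd.comp (by fun_prop) hmap) (fun w hw => hre _ (hmap w hw)) hR
      (by simpa [mem_ball, dist_eq_norm] using hzR) (by simpa using hg0)
    rw [add_sub_cancel, ← dist_eq_norm] at this
    refine this.trans ?_
    rw [div_le_div_iff₀ (by linarith) hδ]
    have h1 : dist z c * δ ≤ R * δ := by gcongr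
    have h2 : R * (δ / 2) ≤ R * (R - dist z c) := by gcongr; linarith
    nlinarith
  have hsR : s ∈ ball c R := by rw [mem_ball]; linarith
  have hcl : closedBall s (δ / 2) ⊆ ball c R := by
    intro w hw
    rw [mem_closedBall] at hw
    rw [mem_ball]
    linarith [dist_triangle w s c]
  have := norm_deriv_le_of_forall_mem_sphere_norm_le (f := g) (c := s) (R := δ / 2)
    (C := 4 * M * R / δ) (by linarith)
    ((hgd.mono hcl).diffContOnCl_ball (by rfl)) (fun z hz => hbound z (by
      rw [mem_sphere] at hz
      linarith [dist_triangle z s c]))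
  rw [(hg s hsR).deriv] at this
  refine this.trans (le_of_eq ?_)
  field_simp
  ring

theorem norm_LSeries_ge {f : ℕ → ℂ} (hf : ∀ n, ‖f n‖ ≤ 1) (h1 : f 1 = 1) {s : ℂ} (hs : s.re = 2) :
    1 / 4 ≤ ‖LSeries f s‖ := by
  have hz := hasSum_zeta_two
  have hle : ∀ n, ‖LSeries.term f s n‖ ≤ 1 / (n : ℝ) ^ 2 := by
    intro n
    rw [LSeries.norm_term_eq, hs]
    split_ifs with h
    · simp
    · rw [Real.rpow_two]
      gcongr
      exact hf n
  have hsum : Summable (LSeries.term f s) := hz.summable.of_norm_bounded hle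
  have e1 : LSeries f s = 1 + ∑' n, ite (n = 1) 0 (LSeries.term f s n) := by
    unfold LSeries
    rw [hsum.tsum_eq_add_tsum_ite 1]
    simp [LSeries.term, h1]
  have hz' : HasSum (fun n : ℕ => ite (n = 1) 0 (1 / (n : ℝ) ^ 2)) (Real.pi ^ 2 / 6 - 1) := by
    have h2 := hz.update 1 (0 : ℝ)
    have e3 : (0 : ℝ) - 1 / ((1 : ℕ) : ℝ) ^ 2 + Real.pi ^ 2 / 6 = Real.pi ^ 2 / 6 - 1 := by
      norm_num; ring
    rw [e3] at h2
    refine h2.congr_fun fun n => ?_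
    by_cases hn : n = 1 <;> simp [hn]
  have e2 : ‖∑' n, ite (n = 1) 0 (LSeries.term f s n)‖ ≤ Real.pi ^ 2 / 6 - 1 := by
    refine tsum_of_norm_bounded hz' fun n => ?_
    by_cases hn : n = 1
    · simp [hn]
    · simpa [hn] using hle n
  have hpi : Real.pi ^ 2 / 6 - 1 ≤ 3 / 4 := by
    have := Real.pi_lt_d2
    have := Real.pi_pos
    nlinarith
  rw [e1]
  have h3 := norm_sub_norm_le (1 : ℂ) (-∑' n, ite (n = 1) 0 (LSeries.term f s n))
  rw [norm_neg, norm_one, sub_neg_eq_add] at h3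
  linarith

theorem LFunction_ne_zero_of_GRH (hG : GRH) {r : ℕ} [NeZero r] {χ : DirichletCharacter ℂ r}
    (hχ : χ ≠ 1) {s : ℂ} (hs : 1 / 2 < s.re) : DirichletCharacter.LFunction χ s ≠ 0 := by
  intro h
  rcases lt_or_ge s.re 1 with h1 | h1
  · exact hs.ne' (hG.2 r χ s (by linarith) h1 h)
  · exact DirichletCharacter.LFunction_ne_zero_of_one_le_re χ (Or.inl hχ) h1 h

theorem zetaMul_ne_zero_of_GRH (hG : GRH) {s : ℂ} (hs : 1 / 2 < s.re) : zetaMul s ≠ 0 := by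
  by_cases h1 : s = 1
  · rw [h1]; exact DirichletCharacter.LFunctionTrivChar₁_apply_one_ne_zero 1
  rw [zetaMul_eq h1]
  refine mul_ne_zero (sub_ne_zero.mpr h1) fun h => ?_
  rcases lt_or_ge s.re 1 with h2 | h2
  · exact hs.ne' (hG.1 s (by linarith) h2 h)
  · exact riemannZeta_ne_zero_of_one_le_re h2 h

theorem re_gt_of_mem_ball {t : ℝ} {z : ℂ} (hz : z ∈ ball (2 + t * I : ℂ) (3 / 2)) :
    1 / 2 < z.re ∧ ‖z‖ ≤ |t| + 4 := by
  rw [mem_ball, dist_eq_norm] at hz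
  constructor
  · have := (abs_le.mp ((abs_re_le_norm _).trans hz.le)).1
    simp at this
    have h2 := abs_re_le_norm (z - (2 + t * I))
    have h3 := (abs_lt.mp (h2.trans_lt hz)).1
    simp at h3
    linarith
  · have h1 : ‖(2 + t * I : ℂ)‖ ≤ 2 + |t| := by
      refine (norm_add_le _ _).trans ?_
      simp
    have := norm_le_norm_sub_add z (2 + t * I)
    linarith

theorem dist_le_of_re {δ : ℝ} {s : ℂ} (h1 : 1 / 2 + δ ≤ s.re) (h2 : s.re ≤ 2) :
    dist s (2 + s.im * I) ≤ 3 / 2 - δ := by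
  rw [dist_eq_norm]
  have : s - (2 + s.im * I) = ((s.re - 2 : ℝ) : ℂ) := by
    apply Complex.ext <;> simp
  rw [this, norm_real, Real.norm_eq_abs, abs_le]
  constructor <;> linarith

theorem norm_logDeriv_LFunction_le (hG : GRH) {r : ℕ} [NeZero r] {χ : DirichletCharacter ℂ r}
    (hχ : χ ≠ 1) {δ : ℝ} (hδ : 0 < δ) {s : ℂ} (h1 : 1 / 2 + δ ≤ s.re) (h2 : s.re ≤ 2) :
    ‖deriv (DirichletCharacter.LFunction χ) s / DirichletCharacter.LFunction χ s‖ ≤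
      36 / δ ^ 2 * Real.log (r * (|s.im| + 4)) := by
  set x : ℝ := r * (|s.im| + 4) with hx
  have hr : (1 : ℝ) ≤ r := by exact_mod_cast NeZero.one_le
  have hx4 : 4 ≤ x := by
    have := abs_nonneg s.im
    nlinarith
  have hlog : 0 < Real.log x := Real.log_pos (by linarith)
  have hc : 1 / 4 ≤ ‖DirichletCharacter.LFunction χ (2 + s.im * I)‖ := by
    have hre : (2 + s.im * I : ℂ).re = 2 := by simp
    rw [DirichletCharacter.LFunction_eq_LSeries χ (by rw [hre]; norm_num)]
    exact norm_LSeries_ge (fun n => χ.norm_le_one _) (by simp) hre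
  refine (norm_logDeriv_le (c := 2 + s.im * I) (R := 3 / 2) (M := 3 * Real.log x) (by positivity) hδ
    (DirichletCharacter.differentiable_LFunction hχ).differentiableOn
    (fun z hz => LFunction_ne_zero_of_GRH hG hχ (re_gt_of_mem_ball hz).1) (fun z hz => ?_)
    (dist_le_of_re h1 h2)).trans (le_of_eq (by ring))
  have hb := re_gt_of_mem_ball hz
  have he : Real.exp (3 * Real.log x) = x ^ 3 := by
    rw [mul_comm, Real.exp_mul, Real.exp_log (by linarith)]; norm_cast
  rw [he]
  calc ‖DirichletCharacter.LFunction χ z‖ ≤ 2 * r * ‖z‖ := norm_LFunction_le hχ hb.1.le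
    _ ≤ 2 * r * (|s.im| + 4) := by gcongr; exact hb.2
    _ = 2 * x := by rw [hx]; ring
    _ ≤ x ^ 3 * (1 / 4) := by nlinarith [mul_self_nonneg (x - 4)]
    _ ≤ _ := by gcongr

theorem norm_logDeriv_zetaMul_le (hG : GRH) {δ : ℝ} (hδ : 0 < δ) {s : ℂ} (h1 : 1 / 2 + δ ≤ s.re)
    (h2 : s.re ≤ 2) :
    ‖deriv zetaMul s / zetaMul s‖ ≤ 48 / δ ^ 2 * Real.log (|s.im| + 4) := by
  set x : ℝ := |s.im| + 4 with hx
  have hx4 : 4 ≤ x := by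
    have := abs_nonneg s.im
    linarith
  have hlog : 0 < Real.log x := Real.log_pos (by linarith)
  have hc : 1 / 4 ≤ ‖zetaMul (2 + s.im * I)‖ := by
    have hre : (2 + s.im * I : ℂ).re = 2 := by simp
    have hne : (2 + s.im * I : ℂ) ≠ 1 := by
      intro h; have := congrArg Complex.re h; simp at this
    rw [zetaMul_eq hne, norm_mul, ← LSeries_one_eq_riemannZeta (by rw [hre]; norm_num)]
    have h3 := norm_LSeries_ge (f := 1) (fun n => by simp) (by simp) hre
    have h4 : 1 ≤ ‖(2 + s.im * I - 1 : ℂ)‖ := by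
      refine le_trans ?_ (abs_re_le_norm _)
      simp; norm_num
    nlinarith [norm_nonneg (LSeries 1 (2 + s.im * I))]
  refine (norm_logDeriv_le (c := 2 + s.im * I) (R := 3 / 2) (M := 4 * Real.log x) (by positivity) hδ
    (DirichletCharacter.differentiable_LFunctionTrivChar₁ 1).differentiableOn
    (fun z hz => zetaMul_ne_zero_of_GRH hG (re_gt_of_mem_ball hz).1) (fun z hz => ?_)
    (dist_le_of_re h1 h2)).trans (le_of_eq (by ring))
  have hb := re_gt_of_mem_ball hz
  have he : Real.exp (4 * Real.log x) = x ^ 4 := by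
    rw [mul_comm, Real.exp_mul, Real.exp_log (by linarith)]; norm_cast
  rw [he]
  calc ‖zetaMul z‖ ≤ ‖z‖ * (2 * ‖z‖ + 3) := norm_zetaMul_le hb.1.le
    _ ≤ x * (2 * x + 3) := by have := hb.2; gcongr
    _ ≤ x ^ 4 * (1 / 4) := by
      have h16 : 16 ≤ x ^ 2 := by nlinarith
      have : 2 * x ^ 2 + 3 * x ≤ 4 * x ^ 2 := by nlinarith
      nlinarith
    _ ≤ _ := by gcongr

end LGrowth

namespace LGrowth
open Complex Filter Asymptotics Topology MeasureTheory Set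

/-- The truncated power `(1 - x)_+^J`. -/
noncomputable def trunc (J : ℕ) (x : ℝ) : ℝ := max (1 - x) 0 ^ J

/-- The Mellin transform `J! / (w (w + 1) ⋯ (w + J))` of the truncated power. -/
noncomputable def perronKernel (J : ℕ) (w : ℂ) : ℂ :=
  J.factorial / ∏ j ∈ Finset.range (J + 1), (w + j)

theorem continuous_trunc (J : ℕ) : Continuous (trunc J) := by
  unfold trunc
  fun_prop

theorem trunc_nonneg (J : ℕ) (x : ℝ) : 0 ≤ trunc J x := by unfold trunc; positivity

theorem trunc_le_one (J : ℕ) {x : ℝ} (hx : 0 ≤ x) : trunc J x ≤ 1 := by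
  unfold trunc
  exact pow_le_one₀ (le_max_right _ _) (max_le (by linarith) zero_le_one)

theorem trunc_of_one_le {J : ℕ} (hJ : J ≠ 0) {x : ℝ} (hx : 1 ≤ x) : trunc J x = 0 := by
  unfold trunc
  rw [max_eq_right (by linarith), zero_pow hJ]

theorem mellinConvergent_trunc {J : ℕ} (hJ : J ≠ 0) {s : ℂ} (hs : 0 < s.re) :
    MellinConvergent (fun x => (trunc J x : ℂ)) s := by
  apply mellinConvergent_of_isBigO_rpow (a := s.re + 1) (b := 0)
  · exact (continuous_ofReal.comp (continuous_trunc J)).locallyIntegrable.locallyIntegrableOn _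
  · apply IsBigO.of_bound 0
    filter_upwards [eventually_ge_atTop 1] with x hx
    rw [trunc_of_one_le hJ hx]; simp
  · linarith
  · apply IsBigO.of_bound 1
    filter_upwards [self_mem_nhdsWithin] with x hx
    rw [norm_real, Real.norm_of_nonneg (trunc_nonneg J x)]
    simpa using trunc_le_one J (le_of_lt hx)
  · exact hs

theorem mellin_trunc {J : ℕ} (hJ : J ≠ 0) {s : ℂ} (hs : 0 < s.re) :
    mellin (fun x => (trunc J x : ℂ)) s = perronKernel J s := by
  unfold perronKernel
  rw [← betaIntegral_eval_nat_add_one_right hs, betaIntegral,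
    intervalIntegral.integral_of_le zero_le_one, mellin, ← Ioc_union_Ioi_eq_Ioi zero_le_one,
    setIntegral_union (Ioc_disjoint_Ioi le_rfl) measurableSet_Ioi]
  · have h0 : ∫ t in Ioi (1 : ℝ), (t : ℂ) ^ (s - 1) • (trunc J t : ℂ) = 0 := by
      apply setIntegral_eq_zero_of_forall_eq_zero
      intro t ht
      rw [trunc_of_one_le hJ (le_of_lt ht)]; simp
    rw [h0, add_zero]
    apply setIntegral_congr_fun measurableSet_Ioc
    intro t ht
    simp only [smul_eq_mul, add_sub_cancel_right, trunc]
    rw [max_eq_left (by linarith [ht.2])]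
    congr 1
    rw [cpow_natCast]
    push_cast
    rfl
  · exact (mellinConvergent_trunc hJ hs).mono_set Ioc_subset_Ioi_self
  · exact (mellinConvergent_trunc hJ hs).mono_set (Ioi_subset_Ioi zero_le_one)

theorem re_add_natCast (w : ℂ) (j : ℕ) : (w + j).re = w.re + j := by simp

theorem add_natCast_ne_zero {w : ℂ} (hw : 0 < w.re) (j : ℕ) : w + j ≠ 0 := by
  intro h
  have := congrArg Complex.re h
  rw [re_add_natCast, zero_re] at this
  have : (0 : ℝ) ≤ j := by positivity
  linarith

theorem norm_le_norm_add_natCast {w : ℂ} (hw : 0 ≤ w.re) (j : ℕ) : ‖w‖ ≤ ‖w + j‖ := by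
  rw [← sq_le_sq₀ (norm_nonneg _) (norm_nonneg _), Complex.sq_norm, Complex.sq_norm, normSq_apply,
    normSq_apply]
  have : (0 : ℝ) ≤ j := by positivity
  simp
  nlinarith

theorem norm_perronKernel_le {J : ℕ} (hJ : 3 ≤ J) {w : ℂ} (hw : 1 / 2 ≤ w.re) :
    ‖perronKernel J w‖ ≤ 16 * J.factorial / (1 + w.im ^ 2) ^ 2 := by
  have h1 : (1 + w.im ^ 2) / 4 ≤ ‖w‖ ^ 2 := by
    rw [Complex.sq_norm, normSq_apply]
    nlinarith [sq_nonneg w.im]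
  have h2 : ‖w‖ ^ 4 ≤ ‖∏ j ∈ Finset.range (J + 1), (w + j)‖ := by
    rw [norm_prod, ← Finset.prod_range_mul_prod_Ico _ (show 4 ≤ J + 1 by omega)]
    have h3 : ‖w‖ ^ 4 ≤ ∏ j ∈ Finset.range 4, ‖w + (j : ℂ)‖ := by
      calc ‖w‖ ^ 4 = ∏ j ∈ Finset.range 4, ‖w‖ := by simp
        _ ≤ _ := Finset.prod_le_prod (fun _ _ => norm_nonneg _)
          (fun j _ => norm_le_norm_add_natCast (by linarith) j)
    have h4 : 1 ≤ ∏ j ∈ Finset.Ico 4 (J + 1), ‖w + (j : ℂ)‖ := by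
      calc (1 : ℝ) = ∏ j ∈ Finset.Ico 4 (J + 1), 1 := by simp
        _ ≤ _ := by
          refine Finset.prod_le_prod (fun _ _ => zero_le_one) fun j hj => ?_
          refine le_trans ?_ (re_le_norm _)
          rw [re_add_natCast]
          have : (4 : ℝ) ≤ j := by exact_mod_cast (Finset.mem_Ico.mp hj).1
          linarith
    calc ‖w‖ ^ 4 = ‖w‖ ^ 4 * 1 := (mul_one _).symm
      _ ≤ _ := by gcongr
  unfold perronKernel
  rw [norm_div, Complex.norm_natCast]
  have h5 : ((1 + w.im ^ 2) / 4) ^ 2 ≤ ‖w‖ ^ 4 := by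
    calc _ ≤ (‖w‖ ^ 2) ^ 2 := by gcongr
      _ = _ := by ring
  have h6 : 0 < ((1 + w.im ^ 2) / 4) ^ 2 := by positivity
  calc _ ≤ (J.factorial : ℝ) / ((1 + w.im ^ 2) / 4) ^ 2 := by
        gcongr
        exact h5.trans h2
    _ = _ := by field_simp; norm_num

theorem norm_perronKernel_one_add_le (J : ℕ) (t : ℝ) :
    ‖perronKernel J (1 + t * I)‖ ≤ J.factorial * 2 ^ (J + 1) / (1 + |t|) ^ (J + 1) := by
  have h1 : (1 + |t|) / 2 ≤ ‖(1 + t * I : ℂ)‖ := by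
    have a := abs_re_le_norm (1 + t * I : ℂ)
    have b := abs_im_le_norm (1 + t * I : ℂ)
    simp at a b
    linarith
  have h2 : ((1 + |t|) / 2) ^ (J + 1) ≤ ‖∏ j ∈ Finset.range (J + 1), ((1 + t * I : ℂ) + j)‖ := by
    rw [norm_prod]
    calc _ = ∏ j ∈ Finset.range (J + 1), ((1 + |t|) / 2) := by simp [div_pow]
      _ ≤ _ := Finset.prod_le_prod (fun _ _ => by positivity)
        (fun j _ => h1.trans (norm_le_norm_add_natCast (by simp) j))
  unfold perronKernel
  rw [norm_div, Complex.norm_natCast]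
  calc _ ≤ (J.factorial : ℝ) / ((1 + |t|) / 2) ^ (J + 1) := by gcongr
    _ = _ := by rw [div_pow]; field_simp

theorem differentiableAt_perronKernel (J : ℕ) {w : ℂ} (hw : 0 < w.re) :
    DifferentiableAt ℂ (perronKernel J) w := by
  unfold perronKernel
  apply DifferentiableAt.div
  · fun_prop
  · fun_prop
  · exact Finset.prod_ne_zero_iff.mpr fun j _ => add_natCast_ne_zero hw j

theorem integrable_inv_one_add_sq_sq : Integrable fun v : ℝ => ((1 + v ^ 2) ^ 2)⁻¹ := by
  apply integrable_inv_one_add_sq.mono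
  · apply Measurable.aestronglyMeasurable; fun_prop
  · refine Eventually.of_forall fun v => ?_
    rw [Real.norm_of_nonneg (by positivity), Real.norm_of_nonneg (by positivity)]
    have : 1 ≤ 1 + v ^ 2 := by nlinarith [sq_nonneg v]
    gcongr
    nlinarith

theorem continuous_perronKernel_line (J : ℕ) {σ : ℝ} (hσ : 0 < σ) :
    Continuous fun v : ℝ => perronKernel J (σ + v * I) := by
  rw [continuous_iff_continuousAt]
  intro v
  have h1 : ContinuousAt (perronKernel J) (σ + v * I) :=
    (differentiableAt_perronKernel J (by simpa using hσ)).continuousAt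
  exact h1.comp (f := fun v : ℝ => (σ + v * I : ℂ)) (by fun_prop)

theorem integrable_perronKernel {J : ℕ} (hJ : 3 ≤ J) {σ : ℝ} (hσ : 1 / 2 ≤ σ) :
    Integrable fun v : ℝ => perronKernel J (σ + v * I) := by
  apply (integrable_inv_one_add_sq_sq.const_mul (16 * (J.factorial : ℝ))).mono'
  · exact (continuous_perronKernel_line J (by linarith)).aestronglyMeasurable
  · refine Eventually.of_forall fun v => ?_
    have := norm_perronKernel_le hJ (w := σ + v * I) (by simpa using hσ)
    simpa [div_eq_mul_inv] using this

theorem trunc_eq_integral {J : ℕ} (hJ : 3 ≤ J) {x : ℝ} (hx : 0 < x) :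
    (trunc J x : ℂ) = (1 / (2 * Real.pi) : ℝ) *
      ∫ v : ℝ, (x : ℂ) ^ (-(2 + v * I)) * perronKernel J (2 + v * I) := by
  have hJ0 : J ≠ 0 := by omega
  have hInt : VerticalIntegrable (mellin fun x => (trunc J x : ℂ)) 2 := by
    unfold VerticalIntegrable
    refine (integrable_perronKernel hJ (σ := 2) (by norm_num)).congr (Eventually.of_forall fun v => ?_)
    exact (mellin_trunc hJ0 (by simp)).symm
  have := mellinInv_mellin_eq 2 (fun x => (trunc J x : ℂ)) hx
    (mellinConvergent_trunc hJ0 (by simp)) hInt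
    ((continuous_ofReal.comp (continuous_trunc J)).continuousAt)
  rw [← this, mellinInv, real_smul]
  congr 2
  ext v
  rw [mellin_trunc hJ0 (by simp), smul_eq_mul]
  norm_num

end LGrowth

namespace LGrowth
open Complex Filter Asymptotics Topology MeasureTheory Set

theorem integrable_vertical {G : ℂ → ℂ} {a B : ℝ}
    (hd : ∀ w : ℂ, w.re = a → DifferentiableAt ℂ G w)
    (hb : ∀ w : ℂ, w.re = a → ‖G w‖ ≤ B / (1 + w.im ^ 2)) :
    Integrable fun v : ℝ => G (a + v * I) := by
  apply (integrable_inv_one_add_sq.const_mul B).mono'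
  · apply Continuous.aestronglyMeasurable
    rw [continuous_iff_continuousAt]
    intro v
    exact (hd (a + v * I) (by simp)).continuousAt.comp (f := fun v : ℝ => (a + v * I : ℂ))
      (by fun_prop)
  · refine Eventually.of_forall fun v => ?_
    simpa [div_eq_mul_inv] using hb (a + v * I) (by simp)

theorem integral_vertical_eq {G : ℂ → ℂ} {a b B : ℝ} (hab : a ≤ b)
    (hd : ∀ w : ℂ, a ≤ w.re → w.re ≤ b → DifferentiableAt ℂ G w)
    (hb : ∀ w : ℂ, a ≤ w.re → w.re ≤ b → ‖G w‖ ≤ B / (1 + w.im ^ 2)) :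
    ∫ v : ℝ, G (a + v * I) = ∫ v : ℝ, G (b + v * I) := by
  have i1 := integrable_vertical (G := G) (a := a) (B := B) (fun w hw => hd w hw.ge (hw.le.trans hab))
    (fun w hw => hb w hw.ge (hw.le.trans hab))
  have i2 := integrable_vertical (G := G) (a := b) (B := B) (fun w hw => hd w (hab.trans hw.ge) hw.le)
    (fun w hw => hb w (hab.trans hw.ge) hw.le)
  have l1 := intervalIntegral_tendsto_integral i1 tendsto_neg_atTop_atBot tendsto_id
  have l2 := intervalIntegral_tendsto_integral i2 tendsto_neg_atTop_atBot tendsto_id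
  refine eq_of_sub_eq_zero (tendsto_nhds_unique (l1.sub l2) ?_)
  have hbd : ∀ T c : ℝ, c ^ 2 = T ^ 2 → ‖∫ x : ℝ in a..b, G (x + c * I)‖ ≤
      B / (1 + T ^ 2) * |b - a| := by
    intro T c hc
    apply intervalIntegral.norm_integral_le_of_norm_le_const
    intro x hx
    rw [uIoc_of_le hab] at hx
    have := hb (x + c * I) (by simpa using hx.1.le) (by simpa using hx.2)
    simpa [hc] using this
  have hlim : Tendsto (fun T : ℝ => 2 * (B / (1 + T ^ 2) * |b - a|)) atTop (𝓝 0) := by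
    have h1 : Tendsto (fun T : ℝ => 1 + T ^ 2) atTop atTop :=
      tendsto_atTop_add_const_left _ _ (tendsto_pow_atTop two_ne_zero)
    have := ((h1.const_div_atTop B).mul_const |b - a|).const_mul 2
    simpa using this
  refine squeeze_zero_norm (fun T => ?_) hlim
  have hrect := integral_boundary_rect_eq_zero_of_differentiableOn G (a + (-T : ℝ) * I) (b + T * I)
    (by
      intro w hw
      rw [mem_reProdIm] at hw
      have h1 := hw.1
      simp [uIcc_of_le hab] at h1
      exact (hd w h1.1 h1.2).differentiableWithinAt)
  simp only [add_re, ofReal_re, mul_re, I_re, mul_zero, ofReal_im, I_im, mul_one, sub_self, add_zero,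
    add_im, mul_im, zero_add, smul_eq_mul] at hrect
  have e : (∫ x in -T..id T, G (a + x * I)) - ∫ x in -T..id T, G (b + x * I) =
      -I * ((∫ x : ℝ in a..b, G (x + (-T : ℝ) * I)) - ∫ x : ℝ in a..b, G (x + T * I)) := by
    simp only [id]
    linear_combination I * hrect - ((∫ x in -T..T, G (b + x * I)) -
      ∫ x in -T..T, G (a + x * I)) * I_mul_I
  rw [e, norm_mul, norm_neg, norm_I, one_mul]
  refine (norm_sub_le _ _).trans ?_
  linarith [hbd T (-T) (by ring), hbd T T rfl]

theorem ofReal_div_cpow {x Y : ℝ} (hx : 0 < x) (hY : 0 < Y) (w : ℂ) :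
    ((x / Y : ℝ) : ℂ) ^ (-w) = (x : ℂ) ^ (-w) * (Y : ℂ) ^ w := by
  rw [cpow_def_of_ne_zero (by exact_mod_cast (div_pos hx hY).ne'),
    cpow_def_of_ne_zero (by exact_mod_cast hx.ne'), cpow_def_of_ne_zero (by exact_mod_cast hY.ne'),
    ← ofReal_log (div_pos hx hY).le, ← ofReal_log hx.le, ← ofReal_log hY.le,
    Real.log_div hx.ne' hY.ne', ← exp_add]
  push_cast
  ring_nf

theorem perron_formula {α : Type*} [MeasurableSpace α] {μ : Measure α} [SFinite μ] {x : α → ℝ}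
    {a : α → ℂ} (hx : Measurable x) (ha : Measurable a) (hpos : ∀ z, 0 < x z)
    (hInt : Integrable (fun z => ‖a z‖ * x z ^ (-2 : ℝ)) μ) {Y : ℝ} (hY : 0 < Y) {J : ℕ}
    (hJ : 3 ≤ J) :
    Integrable (fun v : ℝ => perronKernel J (2 + v * I) * (Y : ℂ) ^ (2 + v * I) *
      ∫ z, a z * (x z : ℂ) ^ (-(2 + v * I)) ∂μ) ∧
    ∫ z, a z * trunc J (x z / Y) ∂μ = (1 / (2 * Real.pi) : ℝ) *
      ∫ v : ℝ, perronKernel J (2 + v * I) * (Y : ℂ) ^ (2 + v * I) *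
        ∫ z, a z * (x z : ℂ) ^ (-(2 + v * I)) ∂μ := by
  have hK := integrable_perronKernel hJ (σ := 2) (by norm_num)
  push_cast at hK
  set g : α → ℝ → ℂ := fun z v =>
    a z * (((x z / Y : ℝ) : ℂ) ^ (-(2 + v * I)) * perronKernel J (2 + v * I)) with hg
  have hgi : Integrable (Function.uncurry g) (μ.prod volume) := by
    apply ((hInt.const_mul (Y ^ (2 : ℝ))).mul_prod hK.norm).mono'
    · apply AEStronglyMeasurable.mul
      · exact (ha.comp measurable_fst).aestronglyMeasurable
      · apply AEStronglyMeasurable.mul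
        · apply Measurable.aestronglyMeasurable
          fun_prop
        · exact hK.aestronglyMeasurable.comp_snd
    · refine Eventually.of_forall fun p => ?_
      simp only [hg, Function.uncurry, norm_mul]
      rw [norm_cpow_eq_rpow_re_of_pos (div_pos (hpos _) hY)]
      have e : (-(2 + (p.2 : ℂ) * I)).re = -2 := by simp
      rw [e, Real.div_rpow (hpos _).le hY.le, Real.rpow_neg hY.le 2, div_inv_eq_mul]
      exact le_of_eq (by ring)
  have e2 : ∀ v, ∫ z, g z v ∂μ = perronKernel J (2 + v * I) * (Y : ℂ) ^ (2 + v * I) *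
      ∫ z, a z * (x z : ℂ) ^ (-(2 + v * I)) ∂μ := by
    intro v
    rw [← integral_const_mul]
    congr 1
    ext z
    rw [hg]
    simp only
    rw [ofReal_div_cpow (hpos z) hY]
    ring
  constructor
  · exact hgi.integral_prod_right.congr (Eventually.of_forall fun v => e2 v)
  · simp_rw [← e2]
    rw [← integral_integral_swap hgi, ← integral_const_mul]
    congr 1
    ext z
    rw [trunc_eq_integral hJ (div_pos (hpos z) hY), hg]
    simp only
    rw [integral_const_mul]
    ring

/-- Shifting the contour in Perron's formula to the line `Re = σ`. -/
theorem norm_perron_integral_le {D : ℂ → ℂ} {σ A t ℓ Y : ℝ} {J : ℕ} (hJ : 3 ≤ J) (h1 : 1 / 2 ≤ σ)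
    (h2 : σ ≤ 2) (hY : 1 ≤ Y) (hA : 0 ≤ A) (hℓ : 1 ≤ ℓ)
    (hd : ∀ s : ℂ, σ ≤ s.re → DifferentiableAt ℂ D s)
    (hD : ∀ s : ℂ, σ ≤ s.re → s.re ≤ 2 → ‖D s‖ ≤ A * (ℓ + |s.im + t|)) :
    ‖∫ v : ℝ, perronKernel J (2 + v * I) * (Y : ℂ) ^ (2 + v * I) * D (2 + v * I - t * I)‖ ≤
      32 * J.factorial * A * ℓ * Real.pi * Y ^ σ := by
  have hY0 : 0 < Y := by linarith
  set G : ℂ → ℂ := fun w => perronKernel J w * (Y : ℂ) ^ w * D (w - t * I) with hG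
  have hGd : ∀ w : ℂ, σ ≤ w.re → DifferentiableAt ℂ G w := by
    intro w hw
    have e : (w - t * I).re = w.re := by simp
    apply DifferentiableAt.mul
    · apply (differentiableAt_perronKernel J (by linarith)).mul
      exact differentiableAt_id.const_cpow (Or.inl (by exact_mod_cast hY0.ne'))
    · exact (hd (w - t * I) (by rw [e]; exact hw)).comp w (by fun_prop)
  have hGb : ∀ w : ℂ, σ ≤ w.re → w.re ≤ 2 →
      ‖G w‖ ≤ 32 * J.factorial * A * ℓ * Y ^ w.re / (1 + w.im ^ 2) := by
    intro w hw hw2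
    have e : (w - t * I).re = w.re := by simp
    have e' : (w - t * I).im + t = w.im := by simp
    have b1 := norm_perronKernel_le hJ (h1.trans hw)
    have b2 := hD (w - t * I) (by rw [e]; exact hw) (by rw [e]; exact hw2)
    rw [e'] at b2
    have b3 : ℓ + |w.im| ≤ 2 * ℓ * (1 + w.im ^ 2) := by
      nlinarith [sq_abs w.im, sq_nonneg (|w.im| - 1), abs_nonneg w.im, sq_nonneg w.im]
    rw [hG]
    simp only [norm_mul]
    rw [norm_cpow_eq_rpow_re_of_pos hY0]
    calc _ ≤ (16 * J.factorial / (1 + w.im ^ 2) ^ 2) * Y ^ w.re *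
          (A * (2 * ℓ * (1 + w.im ^ 2))) := by
          gcongr
          exact b2.trans (by gcongr)
      _ = _ := by
        have : 0 < 1 + w.im ^ 2 := by positivity
        field_simp
        ring
  have hGb' : ∀ w : ℂ, σ ≤ w.re → w.re ≤ 2 →
      ‖G w‖ ≤ 32 * J.factorial * A * ℓ * Y ^ (2 : ℝ) / (1 + w.im ^ 2) := by
    intro w hw hw2
    refine (hGb w hw hw2).trans ?_
    gcongr
  have key := integral_vertical_eq h2 (fun w hw _ => hGd w hw) hGb'
  have e3 : (∫ v : ℝ, perronKernel J (2 + v * I) * (Y : ℂ) ^ (2 + v * I) *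
      D (2 + v * I - t * I)) = ∫ v : ℝ, G ((2 : ℝ) + v * I) := by
    simp [hG]
  rw [e3, ← key]
  have hi := integrable_inv_one_add_sq.const_mul (32 * J.factorial * A * ℓ * Y ^ σ)
  refine (norm_integral_le_of_norm_le hi (Eventually.of_forall fun v => ?_)).trans ?_
  · have := hGb (σ + v * I) (by simp) (by simpa using h2)
    simpa [div_eq_mul_inv] using this
  · rw [integral_const_mul, integral_univ_inv_one_add_sq]
    exact le_of_eq (by ring)

end LGrowth

namespace LGrowth
open Complex Filter Asymptotics Topology MeasureTheory Set

theorem perron_LSeries {b : ℕ → ℂ} (h0 : b 0 = 0) (hb : LSeriesSummable b 2) (t : ℝ) {Y : ℕ}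
    (hY : 0 < Y) {J : ℕ} (hJ : 3 ≤ J) :
    Integrable (fun v : ℝ => perronKernel J (2 + v * I) * (Y : ℂ) ^ (2 + v * I) *
      LSeries b (2 + v * I - t * I)) ∧
    ∑ n ∈ Finset.range Y, b n * (n : ℂ) ^ (t * I) * trunc J (n / Y) = (1 / (2 * Real.pi) : ℝ) *
      ∫ v : ℝ, perronKernel J (2 + v * I) * (Y : ℂ) ^ (2 + v * I) *
        LSeries b (2 + v * I - t * I) := by
  have hY' : (0 : ℝ) < Y := by exact_mod_cast hY
  set x : ℕ → ℝ := fun n => if n = 0 then 1 else n with hx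
  have hpos : ∀ n, 0 < x n := by
    intro n
    rcases n.eq_zero_or_pos with h | h
    · simp [hx, h]
    · simpa [hx, h.ne'] using h
  set a : ℕ → ℂ := fun n => b n * (n : ℂ) ^ (t * I) with ha
  have hna : ∀ n, n ≠ 0 → ‖a n‖ = ‖b n‖ := by
    intro n hn
    rw [ha]
    simp only [norm_mul]
    rw [norm_natCast_cpow_of_pos (Nat.pos_of_ne_zero hn)]
    simp
  have hterm : ∀ n v, a n * (x n : ℂ) ^ (-(2 + v * I)) =
      LSeries.term b (2 + v * I - t * I) n := by
    intro n v
    rcases n.eq_zero_or_pos with h | h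
    · simp [ha, h, h0]
    · have hn : (n : ℂ) ≠ 0 := by exact_mod_cast h.ne'
      rw [LSeries.term_of_ne_zero h.ne']
      simp only [ha, hx, h.ne', if_false]
      rw [mul_assoc, div_eq_mul_inv, ← cpow_neg]
      push_cast
      rw [← cpow_add _ _ hn]
      congr 2
      ring
  have hsum : Summable fun n => ‖a n‖ * x n ^ (-2 : ℝ) := by
    refine hb.norm.congr fun n => ?_
    rcases n.eq_zero_or_pos with h | h
    · simp [ha, h, h0]
    · rw [LSeries.norm_term_eq, hna n h.ne']
      simp only [hx, h.ne', if_false]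
      rw [Real.rpow_neg (by positivity), div_eq_mul_inv]
      simp
  have hInt : Integrable (fun n => ‖a n‖ * x n ^ (-2 : ℝ)) Measure.count :=
    integrable_count_iff.mpr hsum.norm
  obtain ⟨p1, p2⟩ := perron_formula (μ := Measure.count) (x := x) (a := a)
    (measurable_from_nat) (measurable_from_nat) hpos hInt hY' hJ
  have hF : ∀ v : ℝ, ∫ n, a n * (x n : ℂ) ^ (-(2 + v * I)) ∂Measure.count =
      LSeries b (2 + v * I - t * I) := by
    intro v
    have hs : Summable fun n => a n * (x n : ℂ) ^ (-(2 + v * I)) := by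
      apply hsum.of_norm_bounded
      intro n
      rw [norm_mul, norm_cpow_eq_rpow_re_of_pos (hpos n)]
      simp
    rw [integral_countable (integrable_count_iff.mpr hs.norm)]
    unfold LSeries
    simp only [count_real_singleton, one_smul]
    exact tsum_congr fun n => hterm n v
  simp only [hF, ofReal_natCast] at p1 p2
  refine ⟨p1, ?_⟩
  rw [← p2]
  have hvan : ∀ n ∉ Finset.range Y, a n * (trunc J (x n / Y) : ℂ) = 0 := by
    intro n hn
    have hn' : Y ≤ n := by simpa using hn
    have hn0 : n ≠ 0 := by omega
    rw [trunc_of_one_le (by omega)]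
    · simp
    · simp only [hx, hn0, if_false]
      rw [one_le_div hY']
      exact_mod_cast hn'
  have hs2 : Summable fun n => a n * (trunc J (x n / Y) : ℂ) :=
    summable_of_ne_finset_zero (fun n hn => hvan n hn)
  rw [integral_countable (integrable_count_iff.mpr hs2.norm)]
  simp only [count_real_singleton, one_smul]
  rw [tsum_eq_sum hvan]
  apply Finset.sum_congr rfl
  intro n _
  rcases n.eq_zero_or_pos with h | h
  · simp [ha, h, h0]
  · simp [ha, hx, h.ne']

theorem log_mul_add_four_le {R s t : ℝ} (hR : 1 ≤ R) :
    Real.log (R * (|s| + 4)) ≤ Real.log (R * (|t| + 4)) + |s + t| := by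
  have h1 : R * (|s| + 4) ≤ R * (|t| + 4) * (1 + |s + t|) := by
    have a1 : |s| ≤ |t| + |s + t| := by
      have := abs_sub (s + t) t
      rw [add_sub_cancel_right] at this
      linarith
    have := abs_nonneg s; have := abs_nonneg t; have := abs_nonneg (s + t)
    rw [mul_assoc]
    gcongr
    nlinarith
  have hp : 0 < R * (|s| + 4) := by positivity
  have hp2 : 0 < R * (|t| + 4) := by positivity
  have hp3 : 0 < 1 + |s + t| := by positivity
  calc _ ≤ Real.log (R * (|t| + 4) * (1 + |s + t|)) := Real.log_le_log hp h1
    _ = Real.log (R * (|t| + 4)) + Real.log (1 + |s + t|) := Real.log_mul hp2.ne' hp3.ne'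
    _ ≤ _ := by
      have := Real.log_le_sub_one_of_pos hp3
      linarith

theorem one_le_log_mul_add_four {R t : ℝ} (hR : 1 ≤ R) : 1 ≤ Real.log (R * (|t| + 4)) := by
  rw [Real.le_log_iff_exp_le (by positivity)]
  have := Real.exp_one_lt_d9
  have := abs_nonneg t
  nlinarith

theorem norm_two_pi_mul_le {z : ℂ} {B : ℝ} (h : ‖z‖ ≤ B) (_hB : 0 ≤ B) :
    ‖((1 / (2 * Real.pi) : ℝ) : ℂ) * z‖ ≤ B := by
  rw [norm_mul, norm_real, Real.norm_of_nonneg (by positivity)]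
  have : 1 / (2 * Real.pi) ≤ 1 := by
    rw [div_le_one (by positivity)]
    linarith [Real.pi_gt_three]
  calc _ ≤ 1 * B := by gcongr
    _ = B := one_mul B

open ArithmeticFunction in
theorem norm_sum_char_vonMangoldt_le (hG : GRH) {r : ℕ} [NeZero r] {χ : DirichletCharacter ℂ r}
    (hχ : χ ≠ 1) {δ : ℝ} (hδ : 0 < δ) (hδ1 : δ ≤ 1) (t : ℝ) {Y : ℕ} (hY : 0 < Y) {J : ℕ}
    (hJ : 3 ≤ J) :
    ‖∑ n ∈ Finset.range Y, (χ n * vonMangoldt n) * (n : ℂ) ^ (t * I) * trunc J (n / Y)‖ ≤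
      32 * J.factorial * (36 / δ ^ 2) * Real.log (r * (|t| + 4)) * Real.pi *
        (Y : ℝ) ^ (1 / 2 + δ) := by
  have hr : (1 : ℝ) ≤ r := by exact_mod_cast NeZero.one_le
  have hℓ := one_le_log_mul_add_four (t := t) hr
  have hs := DirichletCharacter.LSeriesSummable_twist_vonMangoldt χ (s := 2) (by simp)
  obtain ⟨-, p2⟩ := perron_LSeries (b := fun n => χ n * (vonMangoldt n : ℂ)) (by simp) hs t hY hJ
  rw [p2]
  refine norm_two_pi_mul_le ?_ (by positivity)
  have hD := norm_perron_integral_le (D := fun s => -(deriv (DirichletCharacter.LFunction χ) s /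
    DirichletCharacter.LFunction χ s)) (σ := 1 / 2 + δ) (A := 36 / δ ^ 2) (t := t)
    (ℓ := Real.log (r * (|t| + 4))) (Y := Y) hJ (by linarith) (by linarith) (by exact_mod_cast hY)
    (by positivity) hℓ ?_ ?_
  · convert hD using 3
    ext v
    congr 1
    have hre : 1 < (2 + v * I - t * I : ℂ).re := by simp
    have h2 := DirichletCharacter.LSeries_twist_vonMangoldt_eq χ hre
    rw [DirichletCharacter.deriv_LFunction_eq_deriv_LSeries χ hre,
      DirichletCharacter.LFunction_eq_LSeries χ hre, ← neg_div]
    exact h2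
  · intro s hs
    have hd := DirichletCharacter.differentiable_LFunction hχ
    exact ((hd.deriv s).div (hd s) (LFunction_ne_zero_of_GRH hG hχ (by linarith))).neg
  · intro s hs1 hs2
    rw [norm_neg]
    refine (norm_logDeriv_LFunction_le hG hχ hδ hs1 hs2).trans ?_
    gcongr
    exact log_mul_add_four_le hr

theorem perron_rpow (t : ℝ) {Y : ℕ} (hY : 0 < Y) {J : ℕ} (hJ : 3 ≤ J) :
    Integrable (fun v : ℝ => perronKernel J (2 + v * I) * (Y : ℂ) ^ (2 + v * I) *
      (1 / (2 + v * I - t * I - 1))) ∧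
    ∫ u in Ioi (1 : ℝ), (u : ℂ) ^ (t * I) * trunc J (u / Y) = (1 / (2 * Real.pi) : ℝ) *
      ∫ v : ℝ, perronKernel J (2 + v * I) * (Y : ℂ) ^ (2 + v * I) *
        (1 / (2 + v * I - t * I - 1)) := by
  have hY' : (0 : ℝ) < Y := by exact_mod_cast hY
  set x : ℝ → ℝ := fun u => max u 1 with hx
  have hxe : ∀ u ∈ Ioi (1 : ℝ), x u = u := fun u hu => max_eq_left (le_of_lt hu)
  have hpos : ∀ u, 0 < x u := fun u => lt_of_lt_of_le zero_lt_one (le_max_right _ _)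
  have hxm : Measurable x := by fun_prop
  set a : ℝ → ℂ := fun u => (x u : ℂ) ^ (t * I) with ha
  have ham : Measurable a := by fun_prop
  have hInt : Integrable (fun u => ‖a u‖ * x u ^ (-2 : ℝ)) (volume.restrict (Ioi 1)) := by
    have h1 : IntegrableOn (fun u : ℝ => u ^ (-2 : ℝ)) (Ioi 1) :=
      integrableOn_Ioi_rpow_of_lt (by norm_num) zero_lt_one
    refine h1.congr_fun (fun u hu => ?_) measurableSet_Ioi
    simp only [ha]
    rw [norm_cpow_eq_rpow_re_of_pos (hpos u), hxe u hu]
    simp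
  obtain ⟨p1, p2⟩ := perron_formula (μ := volume.restrict (Ioi 1)) hxm ham hpos hInt hY' hJ
  have hF : ∀ v : ℝ, ∫ u in Ioi (1 : ℝ), a u * (x u : ℂ) ^ (-(2 + v * I)) =
      1 / (2 + v * I - t * I - 1) := by
    intro v
    have e : ∫ u in Ioi (1 : ℝ), a u * (x u : ℂ) ^ (-(2 + v * I)) =
        ∫ u in Ioi (1 : ℝ), (u : ℂ) ^ (-(2 + v * I - t * I)) := by
      apply setIntegral_congr_fun measurableSet_Ioi
      intro u hu
      have hu0 : (u : ℂ) ≠ 0 := by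
        have : (0 : ℝ) < u := lt_trans zero_lt_one hu
        exact_mod_cast this.ne'
      simp only [ha]
      rw [hxe u hu, ← cpow_add _ _ hu0]
      congr 1
      ring
    rw [e, integral_Ioi_cpow_of_lt (by simp) zero_lt_one, ofReal_one, one_cpow,
      neg_div, ← div_neg]
    congr 1
    ring
  simp only [hF, ofReal_natCast] at p1 p2
  refine ⟨p1, ?_⟩
  rw [← p2]
  apply setIntegral_congr_fun measurableSet_Ioi
  intro u hu
  simp only [ha]
  rw [hxe u hu]

theorem norm_integral_rpow_trunc_le (t : ℝ) {Y : ℕ} (hY : 0 < Y) {J : ℕ} (hJ : J ≠ 0) :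
    ‖∫ u in Ioi (1 : ℝ), (u : ℂ) ^ (t * I) * trunc J (u / Y)‖ ≤
      Y * (J.factorial * 2 ^ (J + 1) / (1 + |t|) ^ (J + 1)) + 1 := by
  have hY' : (0 : ℝ) < Y := by exact_mod_cast hY
  have hm : mellin (fun u : ℝ => (trunc J (u * (Y : ℝ)⁻¹) : ℂ)) (1 + t * I) =
      (((Y : ℝ)⁻¹ : ℝ) : ℂ) ^ (-(1 + t * I)) • perronKernel J (1 + t * I) := by
    rw [mellin_comp_mul_right (fun u => (trunc J u : ℂ)) _ (inv_pos.mpr hY'),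
      mellin_trunc hJ (by simp)]
  have hc : MellinConvergent (fun u : ℝ => (trunc J (u * (Y : ℝ)⁻¹) : ℂ)) (1 + t * I) :=
    by
    simp_rw [mul_comm _ (Y : ℝ)⁻¹]
    exact (MellinConvergent.comp_mul_left (f := fun u => (trunc J u : ℂ)) (inv_pos.mpr hY')).mpr
      (mellinConvergent_trunc hJ (by simp))
  have e1 : ∀ u : ℝ, (u : ℂ) ^ ((1 + t * I : ℂ) - 1) • (trunc J (u * (Y : ℝ)⁻¹) : ℂ) =
      (u : ℂ) ^ (t * I) * trunc J (u / Y) := by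
    intro u
    rw [smul_eq_mul, add_sub_cancel_left, div_eq_mul_inv]
  unfold MellinConvergent at hc
  unfold mellin at hm
  simp only [e1] at hc hm
  rw [← Ioc_union_Ioi_eq_Ioi zero_le_one] at hc hm
  rw [setIntegral_union (Ioc_disjoint_Ioi le_rfl) measurableSet_Ioi hc.left_of_union
    hc.right_of_union] at hm
  have h1 : ‖∫ u in Ioc (0 : ℝ) 1, (u : ℂ) ^ (t * I) * trunc J (u / Y)‖ ≤ 1 := by
    have := norm_setIntegral_le_of_norm_le_const (μ := volume) (s := Ioc (0 : ℝ) 1) (C := 1)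
      (f := fun u : ℝ => (u : ℂ) ^ (t * I) * trunc J (u / Y)) (by simp) (fun u hu => by
        rw [norm_mul, norm_cpow_eq_rpow_re_of_pos hu.1, norm_real,
          Real.norm_of_nonneg (trunc_nonneg J _)]
        simpa using trunc_le_one J (div_nonneg hu.1.le hY'.le))
    simpa using this
  have h2 : ‖(((Y : ℝ)⁻¹ : ℝ) : ℂ) ^ (-(1 + t * I)) • perronKernel J (1 + t * I)‖ ≤
      Y * (J.factorial * 2 ^ (J + 1) / (1 + |t|) ^ (J + 1)) := by
    rw [norm_smul, norm_cpow_eq_rpow_re_of_pos (inv_pos.mpr hY')]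
    have : (-(1 + t * I) : ℂ).re = -1 := by simp
    rw [this, Real.rpow_neg_one, inv_inv]
    gcongr
    exact norm_perronKernel_one_add_le J t
  rw [← eq_sub_iff_add_eq'] at hm
  rw [hm]
  exact (norm_sub_le _ _).trans (add_le_add h2 h1)

open ArithmeticFunction in
theorem norm_sum_vonMangoldt_le (hG : GRH) {δ : ℝ} (hδ : 0 < δ) (hδ1 : δ ≤ 1) (t : ℝ) {Y : ℕ}
    (hY : 0 < Y) {J : ℕ} (hJ : 3 ≤ J) :
    ‖∑ n ∈ Finset.range Y, (vonMangoldt n : ℂ) * (n : ℂ) ^ (t * I) * trunc J (n / Y)‖ ≤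
      32 * J.factorial * (48 / δ ^ 2) * Real.log (|t| + 4) * Real.pi * (Y : ℝ) ^ (1 / 2 + δ) +
        (Y * (J.factorial * 2 ^ (J + 1) / (1 + |t|) ^ (J + 1)) + 1) := by
  have hℓ := one_le_log_mul_add_four (t := t) le_rfl
  rw [one_mul] at hℓ
  have hs := LSeriesSummable_vonMangoldt (s := 2) (by simp)
  obtain ⟨i1, p1⟩ := perron_LSeries (b := fun n => (vonMangoldt n : ℂ)) (by simp) hs t hY hJ
  obtain ⟨i2, p2⟩ := perron_rpow t hY hJ
  rw [← sub_add_cancel (∑ n ∈ Finset.range Y, _)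
    (∫ u in Ioi (1 : ℝ), (u : ℂ) ^ (t * I) * trunc J (u / Y))]
  refine (norm_add_le _ _).trans (add_le_add ?_ (norm_integral_rpow_trunc_le t hY (by omega)))
  rw [p1, p2, ← mul_sub, ← integral_sub i1 i2]
  refine norm_two_pi_mul_le ?_ (by positivity)
  have hD := norm_perron_integral_le (D := fun s => -(deriv zetaMul s / zetaMul s))
    (σ := 1 / 2 + δ) (A := 48 / δ ^ 2) (t := t)
    (ℓ := Real.log (|t| + 4)) (Y := Y) hJ (by linarith) (by linarith) (by exact_mod_cast hY)
    (by positivity) hℓ ?_ ?_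
  · convert hD using 3
    ext v
    rw [← mul_sub]
    congr 1
    set s : ℂ := 2 + v * I - t * I with hsdef
    have hre : 1 < s.re := by simp [hsdef]
    have hs1 : s ≠ 1 := by
      intro h; rw [h] at hre; simp at hre
    have hz : riemannZeta s ≠ 0 := riemannZeta_ne_zero_of_one_le_re hre.le
    have e1 : deriv zetaMul s = riemannZeta s + (s - 1) * deriv riemannZeta s := by
      have hev : zetaMul =ᶠ[𝓝 s] fun z => (z - 1) * riemannZeta z := by
        filter_upwards [isOpen_ne.mem_nhds hs1] with z hz using zetaMul_eq hz
      rw [hev.deriv_eq]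
      have hd := ((hasDerivAt_id s).sub_const 1).mul (differentiableAt_riemannZeta hs1).hasDerivAt
      have h := hd.deriv
      simp only [id, one_mul] at h
      exact h
    have h2 := LSeries_vonMangoldt_eq_deriv_riemannZeta_div hre
    have hs10 : s - 1 ≠ 0 := sub_ne_zero.mpr hs1
    have h3 : LSeries (fun n => (vonMangoldt n : ℂ)) s = -deriv riemannZeta s / riemannZeta s := h2
    rw [e1, zetaMul_eq hs1, h3]
    field_simp
    ring
  · intro s hs
    have hd := DirichletCharacter.differentiable_LFunctionTrivChar₁ 1
    exact ((hd.deriv s).div (hd s) (zetaMul_ne_zero_of_GRH hG (by linarith))).neg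
  · intro s hs1 hs2
    rw [norm_neg]
    refine (norm_logDeriv_zetaMul_le hG hδ hs1 hs2).trans ?_
    gcongr
    simpa using log_mul_add_four_le (R := 1) (s := s.im) (t := t) le_rfl

end LGrowth

namespace LGrowth
open Complex Filter Asymptotics Topology MeasureTheory Set

/-- The primes below `Y`. -/
def primeSet (Y : ℕ) : Finset ℕ := (Finset.range Y).filter Nat.Prime

/-- The smooth weight `log p * (1 - p / Y) ^ J` on primes. -/
noncomputable def primeWeight (J Y p : ℕ) : ℝ := Real.log p * trunc J (p / Y)

theorem mem_primeSet {Y p : ℕ} : p ∈ primeSet Y ↔ p < Y ∧ p.Prime := by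
  simp [primeSet]

theorem primeWeight_nonneg (J Y p : ℕ) : 0 ≤ primeWeight J Y p :=
  mul_nonneg (Real.log_natCast_nonneg p) (trunc_nonneg _ _)

theorem primeWeight_le_log (J Y p : ℕ) : primeWeight J Y p ≤ Real.log p :=
  mul_le_of_le_one_right (Real.log_natCast_nonneg p) (trunc_le_one _ (by positivity))

open ArithmeticFunction in
theorem exists_norm_prime_sum_le : ∃ C > (0 : ℝ), ∀ (J Y : ℕ) (a : ℕ → ℂ), (∀ n, ‖a n‖ ≤ 1) →
    ‖∑ p ∈ primeSet Y, primeWeight J Y p * a p‖ ≤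
      ‖∑ n ∈ Finset.range Y, (vonMangoldt n : ℂ) * a n * trunc J (n / Y)‖ + C * √Y := by
  obtain ⟨C, hC⟩ := Chebyshev.psi_sub_theta_le_mul_sqrt
  refine ⟨max C 1, by positivity, fun J Y a ha => ?_⟩
  rw [← Finset.sum_filter_add_sum_filter_not (Finset.range Y) Nat.Prime]
  have h1 : ∑ p ∈ primeSet Y, primeWeight J Y p * a p = ∑ n ∈ Finset.range Y with n.Prime,
      (vonMangoldt n : ℂ) * a n * trunc J (n / Y) := by
    refine Finset.sum_congr rfl fun p hp => ?_
    rw [vonMangoldt_apply_prime (Finset.mem_filter.mp hp).2, primeWeight]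
    push_cast
    ring
  rw [h1]
  have h2 : ‖∑ n ∈ Finset.range Y with ¬n.Prime, (vonMangoldt n : ℂ) * a n * trunc J (n / Y)‖ ≤
      C * √Y := by
    refine le_trans ?_ (hC Y)
    rw [Chebyshev.psi_sub_theta_eq_sum_not_prime, Nat.floor_natCast]
    calc _ ≤ ∑ n ∈ Finset.range Y with ¬n.Prime, vonMangoldt n := by
          refine norm_sum_le_of_le _ fun n _ => ?_
          rw [norm_mul, norm_mul, norm_real, norm_real, Real.norm_of_nonneg vonMangoldt_nonneg,
            Real.norm_of_nonneg (trunc_nonneg _ _)]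
          have hΛ : 0 ≤ vonMangoldt n := vonMangoldt_nonneg
          calc _ ≤ vonMangoldt n * 1 * 1 := by
                gcongr
                · exact trunc_nonneg _ _
                · exact ha n
                · exact trunc_le_one _ (by positivity)
            _ = _ := by ring
      _ ≤ ∑ n ∈ insert 0 (Finset.Ioc 0 Y) with ¬n.Prime, vonMangoldt n := by
          refine Finset.sum_le_sum_of_subset_of_nonneg ?_ fun _ _ _ => vonMangoldt_nonneg
          refine Finset.filter_subset_filter _ fun n hn => ?_
          simp only [Finset.mem_insert, Finset.mem_Ioc, Finset.mem_range] at hn ⊢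
          omega
      _ = _ := by
          rw [Finset.filter_insert, if_pos (by decide), Finset.sum_insert (by simp)]
          simp
  have h3 := norm_sub_le_norm_add (∑ n ∈ Finset.range Y with n.Prime,
      (vonMangoldt n : ℂ) * a n * trunc J (n / Y)) (∑ n ∈ Finset.range Y with ¬n.Prime,
      (vonMangoldt n : ℂ) * a n * trunc J (n / Y))
  have h4 : C * √Y ≤ max C 1 * √Y := by gcongr; exact le_max_left _ _
  linarith

theorem norm_natCast_cpow_I_le (t : ℝ) (n : ℕ) : ‖(n : ℂ) ^ (t * I)‖ ≤ 1 := by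
  rcases n.eq_zero_or_pos with h | h
  · subst h
    by_cases ht : (t * I : ℂ) = 0
    · simp [ht]
    · rw [Nat.cast_zero, zero_cpow ht]; simp
  · rw [norm_natCast_cpow_of_pos h]; simp

theorem sqrt_le_rpow {Y : ℕ} (hY : 0 < Y) {δ : ℝ} (hδ : 0 < δ) : √(Y : ℝ) ≤ (Y : ℝ) ^ (1 / 2 + δ) := by
  rw [Real.sqrt_eq_rpow]
  exact Real.rpow_le_rpow_of_exponent_le (by exact_mod_cast hY) (by linarith)

theorem exists_norm_char_sum_le (hG : GRH) {δ : ℝ} (hδ : 0 < δ) (hδ1 : δ ≤ 1) {J : ℕ} (hJ : 3 ≤ J) :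
    ∃ C > (0 : ℝ), ∀ (r : ℕ) [NeZero r] (χ : DirichletCharacter ℂ r), χ ≠ 1 → ∀ (t : ℝ) (Y : ℕ),
      0 < Y → ‖∑ p ∈ primeSet Y, primeWeight J Y p * (χ p * (p : ℂ) ^ (t * I))‖ ≤
        C * Real.log (r * (|t| + 4)) * (Y : ℝ) ^ (1 / 2 + δ) := by
  obtain ⟨C, hC, h⟩ := exists_norm_prime_sum_le
  refine ⟨32 * J.factorial * (36 / δ ^ 2) * Real.pi + C, by positivity, ?_⟩
  intro r _ χ hχ t Y hY
  have hr : (1 : ℝ) ≤ r := by exact_mod_cast NeZero.one_le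
  have hℓ := one_le_log_mul_add_four (t := t) hr
  have h1 := h J Y (fun n => χ n * (n : ℂ) ^ (t * I)) (fun n => by
    rw [norm_mul]
    exact mul_le_one₀ (DirichletCharacter.norm_le_one χ _) (norm_nonneg _)
      (norm_natCast_cpow_I_le t n))
  have h2 := norm_sum_char_vonMangoldt_le hG hχ hδ hδ1 t hY hJ
  have h3 : ∑ n ∈ Finset.range Y, (ArithmeticFunction.vonMangoldt n : ℂ) *
      (χ n * (n : ℂ) ^ (t * I)) * trunc J (n / Y) = ∑ n ∈ Finset.range Y,
      (χ n * ArithmeticFunction.vonMangoldt n) * (n : ℂ) ^ (t * I) * trunc J (n / Y) :=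
    Finset.sum_congr rfl fun n _ => by ring
  rw [h3] at h1
  refine h1.trans ((add_le_add_left h2 _).trans ?_)
  have h5 := mul_le_mul hℓ (sqrt_le_rpow hY hδ) (by positivity) (by linarith)
  have h6 := mul_le_mul_of_nonneg_left h5 hC.le
  linarith

theorem exists_norm_prime_cpow_sum_le (hG : GRH) {δ : ℝ} (hδ : 0 < δ) (hδ1 : δ ≤ 1) {J : ℕ}
    (hJ : 3 ≤ J) :
    ∃ C > (0 : ℝ), ∀ (t : ℝ) (Y : ℕ),
      0 < Y → ‖∑ p ∈ primeSet Y, primeWeight J Y p * (p : ℂ) ^ (t * I)‖ ≤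
        C * (Real.log (|t| + 4) * (Y : ℝ) ^ (1 / 2 + δ) + Y / (1 + |t|) ^ (J + 1)) := by
  obtain ⟨C, hC, h⟩ := exists_norm_prime_sum_le
  refine ⟨32 * J.factorial * (48 / δ ^ 2) * Real.pi + (C + 1) + J.factorial * 2 ^ (J + 1),
    by positivity, ?_⟩
  intro t Y hY
  have hℓ := one_le_log_mul_add_four (t := t) le_rfl
  rw [one_mul] at hℓ
  have h1 := h J Y (fun n => (n : ℂ) ^ (t * I)) (norm_natCast_cpow_I_le t)
  have h2 := norm_sum_vonMangoldt_le hG hδ hδ1 t hY hJ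
  refine h1.trans ((add_le_add_left h2 _).trans ?_)
  have h5 := mul_le_mul hℓ (sqrt_le_rpow hY hδ) (by positivity) (by linarith)
  have h5a : (1 : ℝ) ≤ √Y := by rw [Real.one_le_sqrt]; exact_mod_cast hY
  have h6 := mul_le_mul_of_nonneg_left h5 (by positivity : 0 ≤ C + 1)
  have h7 : 0 ≤ (Y : ℝ) / (1 + |t|) ^ (J + 1) := by positivity
  have h8 : 0 ≤ Real.log (|t| + 4) * (Y : ℝ) ^ (1 / 2 + δ) := by positivity
  have h9 : (Y : ℝ) * (J.factorial * 2 ^ (J + 1) / (1 + |t|) ^ (J + 1)) =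
    J.factorial * 2 ^ (J + 1) * (Y / (1 + |t|) ^ (J + 1)) := by ring
  rw [h9]
  have h10 : 0 ≤ (J.factorial * 2 ^ (J + 1) : ℝ) * (Real.log (|t| + 4) * (Y : ℝ) ^ (1 / 2 + δ)) := by
    positivity
  have h11 : 0 ≤ (32 * J.factorial * (48 / δ ^ 2) * Real.pi + (C + 1)) *
    ((Y : ℝ) / (1 + |t|) ^ (J + 1)) := by positivity
  nlinarith

theorem theta_eq_sum_primeSet_le {Y : ℕ} : ∑ p ∈ primeSet Y, Real.log p ≤ Real.log 4 * Y := by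
  refine le_trans ?_ (Chebyshev.theta_le_log4_mul_x (Nat.cast_nonneg Y))
  rw [Chebyshev.theta, Nat.floor_natCast]
  refine Finset.sum_le_sum_of_subset_of_nonneg ?_ fun p _ _ => Real.log_natCast_nonneg p
  intro p hp
  rw [mem_primeSet] at hp
  simp only [Finset.mem_filter, Finset.mem_Ioc]
  exact ⟨⟨hp.2.pos, hp.1.le⟩, hp.2⟩

theorem exists_le_sum_primeWeight (J : ℕ) : ∃ c > (0 : ℝ), ∃ Y₀ : ℕ, ∀ Y ≥ Y₀,
    c * Y ≤ ∑ p ∈ primeSet Y, primeWeight J Y p := by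
  have hl2 : 0 < Real.log 2 := Real.log_pos one_lt_two
  have hlim : ∀ᶠ x : ℝ in atTop, Real.log 2 / 2 * x ≤ Chebyshev.theta x := by
    have h1 : (fun x : ℝ => Real.log x) =o[atTop] fun x : ℝ => x ^ (1 / 4 : ℝ) :=
      isLittleO_log_rpow_atTop (by norm_num)
    have h2 := h1.bound (show (0 : ℝ) < 1 by norm_num)
    have h3 : Tendsto (fun x : ℝ => x ^ (1 / 4 : ℝ)) atTop atTop := tendsto_rpow_atTop (by norm_num)
    filter_upwards [h2, h3.eventually_ge_atTop (20 / Real.log 2 + 20), eventually_ge_atTop 2] with x hx hx2 hx3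
    refine le_trans ?_ (Chebyshev.theta_ge' (by linarith))
    have hx0 : 0 < x := by linarith
    set y := x ^ (1 / 4 : ℝ) with hy
    have hy4 : x = y ^ 4 := by
      rw [hy, ← Real.rpow_natCast, ← Real.rpow_mul hx0.le]; norm_num
    have hs : √x = y ^ 2 := by
      rw [hy4, show y ^ 4 = (y ^ 2) ^ 2 by ring, Real.sqrt_sq (by positivity)]
    have hlx : Real.log x ≤ y := by
      have := hx
      rw [one_mul, Real.norm_of_nonneg (Real.rpow_nonneg hx0.le _ : 0 ≤ y)] at this
      exact (le_abs_self _).trans this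
    have hlx0 : 0 ≤ Real.log x := Real.log_nonneg (by linarith)
    have hlx2 : Real.log (x + 2) ≤ Real.log x + 1 := by
      rw [← sub_le_iff_le_add', ← Real.log_div (by linarith) (by linarith)]
      refine (Real.log_le_sub_one_of_pos (by positivity)).trans ?_
      rw [tsub_le_iff_right, div_le_iff₀ hx0]; linarith
    have hy20 : 20 ≤ y := by
      have : 0 < 20 / Real.log 2 := by positivity
      linarith
    have hyl : 20 ≤ y * Real.log 2 := by
      have : 20 / Real.log 2 ≤ y := by linarith
      rwa [div_le_iff₀ hl2] at this
    rw [hs]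
    have hl1 : Real.log 2 ≤ 1 := by linarith [Real.log_two_lt_d9]
    have e1 : 2 * y ^ 2 * Real.log x ≤ 2 * y ^ 3 := by nlinarith [sq_nonneg y]
    have e2 : 10 * y ^ 3 ≤ Real.log 2 / 2 * x := by rw [hy4]; nlinarith [pow_pos (by linarith : 0 < y) 3]
    have e3 : y + 2 ≤ y ^ 3 := by nlinarith [sq_nonneg y]
    nlinarith
  obtain ⟨x₀, hx₀⟩ := eventually_atTop.mp hlim
  refine ⟨Real.log 2 / 8 * (1 / 2) ^ J, by positivity, ⌈2 * x₀⌉₊ + 4, fun Y hY => ?_⟩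
  have hYx : 2 * x₀ ≤ Y := (Nat.le_ceil _).trans (by exact_mod_cast (by omega : ⌈2 * x₀⌉₊ ≤ Y))
  have hY4 : (4 : ℝ) ≤ Y := by exact_mod_cast (by omega : 4 ≤ Y)
  have h1 := hx₀ ((Y : ℝ) / 2) (by linarith)
  have h2 : Chebyshev.theta ((Y : ℝ) / 2) * (1 / 2) ^ J ≤ ∑ p ∈ primeSet Y, primeWeight J Y p := by
    rw [Chebyshev.theta, Finset.sum_mul]
    refine (Finset.sum_le_sum fun p hp => ?_).trans
      (Finset.sum_le_sum_of_subset_of_nonneg (t := primeSet Y) (f := primeWeight J Y) ?_ fun p _ _ => primeWeight_nonneg _ _ _)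
    · simp only [Finset.mem_filter, Finset.mem_Ioc] at hp
      have hp2 : (p : ℝ) ≤ Y / 2 := (Nat.le_floor_iff (by positivity)).mp hp.1.2
      unfold primeWeight trunc
      refine mul_le_mul_of_nonneg_left ?_ (Real.log_natCast_nonneg p)
      refine pow_le_pow_left₀ (by norm_num) (le_max_of_le_left ?_) J
      have : (p : ℝ) / Y ≤ 1 / 2 := by rw [div_le_iff₀ (by linarith)]; linarith
      linarith
    · intro p hp
      simp only [Finset.mem_filter, Finset.mem_Ioc] at hp
      have hp2 : (p : ℝ) ≤ Y / 2 := (Nat.le_floor_iff (by positivity)).mp hp.1.2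
      rw [mem_primeSet]
      refine ⟨?_, hp.2⟩
      have : (p : ℝ) < Y := by linarith
      exact_mod_cast this
  refine le_trans ?_ h2
  have : (0 : ℝ) < (1 / 2) ^ J := by positivity
  have h3 := mul_le_mul_of_nonneg_right h1 this.le
  have : 0 ≤ Real.log 2 * Y * (1 / 2) ^ J := by positivity
  linarith

end LGrowth

namespace SmoothCircle
open Finset

section KMean
variable {V : Type*} [AddCommGroup V] [Module ℝ V]

/-- The weight of `n` as an ordered product of `k` elements of `P`. -/
noncomputable def kWeight (P : Finset ℕ) (w : ℕ → ℝ) : ℕ → ℕ → ℝ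
  | 0, n => if n = 1 then 1 else 0
  | k + 1, n => ∑ p ∈ P, if p ∣ n then w p * kWeight P w k (n / p) else 0

/-- The weighted sum of `Φ` over ordered products of `k` elements of `P`. -/
noncomputable def kMean (P : Finset ℕ) (w : ℕ → ℝ) : ℕ → (ℕ → V) → V
  | 0, Φ => Φ 1
  | k + 1, Φ => ∑ p ∈ P, w p • kMean P w k (fun n => Φ (p * n))

variable {P : Finset ℕ} {w : ℕ → ℝ} {Y : ℕ}

theorem kWeight_nonneg (hw : ∀ p, 0 ≤ w p) (k n : ℕ) : 0 ≤ kWeight P w k n := by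
  induction k generalizing n with
  | zero => unfold kWeight; split_ifs <;> norm_num
  | succ k ih =>
    unfold kWeight
    refine sum_nonneg fun p _ => ?_
    split_ifs
    · exact mul_nonneg (hw p) (ih _)
    · rfl

theorem kWeight_support (hP : ∀ p ∈ P, p.Prime ∧ p < Y) {k n : ℕ} (h : kWeight P w k n ≠ 0) :
    0 < n ∧ n ≤ Y ^ k ∧ ∀ q, q.Prime → q ∣ n → q ∈ P := by
  induction k generalizing n with
  | zero =>
    have : n = 1 := by
      by_contra hn
      exact h (by simp [kWeight, hn])
    subst this
    simp only [zero_lt_one, pow_zero, le_refl, true_and]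
    intro q hq h1
    exact absurd (Nat.dvd_one.mp h1) hq.ne_one
  | succ k ih =>
    unfold kWeight at h
    obtain ⟨p, hp, hne⟩ := exists_ne_zero_of_sum_ne_zero h
    have hpn : p ∣ n := by
      by_contra hpn
      exact hne (by simp [hpn])
    rw [if_pos hpn] at hne
    obtain ⟨i1, i2, i3⟩ := ih (right_ne_zero_of_mul hne)
    obtain ⟨m, rfl⟩ := hpn
    have hp0 := (hP p hp).1.pos
    rw [Nat.mul_div_cancel_left _ hp0] at i1 i2 i3
    refine ⟨Nat.mul_pos hp0 i1, ?_, fun q hq hqn => ?_⟩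
    · rw [pow_succ, mul_comm]
      exact Nat.mul_le_mul i2 (hP p hp).2.le
    · rcases (hq.dvd_mul).mp hqn with h1 | h1
      · rwa [(Nat.prime_dvd_prime_iff_eq hq (hP p hp).1).mp h1]
      · exact i3 q hq h1

theorem sum_weight_dvd_le_log (hP : ∀ p ∈ P, p.Prime) (hw1 : ∀ p, w p ≤ Real.log p) {n : ℕ} (hn : 0 < n) :
    ∑ p ∈ P with p ∣ n, w p ≤ Real.log n := by
  calc _ ≤ ∑ p ∈ n.primeFactors, Real.log p := by
        refine (sum_le_sum fun p _ => hw1 p).trans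
          (sum_le_sum_of_subset_of_nonneg ?_ fun p _ _ => Real.log_natCast_nonneg p)
        intro p hp
        rw [mem_filter] at hp
        exact Nat.mem_primeFactors.mpr ⟨hP p hp.1, hp.2, hn.ne'⟩
    _ = Real.log (∏ p ∈ n.primeFactors, p : ℕ) := by
        rw [Nat.cast_prod, Real.log_prod]
        intro p hp
        exact_mod_cast (Nat.prime_of_mem_primeFactors hp).ne_zero
    _ ≤ _ := by
        refine Real.log_le_log ?_ ?_
        · exact_mod_cast Finset.prod_pos fun p hp => (Nat.prime_of_mem_primeFactors hp).pos
        · exact_mod_cast Nat.le_of_dvd hn (Nat.prod_primeFactors_dvd n)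

theorem kWeight_le (hP : ∀ p ∈ P, p.Prime) (hw : ∀ p, 0 ≤ w p) (hw1 : ∀ p, w p ≤ Real.log p)
    (k : ℕ) {n : ℕ} (hn : 0 < n) : kWeight P w k n ≤ Real.log n ^ k := by
  induction k generalizing n with
  | zero => unfold kWeight; split_ifs <;> norm_num
  | succ k ih =>
    unfold kWeight
    rw [← sum_filter]
    calc _ ≤ ∑ p ∈ P with p ∣ n, w p * Real.log n ^ k := by
          refine sum_le_sum fun p hp => mul_le_mul_of_nonneg_left ?_ (hw p)
          rw [mem_filter] at hp
          have h0 : 0 < n / p := Nat.div_pos (Nat.le_of_dvd hn hp.2) (hP p hp.1).pos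
          refine (ih h0).trans (pow_le_pow_left₀ (Real.log_natCast_nonneg _) ?_ k)
          exact Real.log_le_log (by exact_mod_cast h0) (by exact_mod_cast Nat.div_le_self n p)
      _ ≤ Real.log n * Real.log n ^ k := by
          rw [← sum_mul]
          exact mul_le_mul_of_nonneg_right (sum_weight_dvd_le_log hP hw1 hn)
            (pow_nonneg (Real.log_natCast_nonneg _) _)
      _ = _ := by ring

theorem kMean_eq_sum (hP : ∀ p ∈ P, p.Prime ∧ p < Y) (k : ℕ) (Φ : ℕ → V) :
    kMean P w k Φ = ∑ n ∈ range (Y ^ k + 1), kWeight P w k n • Φ n := by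
  induction k generalizing Φ with
  | zero => simp [kMean, kWeight]
  | succ k ih =>
    unfold kMean
    conv_rhs => unfold kWeight
    simp_rw [sum_smul]
    rw [sum_comm]
    refine sum_congr rfl fun p hp => ?_
    have hp0 := (hP p hp).1.pos
    rw [ih, smul_sum]
    simp_rw [ite_smul, zero_smul]
    rw [← sum_filter]
    symm
    rw [← sum_subset (s₁ := (range (Y ^ k + 1)).image (fun n => p * n))]
    · rw [sum_image (by intro a _ b _ h; exact Nat.eq_of_mul_eq_mul_left hp0 h)]
      refine sum_congr rfl fun n _ => ?_
      rw [Nat.mul_div_cancel_left _ hp0, mul_smul]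
    · intro n hn
      rw [mem_image] at hn
      obtain ⟨m, hm, rfl⟩ := hn
      rw [mem_range] at hm
      rw [mem_filter, mem_range]
      refine ⟨?_, dvd_mul_right _ _⟩
      rw [pow_succ, mul_comm (Y ^ k)]
      exact Nat.lt_succ_of_le (Nat.mul_le_mul (hP p hp).2.le (by omega))
    · intro n hn hn2
      rw [mem_filter] at hn
      obtain ⟨m, rfl⟩ := hn.2
      rw [Nat.mul_div_cancel_left _ hp0]
      have : kWeight P w k m = 0 := by
        by_contra h
        refine hn2 (mem_image.mpr ⟨m, mem_range.mpr ?_, rfl⟩)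
        exact Nat.lt_succ_of_le (kWeight_support hP h).2.1
      rw [this, mul_zero, zero_smul]

theorem kMean_const (k : ℕ) (c : V) : kMean P w k (fun _ => c) = (∑ p ∈ P, w p) ^ k • c := by
  induction k with
  | zero => simp [kMean]
  | succ k ih => unfold kMean; beta_reduce; rw [ih, ← sum_smul, smul_smul, pow_succ']

theorem kMean_sum {ι : Type*} (s : Finset ι) (k : ℕ) (Φ : ι → ℕ → V) :
    kMean P w k (fun n => ∑ i ∈ s, Φ i n) = ∑ i ∈ s, kMean P w k (Φ i) := by
  induction k generalizing Φ with
  | zero => rfl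
  | succ k ih =>
    unfold kMean
    simp_rw [ih, smul_sum]
    rw [sum_comm]

theorem kMean_congr (hP : ∀ p ∈ P, 0 < p) (k : ℕ) {Φ Ψ : ℕ → V} (h : ∀ n, 0 < n → Φ n = Ψ n) :
    kMean P w k Φ = kMean P w k Ψ := by
  induction k generalizing Φ Ψ with
  | zero => exact h 1 one_pos
  | succ k ih =>
    unfold kMean
    exact sum_congr rfl fun p hp => congrArg _ (ih fun n hn => h _ (Nat.mul_pos (hP p hp) hn))

theorem kMean_mul (k : ℕ) (c : ℂ) (Φ : ℕ → ℂ) :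
    kMean P w k (fun n => c * Φ n) = c * kMean P w k Φ := by
  induction k generalizing Φ with
  | zero => rfl
  | succ k ih =>
    unfold kMean
    simp_rw [ih, mul_sum, mul_smul_comm]

theorem kMean_mono (hw : ∀ p, 0 ≤ w p) (hP : ∀ p ∈ P, 0 < p) (k : ℕ) {Φ Ψ : ℕ → ℝ}
    (h : ∀ n, 0 < n → Φ n ≤ Ψ n) : kMean P w k Φ ≤ kMean P w k Ψ := by
  induction k generalizing Φ Ψ with
  | zero => exact h 1 one_pos
  | succ k ih =>
    unfold kMean
    refine sum_le_sum fun p hp => mul_le_mul_of_nonneg_left (ih fun n hn => h _ ?_) (hw p)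
    exact Nat.mul_pos (hP p hp) hn

theorem kMean_nonneg (hw : ∀ p, 0 ≤ w p) (hP : ∀ p ∈ P, 0 < p) (k : ℕ) {Φ : ℕ → ℝ}
    (h : ∀ n, 0 < n → 0 ≤ Φ n) : 0 ≤ kMean P w k Φ := by
  have := kMean_mono (w := w) hw hP k (Φ := fun _ => 0) h
  rwa [kMean_const, smul_zero] at this

theorem kMean_real_mul (k : ℕ) (c : ℝ) (Φ : ℕ → ℝ) :
    kMean P w k (fun n => c * Φ n) = c * kMean P w k Φ := by
  induction k generalizing Φ with
  | zero => rfl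
  | succ k ih =>
    unfold kMean
    simp_rw [ih, mul_sum, mul_smul_comm]

theorem norm_kMean_le (hw : ∀ p, 0 ≤ w p) (k : ℕ) (Φ : ℕ → ℂ) :
    ‖kMean P w k Φ‖ ≤ kMean P w k (fun n => ‖Φ n‖) := by
  induction k generalizing Φ with
  | zero => rfl
  | succ k ih =>
    unfold kMean
    refine (norm_sum_le _ _).trans (sum_le_sum fun p _ => ?_)
    rw [norm_smul, Real.norm_of_nonneg (hw p)]
    exact mul_le_mul_of_nonneg_left (ih _) (hw p)

end KMean

section Divisors
variable {P : Finset ℕ} {w : ℕ → ℝ} {W K : ℝ}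

open ArithmeticFunction in
theorem kMean_dvd_le_aux (hP : ∀ p ∈ P, p.Prime) (hw : ∀ p, 0 ≤ w p) (hW : ∑ p ∈ P, w p ≤ W)
    (hK : 0 < K) (h : ∀ p ∈ P, w p * K ≤ W * (p : ℝ) ^ (-(7 / 8) : ℝ)) (k : ℕ) {d : ℕ} (hd : 0 < d) :
    kMean P w k (fun n => if d ∣ n then (1 : ℝ) else 0) ≤
      W ^ k * (k / K) ^ cardFactors d * (d : ℝ) ^ (-(7 / 8) : ℝ) := by
  have hP' : ∀ p ∈ P, 0 < p := fun p hp => (hP p hp).pos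
  have hW0 : 0 ≤ W := (sum_nonneg fun p _ => hw p).trans hW
  induction k generalizing d with
  | zero =>
    unfold kMean
    beta_reduce
    split_ifs with h1
    · have : d = 1 := Nat.dvd_one.mp h1
      subst this
      simp
    · positivity
  | succ k ih =>
    set a := cardFactors d with ha
    set D : ℝ := (d : ℝ) ^ (-(7 / 8) : ℝ) with hD
    have hD0 : 0 ≤ D := by positivity
    unfold kMean
    have hterm : ∀ p ∈ P, w p • kMean P w k (fun n => if d ∣ p * n then (1 : ℝ) else 0) ≤
        w p * (W ^ k * (k / K) ^ a * D) +
          if p ∣ d then W ^ (k + 1) * (1 / K * (k / K) ^ (a - 1)) * D else 0 := by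
      intro p hp
      have hpp := hP p hp
      rw [smul_eq_mul]
      split_ifs with hpd
      · obtain ⟨e, rfl⟩ := hpd
        have he : 0 < e := Nat.pos_of_mul_pos_left hd
        have h1 : ∀ n, (p * e ∣ p * n) = (e ∣ n) := fun n =>
          propext (Nat.mul_dvd_mul_iff_left hpp.pos)
        simp_rw [h1]
        have h2 : a = cardFactors e + 1 := by
          rw [ha, cardFactors_mul hpp.ne_zero he.ne', cardFactors_apply_prime hpp, add_comm]
        have h3 : a - 1 = cardFactors e := by omega
        rw [h3]
        have h4 : D = (p : ℝ) ^ (-(7 / 8) : ℝ) * (e : ℝ) ^ (-(7 / 8) : ℝ) := by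
          rw [hD, Nat.cast_mul, Real.mul_rpow (by positivity) (by positivity)]
        have h5 : w p ≤ W * (p : ℝ) ^ (-(7 / 8) : ℝ) / K := by
          rw [le_div_iff₀ hK]; exact h p hp
        have h6 := mul_le_mul_of_nonneg_left (ih he) (hw p)
        have h7 := mul_le_mul_of_nonneg_right h5
          (by positivity : 0 ≤ W ^ k * (k / K) ^ cardFactors e * (e : ℝ) ^ (-(7 / 8) : ℝ))
        have h8 : 0 ≤ w p * (W ^ k * (k / K) ^ a * D) := mul_nonneg (hw p) (by positivity)
        refine (h6.trans h7).trans ?_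
        refine le_trans (le_of_eq ?_) (le_add_of_nonneg_left h8)
        rw [h4]
        ring
      · have h1 : ∀ n, (d ∣ p * n) = (d ∣ n) := fun n => propext
          (Nat.Coprime.dvd_mul_left ((Nat.Prime.coprime_iff_not_dvd hpp).mpr hpd).symm)
        simp_rw [h1, add_zero]
        exact mul_le_mul_of_nonneg_left (ih hd) (hw p)
    refine (sum_le_sum hterm).trans ?_
    rw [sum_add_distrib, ← sum_mul, ← sum_filter, sum_const, nsmul_eq_mul]
    have hcard : ((P.filter (· ∣ d)).card : ℝ) ≤ a := by
      have h1 : (P.filter (· ∣ d)).card ≤ cardDistinctFactors d := by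
        rw [cardDistinctFactors_apply, ← List.card_toFinset]
        refine card_le_card fun p hp => ?_
        rw [mem_filter] at hp
        rw [List.mem_toFinset]
        exact (Nat.mem_primeFactorsList hd.ne').mpr ⟨hP p hp.1, hp.2⟩
      exact_mod_cast h1.trans ((List.dedup_sublist _).length_le)
    have hx : 0 ≤ (k : ℝ) / K := by positivity
    have hkey : ((k : ℝ) / K) ^ a + a * (1 / K * (k / K) ^ (a - 1)) ≤ ((k + 1 : ℕ) / K : ℝ) ^ a := by
      have hsplit : ((k + 1 : ℕ) / K : ℝ) = k / K + 1 / K := by push_cast; ring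
      rw [hsplit]
      generalize (k : ℝ) / K = x at *
      have hy : 0 ≤ 1 / K := by positivity
      generalize 1 / K = y at *
      clear * - hx hy
      induction a with
      | zero => simp
      | succ a ih =>
        rcases a.eq_zero_or_pos with h0 | h0
        · subst h0; simp
        · have e : x ^ (a - 1 + 1) = x ^ a := by congr 1; omega
          have h1 : (x ^ a + a * (y * x ^ (a - 1))) * (x + y) ≤ (x + y) ^ (a + 1) := by
            rw [pow_succ]; exact mul_le_mul_of_nonneg_right ih (by positivity)
          refine le_trans ?_ h1
          simp only [Nat.add_sub_cancel]
          push_cast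
          have h2 : 0 ≤ (a : ℝ) * (y * x ^ (a - 1)) * y := by positivity
          have h3 : (x ^ a + a * (y * x ^ (a - 1))) * (x + y) = x ^ (a + 1) + x ^ a * y +
            a * y * x ^ (a - 1 + 1) + a * (y * x ^ (a - 1)) * y := by ring
          rw [h3, e]
          linarith
    calc _ ≤ W * (W ^ k * (k / K) ^ a * D) + a * (W ^ (k + 1) * (1 / K * (k / K) ^ (a - 1)) * D) := by
          gcongr
      _ = W ^ (k + 1) * ((k / K) ^ a + a * (1 / K * (k / K) ^ (a - 1))) * D := by ring
      _ ≤ _ := by gcongr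

theorem kMean_dvd_le (hP : ∀ p ∈ P, p.Prime) (hw : ∀ p, 0 ≤ w p) (hW : ∑ p ∈ P, w p ≤ W)
    (hK : 0 < K) (h : ∀ p ∈ P, w p * K ≤ W * (p : ℝ) ^ (-(7 / 8) : ℝ)) {k : ℕ} (hkK : k ≤ K)
    {d : ℕ} (hd : 0 < d) :
    kMean P w k (fun n => if d ∣ n then (1 : ℝ) else 0) ≤ W ^ k * (d : ℝ) ^ (-(7 / 8) : ℝ) := by
  have hW0 : 0 ≤ W := (sum_nonneg fun p _ => hw p).trans hW
  refine (kMean_dvd_le_aux hP hw hW hK h k hd).trans ?_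
  have h1 : ((k : ℝ) / K) ^ ArithmeticFunction.cardFactors d ≤ 1 :=
    pow_le_one₀ (by positivity) ((div_le_one hK).mpr hkK)
  calc _ ≤ W ^ k * 1 * (d : ℝ) ^ (-(7 / 8) : ℝ) := by gcongr
    _ = _ := by ring

theorem gcd_le_sum_dvd {n r : ℕ} (hr : 0 < r) :
    (n.gcd r : ℝ) ≤ ∑ d ∈ r.divisors, (d : ℝ) * if d ∣ n then 1 else 0 := by
  have := single_le_sum (f := fun d : ℕ => (d : ℝ) * if d ∣ n then 1 else 0)
    (fun d _ => by positivity) (Nat.mem_divisors.mpr ⟨Nat.gcd_dvd_right n r, hr.ne'⟩)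
  simpa [Nat.gcd_dvd_left] using this

theorem kMean_gcd_le (hP : ∀ p ∈ P, p.Prime) (hw : ∀ p, 0 ≤ w p) (hW : ∑ p ∈ P, w p ≤ W)
    (hK : 0 < K) (h : ∀ p ∈ P, w p * K ≤ W * (p : ℝ) ^ (-(7 / 8) : ℝ)) {k : ℕ} (hkK : k ≤ K)
    {r : ℕ} (hr : 0 < r) :
    kMean P w k (fun n => (n.gcd r : ℝ)) ≤ W ^ k * (r.divisors.card * (r : ℝ) ^ (1 / 8 : ℝ)) := by
  have hP' : ∀ p ∈ P, 0 < p := fun p hp => (hP p hp).pos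
  have hW0 : 0 ≤ W := (sum_nonneg fun p _ => hw p).trans hW
  refine (kMean_mono hw hP' k fun n _ => gcd_le_sum_dvd hr).trans ?_
  rw [kMean_sum]
  calc _ ≤ ∑ d ∈ r.divisors, W ^ k * (r : ℝ) ^ (1 / 8 : ℝ) := by
        refine sum_le_sum fun d hd => ?_
        have hd0 := Nat.pos_of_mem_divisors hd
        have hd1 : (0 : ℝ) < d := by exact_mod_cast hd0
        rw [kMean_real_mul]
        refine (mul_le_mul_of_nonneg_left (kMean_dvd_le hP hw hW hK h hkK hd0) hd1.le).trans ?_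
        have : (d : ℝ) * (W ^ k * (d : ℝ) ^ (-(7 / 8) : ℝ)) = W ^ k * (d : ℝ) ^ (1 / 8 : ℝ) := by
          have : (d : ℝ) * (d : ℝ) ^ (-(7 / 8) : ℝ) = (d : ℝ) ^ (1 / 8 : ℝ) := by
            nth_rewrite 1 [← Real.rpow_one (d : ℝ)]
            rw [← Real.rpow_add hd1]; norm_num
          rw [← this]; ring
        rw [this]
        gcongr
        exact Nat.divisor_le hd
    _ = _ := by rw [sum_const, nsmul_eq_mul]; ring

end Divisors
end SmoothCircle

namespace SmoothCircle
open Finset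

section CharCoeff
variable {r : ℕ} [NeZero r]

/-- The coefficient of the character `χ` in the expansion of `u ↦ e(u y / r)` on units. -/
noncomputable def charCoeff (χ : DirichletCharacter ℂ r) (y : ZMod r) : ℂ :=
  (r.totient : ℂ)⁻¹ * gaussSum χ⁻¹ (AddChar.mulShift ZMod.stdAddChar y)

theorem totient_cast_ne_zero : (r.totient : ℂ) ≠ 0 :=
  Nat.cast_ne_zero.mpr (Nat.totient_pos.mpr (NeZero.pos r)).ne'

theorem sum_charCoeff (y : ZMod r) :
    ∑ χ : DirichletCharacter ℂ r, charCoeff χ y = ZMod.stdAddChar y := by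
  unfold charCoeff gaussSum
  rw [← mul_sum, sum_comm]
  have h : ∀ a : ZMod r, ∑ χ : DirichletCharacter ℂ r, χ⁻¹ a * AddChar.mulShift ZMod.stdAddChar y a =
      (if a = 1 then (r.totient : ℂ) else 0) * AddChar.mulShift ZMod.stdAddChar y a := by
    intro a
    rw [← sum_mul, ← DirichletCharacter.sum_characters_eq ℂ a]
    congr 1
    exact Equiv.sum_comp (Equiv.inv (DirichletCharacter ℂ r)) (fun χ => χ a)
  simp_rw [h, ite_mul, zero_mul]
  rw [sum_ite_eq' univ (1 : ZMod r), if_pos (mem_univ _), ← mul_assoc,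
    inv_mul_cancel₀ totient_cast_ne_zero, one_mul, AddChar.mulShift_apply, mul_one]

theorem charCoeff_unit_mul (χ : DirichletCharacter ℂ r) (v : (ZMod r)ˣ) (y : ZMod r) :
    charCoeff χ (v * y) = χ v * charCoeff χ y := by
  have h : AddChar.mulShift (ZMod.stdAddChar (N := r)) (v * y) =
      AddChar.mulShift (AddChar.mulShift ZMod.stdAddChar y) v := by
    ext a; simp only [AddChar.mulShift_apply]; ring_nf
  unfold charCoeff
  rw [h, gaussSum_mulShift_eq, inv_inv]
  ring

theorem sum_norm_sq_char_sum (f : ZMod r → ℂ) :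
    ∑ χ : DirichletCharacter ℂ r, ‖∑ a, χ a * f a‖ ^ 2 ≤ r.totient * ∑ a with IsUnit a, ‖f a‖ ^ 2 := by
  have key : ∑ χ : DirichletCharacter ℂ r, ((∑ a, χ a * f a) * star (∑ a, χ a * f a)) =
      r.totient * ∑ a with IsUnit a, f a * star (f a) := by
    simp_rw [star_sum, sum_mul_sum, star_mul, MulChar.star_apply']
    rw [sum_comm]
    simp_rw [sum_comm (s := (univ : Finset (DirichletCharacter ℂ r)))]
    rw [mul_sum, sum_comm, sum_filter]
    refine sum_congr rfl fun b _ => ?_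
    by_cases hb : IsUnit b
    · rw [if_pos hb]
      have : ∀ a : ZMod r, ∑ χ : DirichletCharacter ℂ r, χ a * f a * (star (f b) * χ⁻¹ b) =
          (if b = a then (r.totient : ℂ) else 0) * (f a * star (f b)) := by
        intro a
        rw [← DirichletCharacter.sum_char_inv_mul_char_eq ℂ hb a, sum_mul]
        refine sum_congr rfl fun χ _ => ?_
        have : χ⁻¹ b = χ b⁻¹ := by
          rw [MulChar.inv_apply]
          congr 1
          obtain ⟨u, rfl⟩ := hb
          rw [Ring.inverse_unit, ZMod.inv_coe_unit]
        rw [this]; ring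
      simp_rw [this, ite_mul, zero_mul]
      rw [sum_ite_eq univ b, if_pos (mem_univ _)]
    · rw [if_neg hb]
      refine sum_eq_zero fun a _ => sum_eq_zero fun χ _ => ?_
      rw [MulChar.map_nonunit _ hb]; ring
  have e : ∀ z : ℂ, z * star z = ((‖z‖ ^ 2 : ℝ) : ℂ) := fun z => by
    rw [Complex.star_def, Complex.mul_conj, Complex.normSq_eq_norm_sq]
  simp_rw [e] at key
  have key2 : ((∑ χ : DirichletCharacter ℂ r, ‖∑ a, χ a * f a‖ ^ 2 : ℝ) : ℂ) =
      ((r.totient * ∑ a with IsUnit a, ‖f a‖ ^ 2 : ℝ) : ℂ) := by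
    push_cast at key ⊢
    exact key
  exact (Complex.ofReal_injective key2).le

theorem sum_norm_charCoeff_le (y : ZMod r) :
    ∑ χ : DirichletCharacter ℂ r, ‖charCoeff χ y‖ ≤ √r := by
  have hφ : (0 : ℝ) < r.totient := by exact_mod_cast Nat.totient_pos.mpr (NeZero.pos r)
  have h1 : ∑ χ : DirichletCharacter ℂ r, ‖charCoeff χ y‖ ^ 2 ≤ 1 := by
    have h2 := sum_norm_sq_char_sum (r := r) (AddChar.mulShift ZMod.stdAddChar y)
    have h3 : ∀ χ : DirichletCharacter ℂ r, ‖charCoeff χ y‖ ^ 2 = ((r.totient : ℝ)⁻¹) ^ 2 *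
        ‖∑ a, χ⁻¹ a * AddChar.mulShift ZMod.stdAddChar y a‖ ^ 2 := by
      intro χ
      unfold charCoeff gaussSum
      rw [norm_mul, mul_pow]
      congr 2
      rw [norm_inv]; simp
    simp_rw [h3]
    rw [← mul_sum]
    have h6 := Equiv.sum_comp (Equiv.inv (DirichletCharacter ℂ r))
      (fun χ => ‖∑ a, χ a * AddChar.mulShift ZMod.stdAddChar y a‖ ^ 2)
    simp only [Equiv.inv_apply] at h6
    rw [h6]
    have h4 : ∑ a : ZMod r with IsUnit a, ‖AddChar.mulShift (ZMod.stdAddChar (N := r)) y a‖ ^ 2 = r.totient := by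
      have : ∀ a, ‖AddChar.mulShift (ZMod.stdAddChar (N := r)) y a‖ = 1 := fun a => AddChar.norm_apply _ _
      simp_rw [this, one_pow, sum_const, nsmul_eq_mul, mul_one]
      rw [← ZMod.card_units_eq_totient, ← card_univ,
        ← card_image_of_injective (univ : Finset (ZMod r)ˣ) Units.val_injective]
      congr 2
      ext a
      simp only [mem_filter, mem_univ, true_and, mem_image]
      rfl
    rw [h4] at h2
    calc _ ≤ ((r.totient : ℝ)⁻¹) ^ 2 * (r.totient * r.totient) := by gcongr
      _ = 1 := by field_simp
  have h5 := sum_mul_sq_le_sq_mul_sq (univ : Finset (DirichletCharacter ℂ r)) (fun _ => (1 : ℝ)) (fun χ => ‖charCoeff χ y‖)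
  simp only [one_mul, one_pow, sum_const, nsmul_eq_mul, mul_one] at h5
  refine Real.le_sqrt_of_sq_le (h5.trans ?_)
  have h6 : ((univ : Finset (DirichletCharacter ℂ r)).card : ℝ) ≤ r := by
    rw [card_univ, ← Nat.card_eq_fintype_card, DirichletCharacter.card_eq_totient_of_hasEnoughRootsOfUnity]
    exact_mod_cast Nat.totient_le r
  calc _ ≤ (r : ℝ) * 1 := by gcongr
    _ = r := mul_one _

theorem norm_sum_stdAddChar_dvd_le {d : ℕ} (hd : d ∣ r) (x : ℕ) :
    ‖∑ n ∈ range r with d ∣ n, ZMod.stdAddChar ((n : ZMod r) * (x : ZMod r))‖ ≤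
      if r / d ∣ x then ((r / d : ℕ) : ℝ) else 0 := by
  obtain ⟨q, hq⟩ := hd
  have hr0 := NeZero.pos r
  have hd0 : 0 < d := Nat.pos_of_mul_pos_right (hq ▸ hr0)
  have hq0 : 0 < q := Nat.pos_of_mul_pos_left (hq ▸ hr0)
  have hqd : r / d = q := by rw [hq, Nat.mul_div_cancel_left _ hd0]
  have h1 : ∑ n ∈ range r with d ∣ n, ZMod.stdAddChar ((n : ZMod r) * (x : ZMod r)) =
      ∑ v ∈ range q, (ZMod.stdAddChar (((d * x : ℕ) : ZMod r)) : ℂ) ^ v := by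
    symm
    refine sum_bij (fun v _ => d * v) ?_ ?_ ?_ ?_
    · intro v hv
      rw [mem_filter, mem_range]
      refine ⟨?_, dvd_mul_right d v⟩
      calc d * v < d * q := by gcongr; exact mem_range.mp hv
        _ = r := hq.symm
    · intro a _ b _ h; exact Nat.eq_of_mul_eq_mul_left hd0 h
    · intro n hn
      rw [mem_filter, mem_range] at hn
      obtain ⟨hn, v, rfl⟩ := hn
      exact ⟨v, mem_range.mpr (Nat.lt_of_mul_lt_mul_left (a := d) (by rwa [← hq])), rfl⟩
    · intro v _
      rw [← AddChar.map_nsmul_eq_pow]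
      congr 1
      push_cast; rw [nsmul_eq_mul]; ring
  rw [h1, hqd]
  have h0 : (ZMod.stdAddChar (((d * x : ℕ) : ZMod r)) : ℂ) ^ q = 1 := by
    rw [← AddChar.map_nsmul_eq_pow]
    have : q • ((d * x : ℕ) : ZMod r) = 0 := by
      rw [nsmul_eq_mul, ← Nat.cast_mul, ZMod.natCast_eq_zero_iff]
      exact ⟨x, by rw [hq]; ring⟩
    rw [this, AddChar.map_zero_eq_one]
  split_ifs with hx
  · refine (norm_sum_le _ _).trans ?_
    simp [AddChar.norm_apply]
  · have hne : (ZMod.stdAddChar (((d * x : ℕ) : ZMod r)) : ℂ) ≠ 1 := by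
      intro h
      apply hx
      have : ((d * x : ℕ) : ZMod r) = 0 := by
        apply ZMod.injective_stdAddChar (N := r)
        rw [h, AddChar.map_zero_eq_one]
      rw [ZMod.natCast_eq_zero_iff, hq] at this
      exact Nat.dvd_of_mul_dvd_mul_left hd0 this
    have := geom_sum_mul (ZMod.stdAddChar (((d * x : ℕ) : ZMod r)) : ℂ) q
    rw [h0, sub_self, mul_eq_zero, or_iff_left (sub_ne_zero.mpr hne)] at this
    rw [this, norm_zero]

theorem sum_moebius_divisors (g : ℕ) :
    ∑ d ∈ g.divisors, ArithmeticFunction.moebius d = if g = 1 then 1 else 0 := by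
  rw [← ArithmeticFunction.coe_mul_zeta_apply, ArithmeticFunction.moebius_mul_coe_zeta, ArithmeticFunction.one_apply]

theorem norm_charCoeff_one_le (x : ℕ) :
    ‖charCoeff (1 : DirichletCharacter ℂ r) (x : ZMod r)‖ ≤
      (x.gcd r) * (r.divisors.card / r.totient : ℝ) := by
  have hr0 := NeZero.pos r
  have h1 : gaussSum (1 : DirichletCharacter ℂ r)⁻¹ (AddChar.mulShift ZMod.stdAddChar (x : ZMod r)) =
      ∑ d ∈ r.divisors, (ArithmeticFunction.moebius d : ℂ) *
        ∑ n ∈ range r with d ∣ n, ZMod.stdAddChar ((n : ZMod r) * (x : ZMod r)) := by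
    unfold gaussSum
    simp_rw [sum_filter, mul_sum]
    rw [sum_comm]
    symm
    refine sum_bij (fun n _ => (n : ZMod r)) (fun _ _ => mem_univ _) ?_ ?_ ?_
    · intro a ha b hb h
      rw [mem_range] at ha hb
      rw [ZMod.natCast_eq_natCast_iff'] at h
      rwa [Nat.mod_eq_of_lt ha, Nat.mod_eq_of_lt hb] at h
    · intro b _
      exact ⟨b.val, mem_range.mpr (ZMod.val_lt b), ZMod.natCast_zmod_val b⟩
    · intro n _
      have hg : n.gcd r ≠ 0 := (Nat.gcd_pos_of_pos_right _ hr0).ne'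
      have h2 : (1 : DirichletCharacter ℂ r)⁻¹ (n : ZMod r) =
          ∑ d ∈ r.divisors, (ArithmeticFunction.moebius d : ℂ) * if d ∣ n then 1 else 0 := by
        have h3 : ∑ d ∈ r.divisors, (ArithmeticFunction.moebius d : ℂ) * (if d ∣ n then (1 : ℂ) else 0) =
            ((∑ d ∈ (n.gcd r).divisors, ArithmeticFunction.moebius d : ℤ) : ℂ) := by
          push_cast
          simp_rw [mul_ite, mul_one, mul_zero]
          rw [← sum_filter]
          refine sum_congr ?_ fun _ _ => rfl
          ext d
          simp only [mem_filter, Nat.mem_divisors, Nat.dvd_gcd_iff]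
          constructor
          · rintro ⟨⟨a, _⟩, b⟩; exact ⟨⟨b, a⟩, hg⟩
          · rintro ⟨⟨a, b⟩, _⟩; exact ⟨⟨b, hr0.ne'⟩, a⟩
        rw [h3, sum_moebius_divisors, inv_one]
        by_cases hu : IsUnit (n : ZMod r)
        · rw [MulChar.one_apply hu]
          rw [ZMod.isUnit_iff_coprime] at hu
          rw [if_pos hu]; simp
        · rw [MulChar.map_nonunit _ hu]
          rw [ZMod.isUnit_iff_coprime] at hu
          rw [if_neg hu]; simp
      rw [h2, sum_mul, AddChar.mulShift_apply]
      refine sum_congr rfl fun d _ => ?_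
      split_ifs <;> simp [mul_comm]
  unfold charCoeff
  rw [h1, norm_mul, norm_inv, Complex.norm_natCast]
  have h4 : ‖∑ d ∈ r.divisors, (ArithmeticFunction.moebius d : ℂ) *
        ∑ n ∈ range r with d ∣ n, ZMod.stdAddChar ((n : ZMod r) * (x : ZMod r))‖ ≤ x.gcd r * r.divisors.card := by
    refine (norm_sum_le_of_le _ (f := fun d => (ArithmeticFunction.moebius d : ℂ) *
        ∑ n ∈ range r with d ∣ n, ZMod.stdAddChar ((n : ZMod r) * (x : ZMod r))) (n := fun _ => (x.gcd r : ℝ)) ?_).trans ?_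
    · intro d hd
      rw [norm_mul]
      have hm : ‖(ArithmeticFunction.moebius d : ℂ)‖ ≤ 1 := by
        rw [Complex.norm_intCast]; exact_mod_cast ArithmeticFunction.abs_moebius_le_one
      have h5 := norm_sum_stdAddChar_dvd_le (Nat.dvd_of_mem_divisors hd) x
      have h6 : (if r / d ∣ x then ((r / d : ℕ) : ℝ) else 0) ≤ x.gcd r := by
        split_ifs with h
        · exact_mod_cast Nat.le_of_dvd (Nat.gcd_pos_of_pos_right _ hr0)
            (Nat.dvd_gcd h (Nat.div_dvd_of_dvd (Nat.dvd_of_mem_divisors hd)))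
        · positivity
      calc _ ≤ 1 * (x.gcd r : ℝ) := mul_le_mul hm (h5.trans h6) (norm_nonneg _) zero_le_one
        _ = _ := one_mul _
    · rw [sum_const, nsmul_eq_mul, mul_comm]
  calc _ ≤ (r.totient : ℝ)⁻¹ * (x.gcd r * r.divisors.card) := by gcongr
    _ = _ := by ring

end CharCoeff
end SmoothCircle

namespace SmoothCircle
open Finset

section Divisors

theorem exists_card_divisors_le {η : ℝ} (hη : 0 < η) :
    ∃ C : ℝ, 1 ≤ C ∧ ∀ n : ℕ, 0 < n → (n.divisors.card : ℝ) ≤ C * (n : ℝ) ^ η := by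
  set B : ℝ := 1 + 1 / (η * Real.log 2) with hB
  have hl2 : 0 < Real.log 2 := Real.log_pos one_lt_two
  have hB1 : 1 ≤ B := by rw [hB]; have : 0 < 1 / (η * Real.log 2) := by positivity
                         linarith
  set N : ℕ := ⌈(2 : ℝ) ^ (1 / η)⌉₊ with hN
  have hsmall : ∀ p a : ℕ, p.Prime → ((a + 1 : ℕ) : ℝ) ≤ B * ((p : ℝ) ^ η) ^ a := by
    intro p a hp
    have h2p : (2 : ℝ) ≤ p := by exact_mod_cast hp.two_le
    have h1 : 1 + a * (η * Real.log 2) ≤ ((p : ℝ) ^ η) ^ a := by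
      calc 1 + a * (η * Real.log 2) ≤ Real.exp (a * (η * Real.log 2)) := by
            linarith [Real.add_one_le_exp (a * (η * Real.log 2))]
        _ = ((2 : ℝ) ^ η) ^ a := by
            rw [Real.rpow_def_of_pos two_pos, ← Real.exp_nat_mul]; ring_nf
        _ ≤ _ := by gcongr
    have h0 : 0 < η * Real.log 2 := by positivity
    calc ((a + 1 : ℕ) : ℝ) = a + 1 := by push_cast; rfl
      _ ≤ B * (1 + a * (η * Real.log 2)) := by
          rw [hB]
          have : (1 + 1 / (η * Real.log 2)) * (1 + a * (η * Real.log 2)) =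
            a + 1 + a * (η * Real.log 2) + 1 / (η * Real.log 2) := by field_simp; ring
          rw [this]
          have : 0 ≤ a * (η * Real.log 2) := by positivity
          have : 0 ≤ 1 / (η * Real.log 2) := by positivity
          linarith
      _ ≤ _ := by gcongr
  have hlarge : ∀ p a : ℕ, N ≤ p → ((a + 1 : ℕ) : ℝ) ≤ ((p : ℝ) ^ η) ^ a := by
    intro p a hp
    have h1 : (2 : ℝ) ≤ (p : ℝ) ^ η := by
      have : (2 : ℝ) ^ (1 / η) ≤ p := (Nat.le_ceil _).trans (by exact_mod_cast hp)
      calc (2 : ℝ) = ((2 : ℝ) ^ (1 / η)) ^ η := by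
            rw [← Real.rpow_mul (by norm_num), one_div_mul_cancel hη.ne', Real.rpow_one]
        _ ≤ _ := by gcongr
    calc ((a + 1 : ℕ) : ℝ) ≤ (2 : ℝ) ^ a := by exact_mod_cast Nat.succ_le_of_lt Nat.lt_two_pow_self
      _ ≤ _ := by gcongr
  refine ⟨B ^ N, one_le_pow₀ hB1, fun n hn => ?_⟩
  rw [Nat.card_divisors hn.ne']
  have h2 : (n : ℝ) ^ η = ∏ p ∈ n.primeFactors, ((p : ℝ) ^ η) ^ n.factorization p := by
    conv_lhs => rw [← Nat.prod_factorization_pow_eq_self hn.ne']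
    rw [Finsupp.prod, Nat.support_factorization]
    push_cast
    rw [← Real.finsetProd_rpow _ _ (fun p _ => by positivity)]
    refine prod_congr rfl fun p _ => ?_
    rw [← Real.rpow_natCast, ← Real.rpow_natCast, ← Real.rpow_mul (by positivity), ← Real.rpow_mul (by positivity), mul_comm]
  have h3 : ∏ p ∈ n.primeFactors, (if p < N then B else 1) ≤ B ^ N := by
    rw [← prod_filter, prod_const]
    refine pow_le_pow_right₀ hB1 ?_
    calc _ ≤ (range N).card := card_le_card fun p hp => mem_range.mpr (mem_filter.mp hp).2
      _ = N := card_range N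
  rw [h2]
  calc ((∏ p ∈ n.primeFactors, (n.factorization p + 1) : ℕ) : ℝ)
      ≤ ∏ p ∈ n.primeFactors, ((if p < N then B else 1) * ((p : ℝ) ^ η) ^ n.factorization p) := by
        rw [Nat.cast_prod]
        refine prod_le_prod (fun _ _ => by positivity) fun p hp => ?_
        split_ifs with h
        · exact hsmall p _ (Nat.prime_of_mem_primeFactors hp)
        · rw [one_mul]; exact hlarge p _ (not_lt.mp h)
    _ = (∏ p ∈ n.primeFactors, (if p < N then B else 1)) * _ := prod_mul_distrib
    _ ≤ _ := by gcongr

theorem le_totient_mul_card_divisors {n : ℕ} (hn : 0 < n) : n ≤ n.totient * n.divisors.card := by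
  have h1 := Nat.totient_mul_prod_primeFactors n
  have hp : 0 < ∏ p ∈ n.primeFactors, (p - 1) :=
    prod_pos fun p hp => Nat.sub_pos_of_lt (Nat.prime_of_mem_primeFactors hp).one_lt
  refine Nat.le_of_mul_le_mul_right ?_ hp
  rw [← h1, mul_assoc]
  refine Nat.mul_le_mul_left _ ?_
  rw [Nat.card_divisors hn.ne', ← prod_mul_distrib]
  refine prod_le_prod' fun p hp => ?_
  have h2 := (Nat.prime_of_mem_primeFactors hp).two_le
  have h3 : 1 ≤ n.factorization p := (Nat.prime_of_mem_primeFactors hp).factorization_pos_of_dvd hn.ne' (Nat.dvd_of_mem_primeFactors hp)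
  calc p ≤ 2 * (p - 1) := by omega
    _ ≤ _ := by gcongr; omega

theorem sum_gcd_le {r : ℕ} (hr : 0 < r) (M : ℕ) :
    ∑ m ∈ range M, ((m + 1).gcd r : ℝ) ≤ M * r.divisors.card := by
  calc ∑ m ∈ range M, ((m + 1).gcd r : ℝ)
      ≤ ∑ m ∈ range M, ∑ d ∈ r.divisors, (d : ℝ) * if d ∣ m + 1 then 1 else 0 :=
        sum_le_sum fun m _ => gcd_le_sum_dvd hr
    _ = ∑ d ∈ r.divisors, (d : ℝ) * (M / d : ℕ) := by
        rw [sum_comm]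
        refine sum_congr rfl fun d hd => ?_
        rw [← mul_sum, sum_boole]
        congr 2
        have := Nat.card_multiples M d
        convert this using 2
    _ ≤ ∑ d ∈ r.divisors, (M : ℝ) := by
        refine sum_le_sum fun d hd => ?_
        exact_mod_cast Nat.mul_div_le M d
    _ = _ := by rw [sum_const, nsmul_eq_mul, mul_comm]

end Divisors

section Twisted
variable {r : ℕ} [NeZero r] {P : Finset ℕ} {w : ℕ → ℝ}

/-- The component of the twisted mean along the character `χ`. -/
noncomputable def charMean (P : Finset ℕ) (w : ℕ → ℝ) (k : ℕ) (t : ℝ) (χ : DirichletCharacter ℂ r) (x : ZMod r) : ℂ :=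
  kMean P w k fun n => (n : ℂ) ^ ((t : ℂ) * Complex.I) * charCoeff χ (n * x)

theorem charMean_succ (hP : ∀ p ∈ P, p.Prime) (k : ℕ) (t : ℝ) (χ : DirichletCharacter ℂ r) (x : ZMod r) :
    charMean P w (k + 1) t χ x =
      (∑ p ∈ P, w p * (χ p * (p : ℂ) ^ ((t : ℂ) * Complex.I))) * charMean P w k t χ x +
      ∑ p ∈ P with p ∣ r, w p * (p : ℂ) ^ ((t : ℂ) * Complex.I) * charMean P w k t χ (p * x) := by
  have hP' : ∀ p ∈ P, 0 < p := fun p hp => (hP p hp).pos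
  unfold charMean
  conv_lhs => unfold kMean
  rw [sum_mul, sum_filter, ← sum_add_distrib]
  refine sum_congr rfl fun p hp => ?_
  have e1 : ∀ n : ℕ, 0 < n → ((p * n : ℕ) : ℂ) ^ ((t : ℂ) * Complex.I) = (p : ℂ) ^ ((t : ℂ) * Complex.I) * (n : ℂ) ^ ((t : ℂ) * Complex.I) := by
    intro n _
    rw [Nat.cast_mul, Complex.natCast_mul_natCast_cpow]
  have e2 : kMean P w k (fun n => ((p * n : ℕ) : ℂ) ^ ((t : ℂ) * Complex.I) * charCoeff χ ((p * n : ℕ) * x)) =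
      (p : ℂ) ^ ((t : ℂ) * Complex.I) * kMean P w k (fun n => (n : ℂ) ^ ((t : ℂ) * Complex.I) * charCoeff χ (n * (p * x))) := by
    rw [← kMean_mul]
    refine kMean_congr hP' k fun n hn => ?_
    rw [e1 n hn, Nat.cast_mul]
    ring_nf
  rw [e2]
  by_cases hpr : p ∣ r
  · have hnu : ¬ IsUnit (p : ZMod r) := by
      rw [ZMod.isUnit_iff_coprime, (hP p hp).coprime_iff_not_dvd]
      exact fun h => h hpr
    rw [if_pos hpr, MulChar.map_nonunit _ hnu, Complex.real_smul]
    ring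
  · have hu : IsUnit (p : ZMod r) := by
      rw [ZMod.isUnit_iff_coprime, (hP p hp).coprime_iff_not_dvd]
      exact hpr
    rw [if_neg hpr, add_zero]
    have e3 : kMean P w k (fun n => (n : ℂ) ^ ((t : ℂ) * Complex.I) * charCoeff χ (n * (p * x))) =
        χ p * kMean P w k (fun n => (n : ℂ) ^ ((t : ℂ) * Complex.I) * charCoeff χ (n * x)) := by
      rw [← kMean_mul]
      refine kMean_congr hP' k fun n hn => ?_
      obtain ⟨u, hu⟩ := hu
      rw [← hu, mul_left_comm, charCoeff_unit_mul]
      ring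
    rw [e3, Complex.real_smul]
    ring

theorem sum_norm_charMean_le (hP : ∀ p ∈ P, p.Prime) (hw : ∀ p, 0 ≤ w p) (hw1 : ∀ p, w p ≤ Real.log p)
    (t : ℝ) (𝒳 : Finset (DirichletCharacter ℂ r)) {h : ℝ}
    (hh0 : 0 ≤ h) (hh : ∀ χ ∈ 𝒳, ‖∑ p ∈ P, w p * (χ p * (p : ℂ) ^ ((t : ℂ) * Complex.I))‖ + Real.log r ≤ h)
    (k : ℕ) (x : ZMod r) :
    ∑ χ ∈ 𝒳, ‖charMean P w k t χ x‖ ≤ √r * h ^ k := by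
  rcases 𝒳.eq_empty_or_nonempty with rfl | ⟨χ₀, hχ₀⟩
  · rw [sum_empty]; positivity
  have hr0 := NeZero.pos r
  have hlr : 0 ≤ Real.log r := Real.log_natCast_nonneg r
  induction k generalizing x with
  | zero =>
    rw [pow_zero, mul_one]
    refine le_trans ?_ (sum_norm_charCoeff_le x)
    refine (sum_le_sum_of_subset_of_nonneg (subset_univ _) fun _ _ _ => norm_nonneg _).trans_eq ?_
    refine sum_congr rfl fun χ _ => ?_
    simp [charMean, kMean]
  | succ k ih =>
    calc ∑ χ ∈ 𝒳, ‖charMean P w (k + 1) t χ x‖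
        ≤ ∑ χ ∈ 𝒳, ((h - Real.log r) * ‖charMean P w k t χ x‖ +
            ∑ p ∈ P with p ∣ r, w p * ‖charMean P w k t χ (p * x)‖) := by
          refine sum_le_sum fun χ hχ => ?_
          rw [charMean_succ hP]
          refine (norm_add_le _ _).trans (add_le_add ?_ ?_)
          · rw [norm_mul]
            gcongr
            linarith [hh χ hχ]
          · refine norm_sum_le_of_le _ fun p _ => ?_
            rw [norm_mul, norm_mul, Complex.norm_real, Real.norm_of_nonneg (hw p)]
            have := LGrowth.norm_natCast_cpow_I_le t p
            calc _ ≤ w p * 1 * ‖charMean P w k t χ (p * x)‖ := by gcongr; exact hw p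
              _ = _ := by ring
      _ = (h - Real.log r) * ∑ χ ∈ 𝒳, ‖charMean P w k t χ x‖ +
            ∑ p ∈ P with p ∣ r, w p * ∑ χ ∈ 𝒳, ‖charMean P w k t χ (p * x)‖ := by
          rw [sum_add_distrib, ← mul_sum, sum_comm]
          simp_rw [mul_sum]
      _ ≤ (h - Real.log r) * (√r * h ^ k) + ∑ p ∈ P with p ∣ r, w p * (√r * h ^ k) := by
          have : 0 ≤ h - Real.log r := by linarith [hh χ₀ hχ₀, norm_nonneg (∑ p ∈ P, w p * (χ₀ p * (p : ℂ) ^ ((t : ℂ) * Complex.I)))]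
          gcongr with p hp
          · exact ih x
          · exact hw p
          · exact ih _
      _ ≤ (h - Real.log r) * (√r * h ^ k) + Real.log r * (√r * h ^ k) := by
          rw [← sum_mul]
          gcongr
          exact sum_weight_dvd_le_log hP hw1 hr0
      _ = _ := by ring

theorem norm_prime_sum_one_le (hP : ∀ p ∈ P, p.Prime) (hw : ∀ p, 0 ≤ w p) (hw1 : ∀ p, w p ≤ Real.log p) (t : ℝ) :
    ‖∑ p ∈ P, w p * ((1 : DirichletCharacter ℂ r) p * (p : ℂ) ^ ((t : ℂ) * Complex.I))‖ ≤
      ‖∑ p ∈ P, w p * (p : ℂ) ^ ((t : ℂ) * Complex.I)‖ + Real.log r := by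
  have h1 : ∑ p ∈ P, w p * ((1 : DirichletCharacter ℂ r) p * (p : ℂ) ^ ((t : ℂ) * Complex.I)) =
      ∑ p ∈ P, w p * (p : ℂ) ^ ((t : ℂ) * Complex.I) - ∑ p ∈ P with p ∣ r, w p * (p : ℂ) ^ ((t : ℂ) * Complex.I) := by
    rw [sum_filter, ← sum_sub_distrib]
    refine sum_congr rfl fun p hp => ?_
    have hu : IsUnit (p : ZMod r) ↔ ¬ p ∣ r := by
      rw [ZMod.isUnit_iff_coprime, (hP p hp).coprime_iff_not_dvd]
    by_cases hpr : p ∣ r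
    · rw [if_pos hpr, MulChar.map_nonunit _ (by rwa [hu, not_not])]; ring
    · rw [if_neg hpr, MulChar.one_apply (hu.mpr hpr)]; ring
  rw [h1]
  refine (norm_sub_le _ _).trans (add_le_add le_rfl ?_)
  refine le_trans ?_ (sum_weight_dvd_le_log hP hw1 (NeZero.pos r))
  refine norm_sum_le_of_le _ fun p _ => ?_
  rw [norm_mul, Complex.norm_real, Real.norm_of_nonneg (hw p)]
  calc _ ≤ w p * 1 := by gcongr; exacts [hw p, LGrowth.norm_natCast_cpow_I_le t p]
    _ = _ := mul_one _

theorem norm_charMean_one_le {W K : ℝ} (hP : ∀ p ∈ P, p.Prime) (hw : ∀ p, 0 ≤ w p) (hW : ∑ p ∈ P, w p ≤ W)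
    (hK : 0 < K) (h : ∀ p ∈ P, w p * K ≤ W * (p : ℝ) ^ (-(7 / 8) : ℝ)) {k : ℕ} (hkK : k ≤ K)
    (t : ℝ) {m b : ℕ} (hm : 0 < m) (hb : b.Coprime r) :
    ‖charMean P w k t (1 : DirichletCharacter ℂ r) ((m * b : ℕ) : ZMod r)‖ ≤
      W ^ k * (m.gcd r * ((r.divisors.card : ℝ) ^ 3 * (r : ℝ) ^ (-(7 / 8) : ℝ))) := by
  have hr0 := NeZero.pos r
  have hr0' : (0 : ℝ) < r := by exact_mod_cast hr0
  have hP' : ∀ p ∈ P, 0 < p := fun p hp => (hP p hp).pos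
  have hW0 : 0 ≤ W := (sum_nonneg fun p _ => hw p).trans hW
  have hφ : (0 : ℝ) < r.totient := by exact_mod_cast Nat.totient_pos.mpr (NeZero.pos r)
  set c : ℝ := m.gcd r * (r.divisors.card / r.totient) with hc
  have h1 : ‖charMean P w k t (1 : DirichletCharacter ℂ r) ((m * b : ℕ) : ZMod r)‖ ≤
      kMean P w k (fun n => c * (n.gcd r : ℝ)) := by
    refine (norm_kMean_le hw k _).trans (kMean_mono hw hP' k fun n hn => ?_)
    rw [norm_mul]
    have h2 := norm_charCoeff_one_le (r := r) (n * (m * b))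
    have h3 : (n * (m * b)).gcd r ≤ n.gcd r * m.gcd r := by
      rw [← mul_assoc, Nat.Coprime.gcd_mul_right_cancel _ hb]
      exact Nat.le_of_dvd (Nat.mul_pos (Nat.gcd_pos_of_pos_right _ hr0) (Nat.gcd_pos_of_pos_right _ hr0)) (by
        rw [Nat.gcd_comm, Nat.gcd_comm n, Nat.gcd_comm m]; exact Nat.gcd_mul_right_dvd_mul_gcd r n m)
    have h3' : ((n * (m * b)).gcd r : ℝ) ≤ n.gcd r * m.gcd r := by exact_mod_cast h3
    rw [Nat.cast_mul] at h2
    calc _ ≤ 1 * ((n.gcd r * m.gcd r) * (r.divisors.card / r.totient : ℝ)) := by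
          refine mul_le_mul (LGrowth.norm_natCast_cpow_I_le t n) (h2.trans ?_) (norm_nonneg _) zero_le_one
          gcongr
      _ = _ := by rw [hc]; ring
  refine h1.trans ?_
  rw [kMean_real_mul]
  have h4 := kMean_gcd_le hP hw hW hK h hkK hr0
  have h5 : (1 : ℝ) / r.totient ≤ r.divisors.card / r := by
    rw [div_le_div_iff₀ hφ hr0', one_mul, mul_comm]
    exact_mod_cast le_totient_mul_card_divisors hr0
  have h6 : (r : ℝ) ^ (1 / 8 : ℝ) / r = (r : ℝ) ^ (-(7 / 8) : ℝ) := by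
    rw [← Real.rpow_sub_one hr0'.ne']; norm_num
  calc c * kMean P w k (fun n => (n.gcd r : ℝ)) ≤ (m.gcd r * (r.divisors.card * (r.divisors.card / r))) * (W ^ k * (r.divisors.card * (r : ℝ) ^ (1 / 8 : ℝ))) := by
        have h7 : (r.divisors.card / r.totient : ℝ) ≤ r.divisors.card * (r.divisors.card / r) := by
          rw [div_eq_mul_one_div]
          gcongr
        rw [hc]
        exact mul_le_mul (by gcongr) h4 (kMean_nonneg hw hP' k fun n _ => Nat.cast_nonneg _) (by positivity)
    _ = W ^ k * (m.gcd r * ((r.divisors.card : ℝ) ^ 3 * ((r : ℝ) ^ (1 / 8 : ℝ) / r))) := by ring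
    _ = _ := by rw [h6]

end Twisted
end SmoothCircle

namespace SmoothCircle
open MeasureTheory FourierTransform
open scoped ContDiff SchwartzMap

section Oscillatory

/-- The cutoff `q` twisted by `v ↦ e(B exp v)`. -/
noncomputable def osc (q : ℝ → ℝ) (B v : ℝ) : ℂ :=
  q v * Complex.exp (2 * Real.pi * Complex.I * (B * Real.exp v : ℝ))

theorem norm_osc (q : ℝ → ℝ) (B v : ℝ) : ‖osc q B v‖ = |q v| := by
  unfold osc
  rw [norm_mul, Complex.norm_real, Real.norm_eq_abs]
  have : 2 * Real.pi * Complex.I * (B * Real.exp v : ℝ) = ((2 * Real.pi * (B * Real.exp v) : ℝ) : ℂ) * Complex.I := by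
    push_cast; ring
  rw [this, Complex.norm_exp_ofReal_mul_I, mul_one]

variable {q : ℝ → ℝ}

theorem contDiff_osc (hq : ContDiff ℝ ∞ q) (B : ℝ) : ContDiff ℝ ∞ (osc q B) := by
  unfold osc
  have h1 : ContDiff ℝ ∞ fun v => ((q v : ℝ) : ℂ) := Complex.ofRealCLM.contDiff.comp hq
  have h2 : ContDiff ℝ ∞ fun v : ℝ => ((B * Real.exp v : ℝ) : ℂ) :=
    Complex.ofRealCLM.contDiff.comp (contDiff_const.mul Real.contDiff_exp)
  exact h1.mul (contDiff_const.mul h2).cexp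

theorem hasCompactSupport_osc (hs : HasCompactSupport q) (B : ℝ) : HasCompactSupport (osc q B) := by
  refine hs.mono' fun v hv => subset_tsupport _ ?_
  rw [Function.mem_support] at hv ⊢
  intro h
  apply hv
  unfold osc
  rw [h]; simp

theorem hasDerivAt_osc (hq : ContDiff ℝ ∞ q) (B v : ℝ) :
    HasDerivAt (osc q B) (osc (deriv q) B v + 2 * Real.pi * Complex.I * B * osc (fun v => q v * Real.exp v) B v) v := by
  unfold osc
  have h1 : HasDerivAt (fun v => ((q v : ℝ) : ℂ)) ((deriv q v : ℝ) : ℂ) v :=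
    ((hq.differentiable (by simp)).differentiableAt.hasDerivAt).ofReal_comp
  have h2 : HasDerivAt (fun v : ℝ => ((B * Real.exp v : ℝ) : ℂ)) ((B * Real.exp v : ℝ) : ℂ) v :=
    ((Real.hasDerivAt_exp v).const_mul B).ofReal_comp
  refine (h1.mul (h2.const_mul (2 * Real.pi * Complex.I)).cexp).congr_deriv ?_
  push_cast; ring

theorem deriv_osc (hq : ContDiff ℝ ∞ q) (B : ℝ) :
    deriv (osc q B) = fun v => osc (deriv q) B v + 2 * Real.pi * Complex.I * B * osc (fun v => q v * Real.exp v) B v :=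
  funext fun v => (hasDerivAt_osc hq B v).deriv

theorem integrable_osc (hq : ContDiff ℝ ∞ q) (hs : HasCompactSupport q) (B : ℝ) : Integrable (osc q B) :=
  (contDiff_osc hq B).continuous.integrable_of_hasCompactSupport (hasCompactSupport_osc hs B)

theorem norm_fourier_osc_le (q : ℝ → ℝ) (B ξ : ℝ) : ‖𝓕 (osc q B) ξ‖ ≤ ∫ v, |q v| := by
  simp_rw [← norm_osc q B]
  exact VectorFourier.norm_fourierIntegral_le_integral_norm _ _ _ _ _

theorem contDiff_deriv_infty (hq : ContDiff ℝ ∞ q) : ContDiff ℝ ∞ (deriv q) :=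
  (contDiff_infty_iff_deriv.mp hq).2

theorem norm_mul_fourier_osc_le (hq : ContDiff ℝ ∞ q) (hs : HasCompactSupport q) (B ξ : ℝ) :
    |B| * ‖𝓕 (osc q B) ξ‖ ≤
      (∫ v, |deriv (fun v => q v * Real.exp (-v)) v|) + |ξ| * ∫ v, |q v * Real.exp (-v)| := by
  set q₁ : ℝ → ℝ := fun v => q v * Real.exp (-v) with hq₁
  have h1 : ContDiff ℝ ∞ q₁ := hq.mul (Real.contDiff_exp.comp contDiff_neg)
  have h1s : HasCompactSupport q₁ := hs.mul_right
  have e1 : (fun v => q₁ v * Real.exp v) = q := by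
    funext v
    rw [hq₁]
    simp only
    rw [mul_assoc, ← Real.exp_add, neg_add_cancel, Real.exp_zero, mul_one]
  have h2 := contDiff_deriv_infty h1
  have h2s : HasCompactSupport (deriv q₁) := h1s.deriv
  have hd := deriv_osc h1 B
  rw [e1] at hd
  have hdi : Integrable (deriv (osc q₁ B)) := by
    rw [hd]
    exact (integrable_osc h2 h2s B).add ((integrable_osc hq hs B).const_mul _)
  have h3 := congrFun (Real.fourier_deriv (integrable_osc h1 h1s B) ((contDiff_osc h1 B).differentiable (by simp)) hdi) ξ
  have h4 : 𝓕 (deriv (osc q₁ B)) ξ = 𝓕 (osc (deriv q₁) B) ξ + 2 * Real.pi * Complex.I * B * 𝓕 (osc q B) ξ := by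
    rw [hd]
    have hI : ∀ f : ℝ → ℂ, Integrable f → Integrable fun v => 𝐞 (-inner ℝ v ξ) • f v := fun f hf =>
      (Real.fourierIntegral_convergent_iff ξ).2 hf
    simp only [Real.fourier_eq]
    rw [← integral_const_mul, ← integral_add (hI _ (integrable_osc h2 h2s B)) ((hI _ (integrable_osc hq hs B)).const_mul _)]
    refine integral_congr_ae (Filter.Eventually.of_forall fun v => ?_)
    simp only [Circle.smul_def, smul_eq_mul]
    ring
  rw [h4] at h3
  have h5 : 2 * Real.pi * Complex.I * B * 𝓕 (osc q B) ξ =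
      (2 * Real.pi * Complex.I * ξ) * 𝓕 (osc q₁ B) ξ - 𝓕 (osc (deriv q₁) B) ξ := by
    rw [smul_eq_mul] at h3
    rw [← h3]; ring
  have h6 := congrArg norm h5
  have h7 : ‖2 * Real.pi * Complex.I * B * 𝓕 (osc q B) ξ‖ = 2 * Real.pi * (|B| * ‖𝓕 (osc q B) ξ‖) := by
    simp [abs_of_pos Real.pi_pos]; ring
  have h8 : ‖(2 * Real.pi * Complex.I * ξ) * 𝓕 (osc q₁ B) ξ‖ = 2 * Real.pi * (|ξ| * ‖𝓕 (osc q₁ B) ξ‖) := by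
    simp [abs_of_pos Real.pi_pos]; ring
  have h9 := norm_sub_le ((2 * Real.pi * Complex.I * ξ) * 𝓕 (osc q₁ B) ξ) (𝓕 (osc (deriv q₁) B) ξ)
  rw [← h6, h7, h8] at h9
  have h10 := norm_fourier_osc_le q₁ B ξ
  have h11 := norm_fourier_osc_le (deriv q₁) B ξ
  have h12 : |ξ| * ‖𝓕 (osc q₁ B) ξ‖ ≤ |ξ| * ∫ v, |q₁ v| := by gcongr
  have hpi := Real.pi_gt_three
  have h13 := norm_nonneg (𝓕 (osc (deriv q₁) B) ξ)
  have h14 : 2 * Real.pi * (|B| * ‖𝓕 (osc q B) ξ‖) ≤ 2 * Real.pi * (‖𝓕 (osc (deriv q₁) B) ξ‖ + |ξ| * ‖𝓕 (osc q₁ B) ξ‖) := by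
    nlinarith
  have h15 := le_of_mul_le_mul_left h14 (by positivity)
  linarith

theorem integral_one_add_abs_rpow {U : ℝ} (hU : 0 < U) :
    Integrable (fun ξ : ℝ => (1 + 2 * Real.pi * |ξ| / U) ^ (-(3 / 2) : ℝ)) ∧
    ∫ ξ : ℝ, (1 + 2 * Real.pi * |ξ| / U) ^ (-(3 / 2) : ℝ) ≤ U * ∫ x : ℝ, (1 + ‖x‖) ^ (-(3 / 2) : ℝ) := by
  have h0 : Integrable (fun x : ℝ => (1 + ‖x‖) ^ (-(3 / 2) : ℝ)) :=
    integrable_one_add_norm (by rw [Module.finrank_self]; norm_num)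
  have hpi := Real.pi_gt_three
  have hc : 2 * Real.pi / U ≠ 0 := by positivity
  have e : (fun ξ : ℝ => (1 + 2 * Real.pi * |ξ| / U) ^ (-(3 / 2) : ℝ)) =
      fun ξ : ℝ => (fun x : ℝ => (1 + ‖x‖) ^ (-(3 / 2) : ℝ)) ((2 * Real.pi / U) * ξ) := by
    funext ξ
    simp only [Real.norm_eq_abs]
    rw [abs_mul, abs_of_pos (by positivity : 0 < 2 * Real.pi / U)]
    ring_nf
  rw [e]
  refine ⟨h0.comp_mul_left' hc, ?_⟩
  rw [Measure.integral_comp_mul_left (fun x : ℝ => (1 + ‖x‖) ^ (-(3 / 2) : ℝ)), smul_eq_mul]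
  have h1 : 0 ≤ ∫ x : ℝ, (1 + ‖x‖) ^ (-(3 / 2) : ℝ) := integral_nonneg fun x => by positivity
  gcongr
  rw [abs_of_pos (by positivity), inv_div, div_le_iff₀ (by positivity)]
  nlinarith

theorem plancherel_of_contDiff {f : ℝ → ℂ} (hf : ContDiff ℝ ∞ f) (hs : HasCompactSupport f) :
    Continuous (𝓕 f) ∧ Integrable (𝓕 f) ∧ Integrable (fun ξ => ‖𝓕 f ξ‖ ^ 2) ∧
      Integrable (fun v => ‖f v‖ ^ 2) ∧ ∫ ξ, ‖𝓕 f ξ‖ ^ 2 = ∫ v, ‖f v‖ ^ 2 := by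
  set S : 𝓢(ℝ, ℂ) := hs.toSchwartzMap hf with hS
  have hSc : (S : ℝ → ℂ) = f := rfl
  have hF : ((𝓕 S : 𝓢(ℝ, ℂ)) : ℝ → ℂ) = 𝓕 f := by rw [SchwartzMap.fourier_coe, hSc]
  refine ⟨hF ▸ (𝓕 S : 𝓢(ℝ, ℂ)).continuous, hF ▸ (𝓕 S : 𝓢(ℝ, ℂ)).integrable, ?_,
    hSc ▸ (S.memLp 2).integrable_norm_pow (by norm_num), ?_⟩
  · rw [← hF]; exact ((𝓕 S : 𝓢(ℝ, ℂ)).memLp 2).integrable_norm_pow (by norm_num)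
  · have hP := SchwartzMap.integral_norm_sq_fourier S
    rwa [hF, hSc] at hP

theorem exists_osc_fourier_bounds (hq : ContDiff ℝ ∞ q) (hs : HasCompactSupport q) :
    ∃ C : ℝ, 1 ≤ C ∧ ∀ B : ℝ, ∃ F : ℝ → ℂ, Continuous F ∧ Integrable F ∧
      (∀ v, ∫ ξ : ℝ, F ξ * Complex.exp (2 * Real.pi * Complex.I * (ξ * v : ℝ)) = osc q B v) ∧
      Integrable (fun ξ : ℝ => ‖F ξ‖ * (1 + 2 * Real.pi * |ξ| / (1 + |B|)) ^ (1 / 4 : ℝ)) ∧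
      ∫ ξ : ℝ, ‖F ξ‖ * (1 + 2 * Real.pi * |ξ| / (1 + |B|)) ^ (1 / 4 : ℝ) ≤ C * √(1 + |B|) ∧
      ∀ ξ, ‖F ξ‖ ≤ C * (1 + |ξ|) / (1 + |B|) := by
  set A₀ := ∫ v, |q v|
  set A₁ := ∫ v, |deriv (fun v => q v * Real.exp (-v)) v|
  set A₂ := ∫ v, |q v * Real.exp (-v)|
  set I₀ := ∫ v, |q v| ^ 2
  set I₁ := ∫ v, (|deriv q v| + 2 * Real.pi * |q v * Real.exp v|) ^ 2
  set I₂ := ∫ x : ℝ, (1 + ‖x‖) ^ (-(3 / 2) : ℝ)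
  have hA₀ : 0 ≤ A₀ := integral_nonneg fun v => abs_nonneg _
  have hA₁ : 0 ≤ A₁ := integral_nonneg fun v => abs_nonneg _
  have hA₂ : 0 ≤ A₂ := integral_nonneg fun v => abs_nonneg _
  have hI₀ : 0 ≤ I₀ := integral_nonneg fun v => by positivity
  have hI₁ : 0 ≤ I₁ := integral_nonneg fun v => by positivity
  have hI₂ : 0 ≤ I₂ := integral_nonneg fun v => by positivity
  refine ⟨1 + A₀ + A₁ + A₂ + I₀ + I₁ + I₂, by linarith, fun B => ?_⟩
  set U : ℝ := 1 + |B| with hU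
  have hU1 : 1 ≤ U := by rw [hU]; linarith [abs_nonneg B]
  have hU0 : 0 < U := by linarith
  obtain ⟨hFc, hFi, hPi, -, hPe⟩ := plancherel_of_contDiff (contDiff_osc hq B) (hasCompactSupport_osc hs B)
  have hds : HasCompactSupport (deriv (osc q B)) := (hasCompactSupport_osc hs B).deriv
  have hdc : ContDiff ℝ ∞ (deriv (osc q B)) := (contDiff_infty_iff_deriv.mp (contDiff_osc hq B)).2
  obtain ⟨-, -, hPi', hdi2, hPe'⟩ := plancherel_of_contDiff hdc hds
  have hF' := Real.fourier_deriv (integrable_osc hq hs B) ((contDiff_osc hq B).differentiable (by simp))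
      (hdc.continuous.integrable_of_hasCompactSupport hds)
  simp_rw [norm_osc] at hPe
  have hn : ∀ ξ : ℝ, ‖𝓕 (deriv (osc q B)) ξ‖ ^ 2 = (2 * Real.pi * |ξ|) ^ 2 * ‖𝓕 (osc q B) ξ‖ ^ 2 := by
    intro ξ
    rw [hF', norm_smul, mul_pow]
    simp [abs_of_pos Real.pi_pos]
  simp_rw [hn] at hPi' hPe'
  have hPe' : ∫ ξ : ℝ, (2 * Real.pi * |ξ|) ^ 2 * ‖𝓕 (osc q B) ξ‖ ^ 2 ≤ U ^ 2 * I₁ := by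
    have e := hPe'
    rw [e, ← integral_const_mul]
    have hc1 : Continuous fun v => (|deriv q v| + 2 * Real.pi * |q v * Real.exp v|) ^ 2 := by
      have := (contDiff_deriv_infty hq).continuous
      have := hq.continuous
      fun_prop
    have hs1 : HasCompactSupport fun v => (|deriv q v| + 2 * Real.pi * |q v * Real.exp v|) ^ 2 := by
      refine hs.mono' fun v hv => ?_
      by_contra hcon
      apply hv
      have h1 : q v = 0 := image_eq_zero_of_notMem_tsupport hcon
      have h2 : deriv q v = 0 := by
        exact image_eq_zero_of_notMem_tsupport fun h => hcon (tsupport_deriv_subset h)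
      simp [h1, h2]
    refine integral_mono ?_ ?_ fun v => ?_
    · exact hdi2
    · exact (hc1.integrable_of_hasCompactSupport hs1).const_mul _
    · simp only
      rw [← mul_pow]
      gcongr
      rw [deriv_osc hq]
      refine (norm_add_le _ _).trans ?_
      rw [norm_mul, norm_osc, norm_osc]
      have : ‖2 * Real.pi * Complex.I * B‖ = 2 * Real.pi * |B| := by simp [abs_of_pos Real.pi_pos]
      rw [this, hU]
      have := abs_nonneg (deriv q v)
      have := abs_nonneg B
      have h3 : 0 ≤ 2 * Real.pi * |q v * Real.exp v| := by positivity
      nlinarith [mul_nonneg (abs_nonneg B) (abs_nonneg (deriv q v))]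
  obtain ⟨hJi, hJ⟩ := integral_one_add_abs_rpow hU0
  have hsU : 0 < √U := Real.sqrt_pos.mpr hU0
  have hpt : ∀ ξ : ℝ, ‖𝓕 (osc q B) ξ‖ * (1 + 2 * Real.pi * |ξ| / U) ^ (1 / 4 : ℝ) ≤
      √U * ‖𝓕 (osc q B) ξ‖ ^ 2 + √U / U ^ 2 * ((2 * Real.pi * |ξ|) ^ 2 * ‖𝓕 (osc q B) ξ‖ ^ 2) +
        1 / √U * (1 + 2 * Real.pi * |ξ| / U) ^ (-(3 / 2) : ℝ) := by
    intro ξ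
    set y := 2 * Real.pi * |ξ| / U with hy
    have hy0 : 0 ≤ y := by have := Real.pi_pos; positivity
    set a := ‖𝓕 (osc q B) ξ‖
    have ha : 0 ≤ a := norm_nonneg _
    set b := (1 + y) ^ (-(3 / 4) : ℝ) with hb
    have e1 : (1 + y) ^ (1 / 4 : ℝ) = (1 + y) * b := by
      rw [hb, ← Real.rpow_one_add' (by positivity) (by norm_num)]; norm_num
    have e2 : (1 + y) ^ (-(3 / 2) : ℝ) = b ^ 2 := by
      rw [hb, ← Real.rpow_natCast, ← Real.rpow_mul (by positivity)]; norm_num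
    have e3 : √U / U ^ 2 * ((2 * Real.pi * |ξ|) ^ 2 * a ^ 2) = √U * (y * a) ^ 2 := by
      rw [hy]; field_simp
    rw [e1, e2, e3]
    have hs2 : √U * √U = U := Real.mul_self_sqrt hU0.le
    have h1 : a * ((1 + y) * b) ≤ (√U * (a * (1 + y)) ^ 2 + 1 / √U * b ^ 2) / 2 := by
      have h2 : 0 ≤ 1 / √U * (√U * (a * (1 + y)) - b) ^ 2 := by positivity
      have h3 : 1 / √U * (√U * (a * (1 + y)) - b) ^ 2 = √U * (a * (1 + y)) ^ 2 + 1 / √U * b ^ 2 - 2 * (a * ((1 + y) * b)) := by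
        field_simp; ring
      linarith
    have h2 : (a * (1 + y)) ^ 2 ≤ 2 * (a ^ 2 + (y * a) ^ 2) := by nlinarith [sq_nonneg (a - y * a)]
    have h3 : √U * (a * (1 + y)) ^ 2 ≤ √U * (2 * (a ^ 2 + (y * a) ^ 2)) := by gcongr
    have h4 : 0 ≤ 1 / √U * b ^ 2 := by positivity
    linarith
  have hdom : Integrable fun ξ : ℝ => √U * ‖𝓕 (osc q B) ξ‖ ^ 2 + √U / U ^ 2 * ((2 * Real.pi * |ξ|) ^ 2 * ‖𝓕 (osc q B) ξ‖ ^ 2) +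
        1 / √U * (1 + 2 * Real.pi * |ξ| / U) ^ (-(3 / 2) : ℝ) :=
    ((hPi.const_mul _).add (hPi'.const_mul _)).add (hJi.const_mul _)
  have hInt : Integrable (fun ξ : ℝ => ‖𝓕 (osc q B) ξ‖ * (1 + 2 * Real.pi * |ξ| / U) ^ (1 / 4 : ℝ)) := by
    refine hdom.mono' ?_ (Filter.Eventually.of_forall fun ξ => ?_)
    · refine (hFc.norm.mul ?_).aestronglyMeasurable
      refine Continuous.rpow_const (by fun_prop) fun x => Or.inr (by norm_num)
    · rw [Real.norm_of_nonneg (by have := Real.pi_pos; positivity)]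
      exact hpt ξ
  refine ⟨𝓕 (osc q B), hFc, hFi, fun v => ?_, hInt, ?_, fun ξ => ?_⟩
  · have := congrFun ((contDiff_osc hq B).continuous.fourierInv_fourier_eq (integrable_osc hq hs B) hFi) v
    rw [← this, Real.fourierInv_eq']
    refine integral_congr_ae (Filter.Eventually.of_forall fun ξ => ?_)
    simp only [smul_eq_mul]
    rw [mul_comm]
    congr 2
    simp
    ring
  · refine (integral_mono hInt hdom hpt).trans ?_
    rw [integral_add (by exact (hPi.const_mul _).add (hPi'.const_mul _)) (hJi.const_mul _),
      integral_add (hPi.const_mul _) (hPi'.const_mul _),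
      integral_const_mul, integral_const_mul, integral_const_mul, hPe]
    have h1 : √U / U ^ 2 * ∫ ξ : ℝ, (2 * Real.pi * |ξ|) ^ 2 * ‖𝓕 (osc q B) ξ‖ ^ 2 ≤ √U * I₁ := by
      calc _ ≤ √U / U ^ 2 * (U ^ 2 * I₁) := by gcongr
        _ = _ := by field_simp
    have h2 : 1 / √U * ∫ ξ : ℝ, (1 + 2 * Real.pi * |ξ| / U) ^ (-(3 / 2) : ℝ) ≤ √U * I₂ := by
      calc _ ≤ 1 / √U * (U * I₂) := by gcongr
        _ = U / √U * I₂ := by ring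
        _ = _ := by rw [Real.div_sqrt]
    have h3 : 0 ≤ √U * (1 + A₀ + A₁ + A₂) := by positivity
    linarith
  · rw [le_div_iff₀ hU0]
    have h1 := norm_fourier_osc_le q B ξ
    have h2 := norm_mul_fourier_osc_le hq hs B ξ
    have h3 := abs_nonneg ξ
    rw [hU]
    have : 0 ≤ |ξ| * (1 + A₀ + A₁ + I₀ + I₁ + I₂) := by positivity
    nlinarith

end Oscillatory
end SmoothCircle

namespace SmoothCircle
open MeasureTheory Finset LGrowth
open scoped ContDiff

section Pointwise

theorem exp_log_div_eq {n : ℕ} (hn : 0 < n) {X : ℝ} (hX : 0 < X) (ξ : ℝ) :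
    Complex.exp (2 * Real.pi * Complex.I * (ξ * Real.log (n / X) : ℝ)) =
      Complex.exp (-((2 * Real.pi * (ξ * Real.log X) : ℝ) : ℂ) * Complex.I) *
        (n : ℂ) ^ (((2 * Real.pi * ξ : ℝ) : ℂ) * Complex.I) := by
  have hn0 : (n : ℂ) ≠ 0 := by exact_mod_cast hn.ne'
  have hn1 : (n : ℝ) ≠ 0 := by exact_mod_cast hn.ne'
  rw [Complex.cpow_def_of_ne_zero hn0, ← Complex.exp_add, Real.log_div hn1 hX.ne',
    show Complex.log (n : ℂ) = ((Real.log n : ℝ) : ℂ) by rw [Complex.natCast_log]]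
  congr 1
  push_cast
  ring

variable {q : ℝ → ℝ}

theorem exists_norm_kMean_osc_le (hq : ContDiff ℝ ∞ q) (hs : HasCompactSupport q) :
    ∃ C : ℝ, 1 ≤ C ∧ ∀ (Y : ℕ) (P : Finset ℕ) (w : ℕ → ℝ), (∀ p ∈ P, p.Prime ∧ p < Y) →
      ∀ (k r : ℕ) [NeZero r] (x : ZMod r) (X B T V₁ V₂ : ℝ), 0 < X → 1 ≤ T → 0 ≤ V₁ → 0 ≤ V₂ →
      (∀ t : ℝ, ∑ χ : DirichletCharacter ℂ r, ‖charMean P w k t χ x‖ ≤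
        (if |t| < T then V₁ else 0) + V₂ * (1 + |t| / (1 + |B|)) ^ (1 / 4 : ℝ)) →
      ‖kMean P w k fun n => osc q B (Real.log (n / X)) * ZMod.stdAddChar ((n : ZMod r) * x)‖ ≤
        C * (T ^ 2 / (1 + |B|)) * V₁ + C * √(1 + |B|) * V₂ := by
  obtain ⟨C, hC1, hC⟩ := exists_osc_fourier_bounds hq hs
  refine ⟨C, hC1, fun Y P w hP k r _ x X B T V₁ V₂ hX hT hV₁ hV₂ hchar => ?_⟩
  obtain ⟨F, hFc, hFi, hF1, hF2, hF3, hF4⟩ := hC B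
  have hC0 : 0 < C := by linarith
  have hU : 0 < 1 + |B| := by positivity
  set E : ℕ → ℝ → ℂ := fun n ξ =>
    F ξ * Complex.exp (2 * Real.pi * Complex.I * (ξ * Real.log (n / X) : ℝ)) * ZMod.stdAddChar ((n : ZMod r) * x) with hE
  have hEi : ∀ n, Integrable (E n) := by
    intro n
    refine hFi.norm.mono' ?_ (Filter.Eventually.of_forall fun ξ => ?_)
    · refine Continuous.aestronglyMeasurable ?_
      simp only [hE]
      fun_prop
    · simp only [hE]
      rw [norm_mul, norm_mul, AddChar.norm_apply,
        show (2 * Real.pi * Complex.I * (ξ * Real.log (n / X) : ℝ) : ℂ) =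
          ((2 * Real.pi * (ξ * Real.log (n / X)) : ℝ) : ℂ) * Complex.I by push_cast; ring,
        Complex.norm_exp_ofReal_mul_I, mul_one, mul_one]
  have hInt : (kMean P w k fun n => osc q B (Real.log (n / X)) * ZMod.stdAddChar ((n : ZMod r) * x)) =
      ∫ ξ, kMean P w k fun n => E n ξ := by
    simp only [kMean_eq_sum hP]
    rw [integral_finsetSum _ fun n _ => (show Integrable fun ξ => kWeight P w k n • E n ξ from (hEi n).smul (kWeight P w k n))]
    refine sum_congr rfl fun n _ => ?_
    rw [integral_smul]
    congr 1
    simp only [hE]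
    rw [integral_mul_const, hF1]
  have hpt : ∀ ξ, ‖kMean P w k fun n => E n ξ‖ ≤
      ‖F ξ‖ * ∑ χ : DirichletCharacter ℂ r, ‖charMean P w k (2 * Real.pi * ξ) χ x‖ := by
    intro ξ
    have e1 : (kMean P w k fun n => E n ξ) =
        (F ξ * Complex.exp (-((2 * Real.pi * (ξ * Real.log X) : ℝ) : ℂ) * Complex.I)) *
          ∑ χ : DirichletCharacter ℂ r, charMean P w k (2 * Real.pi * ξ) χ x := by
      unfold charMean
      rw [← kMean_sum, ← kMean_mul]
      refine kMean_congr (fun p hp => (hP p hp).1.pos) k fun n hn => ?_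
      simp only [hE]
      rw [exp_log_div_eq hn hX, ← mul_sum, sum_charCoeff]
      ring
    rw [e1, norm_mul, norm_mul, show (-((2 * Real.pi * (ξ * Real.log X) : ℝ) : ℂ) * Complex.I) =
      ((-(2 * Real.pi * (ξ * Real.log X)) : ℝ) : ℂ) * Complex.I by push_cast; ring,
      Complex.norm_exp_ofReal_mul_I, mul_one]
    gcongr
    exact norm_sum_le _ _
  set I : Set ℝ := Set.Icc (-(T / (2 * Real.pi))) (T / (2 * Real.pi)) with hI
  have hpi := Real.pi_gt_three
  set c : ℝ := C * (1 + T) / (1 + |B|) * V₁ with hc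
  have hc0 : 0 ≤ c := by positivity
  have hpt2 : ∀ ξ, ‖kMean P w k fun n => E n ξ‖ ≤
      I.indicator (fun _ => c) ξ + V₂ * (‖F ξ‖ * (1 + 2 * Real.pi * |ξ| / (1 + |B|)) ^ (1 / 4 : ℝ)) := by
    intro ξ
    refine (hpt ξ).trans ((mul_le_mul_of_nonneg_left (hchar _) (norm_nonneg _)).trans ?_)
    rw [mul_add]
    have habs : |2 * Real.pi * ξ| = 2 * Real.pi * |ξ| := by
      rw [abs_mul, abs_of_pos (by positivity)]
    rw [habs]
    refine add_le_add ?_ (le_of_eq (by ring))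
    split_ifs with hlt
    · have hξ : |ξ| ≤ T / (2 * Real.pi) := by
        rw [le_div_iff₀ (by positivity)]; linarith
      have hmem : ξ ∈ I := abs_le.mp hξ
      rw [Set.indicator_of_mem hmem, hc]
      refine mul_le_mul_of_nonneg_right ((hF4 ξ).trans ?_) hV₁
      have : |ξ| ≤ T := hξ.trans (div_le_self (by linarith) (by linarith))
      gcongr
    · rw [mul_zero]
      exact Set.indicator_nonneg (fun _ _ => hc0) _
  have hIi : Integrable (I.indicator fun _ => c) :=
    (integrable_indicator_iff measurableSet_Icc).mpr (integrableOn_const (by rw [Real.volume_Icc]; exact ENNReal.ofReal_ne_top))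
  rw [hInt]
  refine (norm_integral_le_of_norm_le (hIi.add (hF2.const_mul V₂)) (Filter.Eventually.of_forall hpt2)).trans ?_
  have : ∫ ξ, (I.indicator (fun _ => c) ξ + V₂ * (‖F ξ‖ * (1 + 2 * Real.pi * |ξ| / (1 + |B|)) ^ (1 / 4 : ℝ))) =
      T / Real.pi * c + V₂ * ∫ ξ, ‖F ξ‖ * (1 + 2 * Real.pi * |ξ| / (1 + |B|)) ^ (1 / 4 : ℝ) := by
    rw [integral_add hIi (hF2.const_mul V₂), integral_const_mul, integral_indicator measurableSet_Icc,
      setIntegral_const, Measure.real, Real.volume_Icc, ENNReal.toReal_ofReal (by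
        have : 0 ≤ T / (2 * Real.pi) := by positivity
        linarith), smul_eq_mul]
    congr 2
    field_simp
    ring
  change ∫ ξ, (I.indicator (fun _ => c) ξ + V₂ * (‖F ξ‖ * (1 + 2 * Real.pi * |ξ| / (1 + |B|)) ^ (1 / 4 : ℝ))) ≤ _
  rw [this]
  refine add_le_add ?_ ?_
  · have h1 : T / Real.pi * c = C * (T * (1 + T) / Real.pi / (1 + |B|)) * V₁ := by rw [hc]; ring
    rw [h1]
    have : T * (1 + T) / Real.pi ≤ T ^ 2 := by
      rw [div_le_iff₀ (by linarith)]
      nlinarith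
    gcongr
  · calc V₂ * _ ≤ V₂ * (C * √(1 + |B|)) := mul_le_mul_of_nonneg_left hF3 hV₂
      _ = _ := by ring

theorem log_mul_add_four_pow_le {r : ℕ} (hr : 0 < r) {k : ℕ} {U L : ℝ} (hU : 1 ≤ U) (hL : 0 < L)
    (hL1 : Real.log (4 * r * U) ≤ L) (hL2 : 4 * k ≤ L) (t : ℝ) :
    Real.log (r * (|t| + 4)) ^ k ≤ L ^ k * (1 + |t| / U) ^ (1 / 4 : ℝ) := by
  have hr' : (1 : ℝ) ≤ r := by exact_mod_cast hr
  have ht := abs_nonneg t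
  have hz : 0 < 1 + |t| / U := by positivity
  have h0 : 0 ≤ Real.log (r * (|t| + 4)) := Real.log_nonneg (by nlinarith)
  set x := Real.log (1 + |t| / U) with hx
  have hx0 : 0 ≤ x := Real.log_nonneg (by rw [le_add_iff_nonneg_right]; positivity)
  have h1 : Real.log (r * (|t| + 4)) ≤ L * (1 + x / L) := by
    have : Real.log (r * (|t| + 4)) ≤ Real.log (4 * r * U * (1 + |t| / U)) := by
      refine Real.log_le_log (by positivity) ?_
      have : 4 * (r : ℝ) * U * (1 + |t| / U) = r * (4 * U + 4 * |t|) := by field_simp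
      rw [this]
      exact mul_le_mul_of_nonneg_left (by linarith) (by linarith)
    rw [Real.log_mul (by positivity) hz.ne', ← hx] at this
    have e : L * (1 + x / L) = L + x := by field_simp
    rw [e]; linarith
  calc Real.log (r * (|t| + 4)) ^ k ≤ (L * (1 + x / L)) ^ k := pow_le_pow_left₀ h0 h1 k
    _ = L ^ k * (x / L + 1) ^ k := by rw [mul_pow, add_comm]
    _ ≤ L ^ k * Real.exp (x / L) ^ k := by gcongr; exact Real.add_one_le_exp _
    _ = L ^ k * Real.exp (k * x / L) := by rw [← Real.exp_nat_mul, mul_div_assoc]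
    _ ≤ L ^ k * Real.exp (x / 4) := by
        gcongr ?_ * Real.exp ?_
        rw [div_le_div_iff₀ hL (by norm_num)]
        nlinarith
    _ = _ := by rw [Real.rpow_def_of_pos hz, ← hx]; congr 2; ring

theorem exists_sum_charMean_le (hG : GRH) {δ : ℝ} (hδ : 0 < δ) (hδ1 : δ ≤ 1) {J : ℕ} (hJ : 3 ≤ J) :
    ∃ C : ℝ, 1 ≤ C ∧ ∀ (Y k r m b : ℕ) [NeZero r] (T U L K : ℝ), 0 < Y → 0 < m → b.Coprime r →
      0 ≤ T → (Y : ℝ) / (1 + T) ^ (J + 1) ≤ (Y : ℝ) ^ (1 / 2 : ℝ) → 1 ≤ U → 0 < L → Real.log (4 * r * U) ≤ L →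
      4 * (k : ℝ) ≤ L → 0 < K → (k : ℝ) ≤ K →
      (∀ p ∈ primeSet Y, primeWeight J Y p * K ≤ (∑ p ∈ primeSet Y, primeWeight J Y p) * (p : ℝ) ^ (-(7 / 8) : ℝ)) →
      ∀ t : ℝ, ∑ χ : DirichletCharacter ℂ r, ‖charMean (primeSet Y) (primeWeight J Y) k t χ ((m * b : ℕ) : ZMod r)‖ ≤
        (if |t| < T then (∑ p ∈ primeSet Y, primeWeight J Y p) ^ k *
            (m.gcd r * ((r.divisors.card : ℝ) ^ 3 * (r : ℝ) ^ (-(7 / 8) : ℝ))) else 0) +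
          √r * (C * L * (Y : ℝ) ^ (1 / 2 + δ)) ^ k * (1 + |t| / U) ^ (1 / 4 : ℝ) := by
  obtain ⟨C₁, hC₁, h₁⟩ := exists_norm_char_sum_le hG hδ hδ1 hJ
  obtain ⟨C₂, hC₂, h₂⟩ := exists_norm_prime_cpow_sum_le hG hδ hδ1 hJ
  refine ⟨C₁ + 2 * C₂ + 2, by linarith, fun Y k r m b _ T U L K hY hm hb hT hTY hU hL hL1 hL2 hK hkK hwK t => ?_⟩
  have hP : ∀ p ∈ primeSet Y, p.Prime := fun p hp => (mem_primeSet.mp hp).2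
  have hw := primeWeight_nonneg J Y
  have hw1 := primeWeight_le_log J Y
  have hr := NeZero.pos r
  have hr' : (1 : ℝ) ≤ r := by exact_mod_cast hr
  have hY' : (1 : ℝ) ≤ Y := by exact_mod_cast hY
  set Q : ℝ := (Y : ℝ) ^ (1 / 2 + δ) with hQ
  have hQ1 : 1 ≤ Q := Real.one_le_rpow hY' (by linarith)
  have hYQ : (Y : ℝ) ^ (1 / 2 : ℝ) ≤ Q := Real.rpow_le_rpow_of_exponent_le hY' (by linarith)
  set ℓ := Real.log (r * (|t| + 4)) with hℓ
  have hℓ1 : 1 ≤ ℓ := one_le_log_mul_add_four hr'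
  have ht := abs_nonneg t
  have hlr : Real.log r ≤ ℓ * Q := by
    have : Real.log r ≤ ℓ := Real.log_le_log (by linarith) (by nlinarith)
    nlinarith
  have hl4 : Real.log (|t| + 4) ≤ ℓ := Real.log_le_log (by linarith) (by nlinarith)
  set h : ℝ := (C₁ + 2 * C₂ + 2) * ℓ * Q with hh
  have hh0 : 0 ≤ h := by positivity
  have hℓQ : 0 ≤ ℓ * Q := by positivity
  have hpow : √r * h ^ k ≤ √r * ((C₁ + 2 * C₂ + 2) * L * Q) ^ k * (1 + |t| / U) ^ (1 / 4 : ℝ) := by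
    have e1 : h ^ k = ((C₁ + 2 * C₂ + 2) * Q) ^ k * ℓ ^ k := by rw [hh, ← mul_pow]; ring
    have e2 : √r * ((C₁ + 2 * C₂ + 2) * L * Q) ^ k * (1 + |t| / U) ^ (1 / 4 : ℝ) =
        √r * (((C₁ + 2 * C₂ + 2) * Q) ^ k * (L ^ k * (1 + |t| / U) ^ (1 / 4 : ℝ))) := by
      rw [show (C₁ + 2 * C₂ + 2) * L * Q = ((C₁ + 2 * C₂ + 2) * Q) * L by ring, mul_pow]; ring
    rw [e1, e2]
    gcongr
    exact log_mul_add_four_pow_le hr hU hL hL1 hL2 t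
  have hne : ∀ χ : DirichletCharacter ℂ r, χ ≠ 1 →
      ‖∑ p ∈ primeSet Y, primeWeight J Y p * (χ p * (p : ℂ) ^ ((t : ℂ) * Complex.I))‖ + Real.log r ≤ h := by
    intro χ hχ
    have := h₁ r χ hχ t Y hY
    rw [← hℓ, ← hQ] at this
    rw [hh]
    nlinarith
  split_ifs with hlt
  · classical
    rw [← add_sum_erase univ _ (mem_univ (1 : DirichletCharacter ℂ r))]
    refine add_le_add (norm_charMean_one_le hP hw le_rfl hK hwK hkK t hm hb) (le_trans ?_ hpow)
    exact sum_norm_charMean_le hP hw hw1 t _ hh0 (fun χ hχ => hne χ (ne_of_mem_erase hχ)) k _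
  · rw [zero_add]
    refine le_trans ?_ hpow
    refine sum_norm_charMean_le hP hw hw1 t _ hh0 (fun χ _ => ?_) k _
    by_cases hχ : χ = 1
    · subst hχ
      have a1 := norm_prime_sum_one_le (r := r) hP hw hw1 t
      have a2 := h₂ t Y hY
      have a3 : (Y : ℝ) / (1 + |t|) ^ (J + 1) ≤ Q := by
        refine le_trans ?_ (hTY.trans hYQ)
        gcongr
        exact not_lt.mp hlt
      have a4 : Real.log (|t| + 4) * Q + Y / (1 + |t|) ^ (J + 1) ≤ 2 * (ℓ * Q) := by nlinarith
      have a5 : C₂ * (Real.log (|t| + 4) * Q + Y / (1 + |t|) ^ (J + 1)) ≤ C₂ * (2 * (ℓ * Q)) := by gcongr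
      rw [hh]
      nlinarith
    · exact hne χ hχ

/-- The smoothed exponential sum over ordered products of `k` elements of `P`. -/
noncomputable def smoothSum (q : ℝ → ℝ) (P : Finset ℕ) (w : ℕ → ℝ) (k : ℕ) (X α : ℝ) : ℂ :=
  kMean P w k fun n => (q (Real.log (n / X)) : ℂ) * Complex.exp (2 * Real.pi * Complex.I * (n * α : ℝ))

theorem smoothSum_eq_kMean_osc {P : Finset ℕ} {w : ℕ → ℝ} (hP : ∀ p ∈ P, 0 < p) (k m b r : ℕ) [NeZero r] {X : ℝ}
    (hX : 0 < X) (β : ℝ) :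
    smoothSum q P w k X (m * (b / r + β)) =
      kMean P w k fun n => osc q (m * β * X) (Real.log (n / X)) *
        ZMod.stdAddChar ((n : ZMod r) * ((m * b : ℕ) : ZMod r)) := by
  refine kMean_congr hP k fun n hn => ?_
  have hn' : (0 : ℝ) < n := by exact_mod_cast hn
  have hr : (r : ℂ) ≠ 0 := by exact_mod_cast NeZero.ne r
  unfold osc
  rw [Real.exp_log (by positivity), mul_assoc (q (Real.log (n / X)) : ℂ)]
  congr 1
  rw [show ((n : ZMod r) * ((m * b : ℕ) : ZMod r)) = (((n * (m * b) : ℕ) : ℤ) : ZMod r) by push_cast; rfl,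
    ZMod.stdAddChar_coe, ← Complex.exp_add]
  congr 1
  have hX' : (X : ℂ) ≠ 0 := by exact_mod_cast hX.ne'
  push_cast
  field_simp
  ring

theorem exists_norm_smoothSum_le (hG : GRH) (hq : ContDiff ℝ ∞ q) (hs : HasCompactSupport q)
    {δ : ℝ} (hδ : 0 < δ) (hδ1 : δ ≤ 1) {J : ℕ} (hJ : 3 ≤ J) :
    ∃ C : ℝ, 1 ≤ C ∧ ∀ (Y k r m b : ℕ) [NeZero r] (X β T L K : ℝ), 0 < Y → 0 < m → b.Coprime r → 0 < X →
      1 ≤ T → (Y : ℝ) / (1 + T) ^ (J + 1) ≤ (Y : ℝ) ^ (1 / 2 : ℝ) → 0 < L →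
      Real.log (4 * r * (1 + m * |β| * X)) ≤ L → 4 * (k : ℝ) ≤ L → 0 < K → (k : ℝ) ≤ K →
      (∀ p ∈ primeSet Y, primeWeight J Y p * K ≤ (∑ p ∈ primeSet Y, primeWeight J Y p) * (p : ℝ) ^ (-(7 / 8) : ℝ)) →
      ‖smoothSum q (primeSet Y) (primeWeight J Y) k X (m * (b / r + β))‖ ≤
        C * (T ^ 2 / (1 + m * |β| * X)) * ((∑ p ∈ primeSet Y, primeWeight J Y p) ^ k *
            (m.gcd r * ((r.divisors.card : ℝ) ^ 3 * (r : ℝ) ^ (-(7 / 8) : ℝ)))) +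
          C * √(r * (1 + m * |β| * X)) * (C * L * (Y : ℝ) ^ (1 / 2 + δ)) ^ k := by
  obtain ⟨C₁, hC₁, h₁⟩ := exists_norm_kMean_osc_le hq hs
  obtain ⟨C₂, hC₂, h₂⟩ := exists_sum_charMean_le hG hδ hδ1 hJ
  refine ⟨C₁ * C₂, by nlinarith, fun Y k r m b _ X β T L K hY hm hb hX hT hTY hL hL1 hL2 hK hkK hwK => ?_⟩
  have hB : |m * β * X| = m * |β| * X := by
    rw [abs_mul, abs_mul, Nat.abs_cast, abs_of_pos hX]
  have hU1 : 1 ≤ 1 + m * |β| * X := by rw [le_add_iff_nonneg_right]; positivity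
  have hV : 0 ≤ ∑ p ∈ primeSet Y, primeWeight J Y p := sum_nonneg fun p _ => primeWeight_nonneg J Y p
  have key := h₁ Y (primeSet Y) (primeWeight J Y) (fun p hp => (mem_primeSet.mp hp).symm) k r ((m * b : ℕ) : ZMod r)
    X (m * β * X) T
    (V₂ := √r * (C₂ * L * (Y : ℝ) ^ (1 / 2 + δ)) ^ k)
    (V₁ := (∑ p ∈ primeSet Y, primeWeight J Y p) ^ k *
            (m.gcd r * ((r.divisors.card : ℝ) ^ 3 * (r : ℝ) ^ (-(7 / 8) : ℝ)))) hX hT (by positivity) (by positivity)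
    (by
      rw [hB]
      exact h₂ Y k r m b T _ L K hY hm hb (by linarith) hTY hU1 hL hL1 hL2 hK hkK hwK)
  rw [hB] at key
  rw [smoothSum_eq_kMean_osc (fun p hp => (mem_primeSet.mp hp).2.pos) k m b r hX β]
  refine key.trans (add_le_add ?_ ?_)
  · gcongr
    exact le_mul_of_one_le_right (by linarith) hC₂
  · rw [show C₁ * √(1 + m * |β| * X) * (√r * (C₂ * L * (Y : ℝ) ^ (1 / 2 + δ)) ^ k) =
      C₁ * √(r * (1 + m * |β| * X)) * (C₂ * L * (Y : ℝ) ^ (1 / 2 + δ)) ^ k by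
        rw [Real.sqrt_mul (Nat.cast_nonneg r)]; ring]
    have : C₁ ≤ C₁ * C₂ := le_mul_of_one_le_right (by linarith) hC₂
    have : C₂ ≤ C₁ * C₂ := le_mul_of_one_le_left (by linarith) hC₁
    gcongr

end Pointwise

end SmoothCircle

namespace SmoothCircle
open MeasureTheory Finset LGrowth

section Circle

/-- The exponential sum with coefficients `a` over `A`. -/
noncomputable def expSum (A : Finset ℕ) (a : ℕ → ℝ) (α : ℝ) : ℂ :=
  ∑ n ∈ A, (a n : ℂ) * Complex.exp (2 * Real.pi * Complex.I * (n * α : ℝ))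

/-- The Fejér-averaged sum of dilates of `expSum A a`. -/
noncomputable def fejerSum (A : Finset ℕ) (a : ℕ → ℝ) (M : ℕ) (α : ℝ) : ℝ :=
  ∑ m ∈ Ico 1 M, 2 * ((M : ℝ) - m) * (expSum A a (m * α)).re

theorem continuous_expSum (A : Finset ℕ) (a : ℕ → ℝ) : Continuous (expSum A a) := by
  unfold expSum; fun_prop

theorem continuous_fejerSum (A : Finset ℕ) (a : ℕ → ℝ) (M : ℕ) : Continuous (fejerSum A a M) := by
  unfold fejerSum
  have := continuous_expSum A a
  fun_prop

theorem expSum_term (x θ : ℝ) : (x : ℂ) * Complex.exp (2 * Real.pi * Complex.I * (θ : ℝ)) =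
    ⟨x * Real.cos (2 * Real.pi * θ), x * Real.sin (2 * Real.pi * θ)⟩ := by
  rw [show 2 * Real.pi * Complex.I * (θ : ℝ) = ((2 * Real.pi * θ : ℝ) : ℂ) * Complex.I by push_cast; ring]
  apply Complex.ext
  · rw [Complex.re_ofReal_mul, Complex.exp_ofReal_mul_I_re]
  · rw [Complex.im_ofReal_mul, Complex.exp_ofReal_mul_I_im]

theorem expSum_re (A : Finset ℕ) (a : ℕ → ℝ) (α : ℝ) :
    (expSum A a α).re = ∑ n ∈ A, a n * Real.cos (2 * Real.pi * (n * α)) := by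
  unfold expSum
  rw [Complex.re_sum]
  exact sum_congr rfl fun n _ => by rw [expSum_term]

theorem expSum_im (A : Finset ℕ) (a : ℕ → ℝ) (α : ℝ) :
    (expSum A a α).im = ∑ n ∈ A, a n * Real.sin (2 * Real.pi * (n * α)) := by
  unfold expSum
  rw [Complex.im_sum]
  exact sum_congr rfl fun n _ => by rw [expSum_term]

theorem norm_expSum_sq (A : Finset ℕ) (a : ℕ → ℝ) (α : ℝ) :
    ‖expSum A a α‖ ^ 2 = ∑ u ∈ A, ∑ v ∈ A, a u * a v * Real.cos (2 * Real.pi * (((u : ℤ) - v : ℤ) * α)) := by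
  rw [Complex.sq_norm, Complex.normSq_apply, expSum_re, expSum_im, sum_mul_sum, sum_mul_sum, ← sum_add_distrib]
  refine sum_congr rfl fun u _ => ?_
  rw [← sum_add_distrib]
  refine sum_congr rfl fun v _ => ?_
  rw [show 2 * Real.pi * ((((u : ℤ) - v : ℤ) : ℝ) * α) = 2 * Real.pi * (u * α) - 2 * Real.pi * (v * α) by push_cast; ring,
    Real.cos_sub]
  ring

theorem fejer_identity (M : ℕ) (θ : ℝ) :
    ‖expSum (range M) (fun _ => 1) θ‖ ^ 2 =
      M + ∑ m ∈ Ico 1 M, 2 * ((M : ℝ) - m) * Real.cos (2 * Real.pi * (m * θ)) := by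
  rw [Complex.sq_norm, Complex.normSq_apply, expSum_re, expSum_im]
  induction M with
  | zero => simp
  | succ M ih =>
    have key : ∑ m ∈ Ico 1 (M + 1), 2 * (((M + 1 : ℕ) : ℝ) - m) * Real.cos (2 * Real.pi * (m * θ)) =
        ∑ m ∈ Ico 1 M, 2 * ((M : ℝ) - m) * Real.cos (2 * Real.pi * (m * θ)) +
          2 * ∑ m ∈ Ico 1 (M + 1), Real.cos (2 * Real.pi * (m * θ)) := by
      have : ∑ m ∈ Ico 1 M, 2 * ((M : ℝ) - m) * Real.cos (2 * Real.pi * (m * θ)) =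
          ∑ m ∈ Ico 1 (M + 1), 2 * ((M : ℝ) - m) * Real.cos (2 * Real.pi * (m * θ)) := by
        rcases Nat.eq_zero_or_pos M with rfl | hM
        · simp
        · rw [sum_Ico_succ_top hM]; simp
      rw [this, mul_sum, ← sum_add_distrib]
      refine sum_congr rfl fun m _ => ?_
      push_cast; ring
    have hrefl : ∑ m ∈ Ico 1 (M + 1), Real.cos (2 * Real.pi * (m * θ)) =
        ∑ i ∈ range M, Real.cos (2 * Real.pi * (M * θ) - 2 * Real.pi * (i * θ)) := by
      rw [← sum_range_reflect, sum_Ico_eq_sum_range, Nat.add_sub_cancel]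
      refine sum_congr rfl fun i hi => ?_
      have hi := mem_range.mp hi
      congr 1
      have : ((M - 1 - i : ℕ) : ℝ) = M - 1 - i := by
        rw [Nat.cast_sub (by omega), Nat.cast_sub (by omega)]; norm_num
      rw [this]; push_cast; ring
    rw [key, hrefl, sum_range_succ, sum_range_succ]
    simp only [one_mul] at ih ⊢
    simp_rw [Real.cos_sub, sum_add_distrib, ← mul_sum]
    have := Real.sin_sq_add_cos_sq (2 * Real.pi * (M * θ))
    push_cast
    linear_combination ih + this

theorem fejerSum_eq (A : Finset ℕ) (a : ℕ → ℝ) (M : ℕ) (α : ℝ) :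
    fejerSum A a M α = ∑ n ∈ A, a n * (∑ m ∈ Ico 1 M, 2 * ((M : ℝ) - m) * Real.cos (2 * Real.pi * (m * (n * α)))) := by
  unfold fejerSum
  simp_rw [expSum_re, mul_sum]
  rw [sum_comm]
  refine sum_congr rfl fun n _ => sum_congr rfl fun m _ => ?_
  rw [show (n : ℝ) * (m * α) = m * (n * α) by ring]
  ring

theorem neg_le_fejerSum {A : Finset ℕ} {a : ℕ → ℝ} (ha : ∀ n ∈ A, 0 ≤ a n) (M : ℕ) (α : ℝ) :
    -(M * ∑ n ∈ A, a n) ≤ fejerSum A a M α := by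
  rw [fejerSum_eq, mul_sum, ← sum_neg_distrib]
  refine sum_le_sum fun n hn => ?_
  have h := fejer_identity M (n * α)
  have h1 : 0 ≤ ‖expSum (range M) (fun _ => 1) (n * α)‖ ^ 2 := by positivity
  nlinarith [ha n hn]

theorem sum_Ico_two_mul_sub (M : ℕ) :
    ∑ m ∈ Ico 1 M, 2 * ((M : ℝ) - m) = M * (M - 1) := by
  have h := fejer_identity M 0
  simp only [mul_zero, Real.cos_zero, mul_one] at h
  have h2 : expSum (range M) (fun _ => 1) 0 = M := by simp [expSum]
  rw [h2, Complex.norm_natCast] at h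
  linarith

theorem abs_fejerSum_le (A : Finset ℕ) (a : ℕ → ℝ) (M : ℕ) (α : ℝ) :
    |fejerSum A a M α| ≤ 2 * M * ∑ m ∈ Ico 1 M, ‖expSum A a (m * α)‖ := by
  unfold fejerSum
  rw [mul_sum]
  refine (abs_sum_le_sum_abs _ _).trans (sum_le_sum fun m hm => ?_)
  have hm := mem_Ico.mp hm
  have h1 : (m : ℝ) ≤ M := by exact_mod_cast hm.2.le
  rw [abs_mul, abs_of_nonneg (by linarith : (0 : ℝ) ≤ 2 * ((M : ℝ) - m))]
  have : (0 : ℝ) ≤ m := Nat.cast_nonneg m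
  gcongr
  · linarith
  · exact Complex.abs_re_le_norm _

theorem le_fejerSum_of_small {A : Finset ℕ} {a : ℕ → ℝ} (ha : ∀ n ∈ A, 0 ≤ a n) {M : ℕ} (hM : 2 ≤ M) {α : ℝ}
    (hα : 0 ≤ α) (h : ∀ n ∈ A, a n ≠ 0 → M * n * α ≤ 1 / 6) :
    M ^ 2 / 4 * ∑ n ∈ A, a n ≤ fejerSum A a M α := by
  rw [fejerSum_eq, mul_sum]
  have hM' : (2 : ℝ) ≤ M := by exact_mod_cast hM
  refine sum_le_sum fun n hn => ?_
  by_cases h0 : a n = 0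
  · rw [h0]; simp
  have hn0 := h n hn h0
  have hmain : M ^ 2 / 4 ≤ ∑ m ∈ Ico 1 M, 2 * ((M : ℝ) - m) * Real.cos (2 * Real.pi * (m * (n * α))) := by
    calc (M : ℝ) ^ 2 / 4 ≤ (M * (M - 1)) * (1 / 2) := by nlinarith
      _ = ∑ m ∈ Ico 1 M, 2 * ((M : ℝ) - m) * (1 / 2) := by rw [← sum_Ico_two_mul_sub, sum_mul]
      _ ≤ _ := by
        refine sum_le_sum fun m hm => ?_
        have hm := mem_Ico.mp hm
        have h1 : (m : ℝ) ≤ M := by exact_mod_cast hm.2.le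
        refine mul_le_mul_of_nonneg_left ?_ (by linarith)
        rw [← Real.cos_pi_div_three]
        have hpi := Real.pi_pos
        have hnα : 0 ≤ n * α := by positivity
        have h2 : m * (n * α) ≤ 1 / 6 := le_trans (by nlinarith) hn0
        have h3 : 0 ≤ m * (n * α) := by positivity
        refine Real.cos_le_cos_of_nonneg_of_le_pi (by positivity) (by linarith) (by nlinarith)
  rw [mul_comm]
  exact mul_le_mul_of_nonneg_left hmain (ha n hn)

theorem le_norm_expSum_sq_of_small {A : Finset ℕ} {a : ℕ → ℝ} (ha : ∀ n ∈ A, 0 ≤ a n) {α : ℝ}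
    (hα : 0 ≤ α) (h : ∀ n ∈ A, a n ≠ 0 → n * α ≤ 1 / 8) :
    (∑ n ∈ A, a n) ^ 2 / 2 ≤ ‖expSum A a α‖ ^ 2 := by
  have h1 : (∑ n ∈ A, a n) * (√2 / 2) ≤ (expSum A a α).re := by
    rw [expSum_re, sum_mul]
    refine sum_le_sum fun n hn => ?_
    by_cases h0 : a n = 0
    · rw [h0]; simp
    refine mul_le_mul_of_nonneg_left ?_ (ha n hn)
    have hpi := Real.pi_pos
    have h3 : 0 ≤ n * α := by positivity
    have := h n hn h0
    rw [← Real.cos_pi_div_four]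
    exact Real.cos_le_cos_of_nonneg_of_le_pi (by positivity) (by linarith) (by nlinarith)
  have h0 : 0 ≤ ∑ n ∈ A, a n := sum_nonneg ha
  have h2 := h1.trans (Complex.re_le_norm _)
  calc (∑ n ∈ A, a n) ^ 2 / 2 = ((∑ n ∈ A, a n) * (√2 / 2)) ^ 2 := by
        rw [mul_pow, div_pow, Real.sq_sqrt (by norm_num)]; ring
    _ ≤ _ := by gcongr

theorem integral_cos_int (j : ℤ) : ∫ α in (0 : ℝ)..1, Real.cos (2 * Real.pi * (j * α)) = if j = 0 then 1 else 0 := by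
  split_ifs with h
  · subst h; simp
  · have hj : (2 * Real.pi * j : ℝ) ≠ 0 := by
      have := Real.pi_pos
      have : (j : ℝ) ≠ 0 := by exact_mod_cast h
      positivity
    have : ∀ α : ℝ, 2 * Real.pi * (j * α) = (2 * Real.pi * j) * α := fun α => by ring
    simp_rw [this]
    rw [intervalIntegral.integral_comp_mul_left (fun x => Real.cos x) hj, integral_cos]
    have h2 : Real.sin (2 * Real.pi * j * 1) = 0 := by
      rw [show 2 * Real.pi * j * 1 = (2 * j : ℤ) * Real.pi by push_cast; ring]
      exact Real.sin_int_mul_pi _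
    rw [h2]; simp

theorem integral_norm_expSum_sq (A : Finset ℕ) (a : ℕ → ℝ) :
    ∫ α in (0 : ℝ)..1, ‖expSum A a α‖ ^ 2 = ∑ n ∈ A, a n ^ 2 := by
  simp_rw [norm_expSum_sq]
  rw [intervalIntegral.integral_finsetSum fun u _ => Continuous.intervalIntegrable (by fun_prop) _ _]
  refine sum_congr rfl fun u hu => ?_
  rw [intervalIntegral.integral_finsetSum fun u _ => Continuous.intervalIntegrable (by fun_prop) _ _]
  simp_rw [intervalIntegral.integral_const_mul, integral_cos_int, sub_eq_zero, Nat.cast_inj]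
  rw [sum_eq_single u (fun v _ hv => by rw [if_neg (Ne.symm hv), mul_zero]) (fun h => absurd hu h), if_pos rfl]
  ring

theorem integral_norm_expSum_sq_mul_fejerSum (A D : Finset ℕ) (a b : ℕ → ℝ) (M : ℕ) :
    ∫ α in (0 : ℝ)..1, ‖expSum D b α‖ ^ 2 * fejerSum A a M α =
      ∑ m ∈ Ico 1 M, ∑ n ∈ A, ∑ u ∈ D, ∑ v ∈ D,
        2 * ((M : ℝ) - m) * (a n * (b u * b v)) * if u + m * n = v then 1 else 0 := by
  have h1 : ∀ α, ‖expSum D b α‖ ^ 2 * fejerSum A a M α =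
      ∑ m ∈ Ico 1 M, ∑ n ∈ A, ∑ u ∈ D, ∑ v ∈ D, ((M : ℝ) - m) * (a n * (b u * b v)) *
        (Real.cos (2 * Real.pi * ((((u : ℤ) + m * n - v : ℤ) : ℝ) * α)) +
          Real.cos (2 * Real.pi * ((((v : ℤ) + m * n - u : ℤ) : ℝ) * α))) := by
    intro α
    rw [norm_expSum_sq]
    unfold fejerSum
    simp_rw [expSum_re]
    rw [mul_sum]
    refine sum_congr rfl fun m _ => ?_
    rw [mul_sum, mul_sum]
    refine sum_congr rfl fun n _ => ?_
    rw [sum_mul]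
    refine sum_congr rfl fun u _ => ?_
    rw [sum_mul]
    refine sum_congr rfl fun v _ => ?_
    have e1 : 2 * Real.pi * ((((u : ℤ) + m * n - v : ℤ) : ℝ) * α) =
      2 * Real.pi * (n * (m * α)) + 2 * Real.pi * ((((u : ℤ) - v : ℤ) : ℝ) * α) := by push_cast; ring
    have e2 : 2 * Real.pi * ((((v : ℤ) + m * n - u : ℤ) : ℝ) * α) =
      2 * Real.pi * (n * (m * α)) - 2 * Real.pi * ((((u : ℤ) - v : ℤ) : ℝ) * α) := by push_cast; ring
    rw [e1, e2, Real.cos_add, Real.cos_sub]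
    ring
  simp_rw [h1]
  rw [intervalIntegral.integral_finsetSum fun u _ => Continuous.intervalIntegrable (by fun_prop) _ _]
  refine sum_congr rfl fun m hm => ?_
  rw [intervalIntegral.integral_finsetSum fun u _ => Continuous.intervalIntegrable (by fun_prop) _ _]
  refine sum_congr rfl fun n hn => ?_
  rw [intervalIntegral.integral_finsetSum fun u _ => Continuous.intervalIntegrable (by fun_prop) _ _]
  have h2 : ∀ u ∈ D, ∫ α in (0 : ℝ)..1, ∑ v ∈ D, ((M : ℝ) - m) * (a n * (b u * b v)) *
        (Real.cos (2 * Real.pi * ((((u : ℤ) + m * n - v : ℤ) : ℝ) * α)) +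
          Real.cos (2 * Real.pi * ((((v : ℤ) + m * n - u : ℤ) : ℝ) * α))) =
      ∑ v ∈ D, ((M : ℝ) - m) * (a n * (b u * b v)) * (if u + m * n = v then 1 else 0) +
        ∑ v ∈ D, ((M : ℝ) - m) * (a n * (b u * b v)) * (if v + m * n = u then 1 else 0) := by
    intro u _
    rw [intervalIntegral.integral_finsetSum fun u _ => Continuous.intervalIntegrable (by fun_prop) _ _,
      ← sum_add_distrib]
    refine sum_congr rfl fun v _ => ?_
    rw [intervalIntegral.integral_const_mul,
      intervalIntegral.integral_add (Continuous.intervalIntegrable (by fun_prop) _ _)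
        (Continuous.intervalIntegrable (by fun_prop) _ _), integral_cos_int, integral_cos_int, mul_add]
    congr 3 <;> (rw [sub_eq_zero]; norm_cast)
  rw [sum_congr rfl h2, sum_add_distrib, sum_comm (f := fun u v => _ * (if v + m * n = u then (1 : ℝ) else 0)),
    ← sum_add_distrib]
  refine sum_congr rfl fun u _ => ?_
  rw [← sum_add_distrib]
  refine sum_congr rfl fun v _ => ?_
  ring

end Circle

end SmoothCircle

namespace SmoothCircle
open MeasureTheory Finset LGrowth

section CircleBound

theorem integral_inv_one_add_sq_le {c : ℝ} (hc : 0 < c) (x₀ : ℝ) :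
    ∫ α in (0 : ℝ)..1, 1 / (1 + (c * (α - x₀)) ^ 2) ≤ Real.pi / c := by
  simp_rw [mul_sub]
  rw [intervalIntegral.integral_comp_mul_sub (fun x : ℝ => 1 / (1 + x ^ 2)) hc.ne', integral_one_div_one_add_sq, smul_eq_mul, inv_mul_eq_div]
  gcongr
  linarith [Real.arctan_lt_pi_div_two (c * 1 - c * x₀), Real.neg_pi_div_two_lt_arctan (c * 0 - c * x₀)]

theorem exists_sum_gcd_rpow_le : ∃ C : ℝ, 1 ≤ C ∧ ∀ r M : ℕ, 0 < r →
    ∑ m ∈ Ico 1 M, ((m.gcd r : ℕ) : ℝ) * (r : ℝ) ^ (-(17 / 20) : ℝ) ≤ C * M * (r : ℝ) ^ (-(21 / 25) : ℝ) := by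
  obtain ⟨C, hC1, hC⟩ := exists_card_divisors_le (show (0 : ℝ) < 1 / 100 by norm_num)
  refine ⟨C, hC1, fun r M hr => ?_⟩
  have hr' : (0 : ℝ) < r := by exact_mod_cast hr
  rw [← sum_mul]
  have h1 : ∑ m ∈ Ico 1 M, ((m.gcd r : ℕ) : ℝ) ≤ M * r.divisors.card := by
    refine le_trans ?_ (sum_gcd_le hr M)
    rw [sum_Ico_eq_sum_range]
    simp_rw [add_comm 1]
    exact sum_le_sum_of_subset_of_nonneg (range_mono (Nat.sub_le _ _)) fun _ _ _ => Nat.cast_nonneg _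
  calc _ ≤ (M * r.divisors.card : ℝ) * (r : ℝ) ^ (-(17 / 20) : ℝ) := by gcongr
    _ ≤ (M * (C * (r : ℝ) ^ (1 / 100 : ℝ))) * (r : ℝ) ^ (-(17 / 20) : ℝ) := by gcongr; exact hC r hr
    _ = C * M * ((r : ℝ) ^ (1 / 100 : ℝ) * (r : ℝ) ^ (-(17 / 20) : ℝ)) := by ring
    _ = _ := by rw [← Real.rpow_add hr']; norm_num

theorem exists_rat_approx {N : ℕ} (hN : 0 < N) {α : ℝ} (h0 : 0 ≤ α) (h1 : α ≤ 1) :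
    ∃ r b : ℕ, 0 < r ∧ r ≤ N ∧ b ≤ r ∧ b.Coprime r ∧ r * |α - b / r| ≤ 1 / N := by
  obtain ⟨x, hx, hxN⟩ := Real.exists_rat_abs_sub_le_and_den_le α hN
  have hd : (0 : ℝ) < x.den := by exact_mod_cast x.pos
  have hN' : (0 : ℝ) < N := by exact_mod_cast hN
  have hx' : x.den * |α - x| ≤ 1 / (N + 1) := by
    calc (x.den : ℝ) * |α - x| ≤ x.den * (1 / ((N + 1) * x.den)) := by gcongr
      _ = 1 / (N + 1) := by field_simp
  have hlt : x.den * |α - x| < 1 := hx'.trans_lt (by rw [div_lt_one (by positivity)]; linarith)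
  have hxr : (x : ℝ) = x.num / x.den := by exact_mod_cast (Rat.num_div_den x).symm
  have e : (x.den : ℝ) * |α - x| = |x.den * α - x.num| := by
    rw [hxr, ← abs_of_pos hd, ← abs_mul, abs_of_pos hd]; congr 1; field_simp
  rw [e, abs_lt] at hlt
  have hn0 : 0 ≤ x.num := by
    have : (-1 : ℝ) < x.num := by nlinarith
    have : (-1 : ℤ) < x.num := by exact_mod_cast this
    omega
  have hn1 : x.num ≤ x.den := by
    have : (x.num : ℝ) < x.den + 1 := by nlinarith
    have : x.num < x.den + 1 := by exact_mod_cast this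
    omega
  have hnat : ((x.num.natAbs : ℕ) : ℝ) = x.num := by
    rw [← Int.cast_natCast, Int.natAbs_of_nonneg hn0]
  refine ⟨x.den, x.num.natAbs, x.pos, hxN, by omega, x.reduced, ?_⟩
  rw [hnat, ← hxr]
  exact hx'.trans (by gcongr; linarith)

/-- The majorant of the negative part on the major arcs. -/
noncomputable def arcMajorant (D₀ : ℕ) (ζ κ X : ℝ) (α : ℝ) : ℝ :=
  ∑ r ∈ Icc 1 D₀, ∑ b ∈ range (r + 1),
    (ζ * (1 / (1 + (X / D₀ * (α - b / r)) ^ 2)) +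
      κ * (r : ℝ) ^ (-(53 / 25) : ℝ) * (1 / (1 + (X * (α - b / r)) ^ 2)))

theorem continuous_arcMajorant (D₀ : ℕ) (ζ κ X : ℝ) : Continuous (arcMajorant D₀ ζ κ X) := by
  unfold arcMajorant
  have h : ∀ c x₀ : ℝ, Continuous fun α : ℝ => 1 / (1 + (c * (α - x₀)) ^ 2) := fun c x₀ =>
    continuous_const.div (by fun_prop) fun α => by positivity
  exact continuous_finsetSum _ fun r _ => continuous_finsetSum _ fun b _ =>
    (continuous_const.mul (h _ _)).add (continuous_const.mul (h _ _))

theorem arcMajorant_nonneg (D₀ : ℕ) {ζ κ : ℝ} (hζ : 0 ≤ ζ) (hκ : 0 ≤ κ) (X α : ℝ) : 0 ≤ arcMajorant D₀ ζ κ X α :=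
  sum_nonneg fun r _ => sum_nonneg fun b _ => by positivity

theorem le_arcMajorant {D₀ : ℕ} {ζ κ : ℝ} (hζ : 0 ≤ ζ) (hκ : 0 ≤ κ) (X α : ℝ) {r b : ℕ} (hr : 0 < r) (hrD : r ≤ D₀)
    (hb : b ≤ r) :
    ζ * (1 / (1 + (X / D₀ * (α - b / r)) ^ 2)) +
      κ * (r : ℝ) ^ (-(53 / 25) : ℝ) * (1 / (1 + (X * (α - b / r)) ^ 2)) ≤ arcMajorant D₀ ζ κ X α := by
  unfold arcMajorant
  refine le_trans ?_ (single_le_sum (f := fun r : ℕ => ∑ b ∈ range (r + 1),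
    (ζ * (1 / (1 + (X / D₀ * (α - b / r)) ^ 2)) +
      κ * (r : ℝ) ^ (-(53 / 25) : ℝ) * (1 / (1 + (X * (α - b / r)) ^ 2))))
    (fun r _ => sum_nonneg fun b _ => by positivity) (mem_Icc.mpr ⟨hr, hrD⟩))
  exact single_le_sum (f := fun b : ℕ =>
    (ζ * (1 / (1 + (X / D₀ * (α - b / r)) ^ 2)) +
      κ * (r : ℝ) ^ (-(53 / 25) : ℝ) * (1 / (1 + (X * (α - b / r)) ^ 2))))
    (fun b _ => by positivity) (mem_range.mpr (by omega))

theorem exists_integral_arcMajorant_le : ∃ C : ℝ, 1 ≤ C ∧ ∀ (D₀ : ℕ) (ζ κ X : ℝ), 0 < D₀ → 0 ≤ ζ → 0 ≤ κ → 0 < X →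
    ∫ α in (0 : ℝ)..1, arcMajorant D₀ ζ κ X α ≤ C * ζ * D₀ ^ 3 / X + C * κ / X := by
  have hsum : Summable fun r : ℕ => (r : ℝ) ^ (-(28 / 25) : ℝ) := Real.summable_nat_rpow.mpr (by norm_num)
  set Z := ∑' r : ℕ, (r : ℝ) ^ (-(28 / 25) : ℝ) with hZ
  have hZ0 : 0 ≤ Z := tsum_nonneg fun r => by positivity
  have hpi := Real.pi_gt_three
  refine ⟨2 * Real.pi * (1 + Z), by nlinarith, fun D₀ ζ κ X hD hζ hκ hX => ?_⟩
  have hD' : (1 : ℝ) ≤ D₀ := by exact_mod_cast hD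
  have h : ∀ c x₀ : ℝ, Continuous fun α : ℝ => 1 / (1 + (c * (α - x₀)) ^ 2) := fun c x₀ =>
    continuous_const.div (by fun_prop) fun α => by positivity
  have hcont : ∀ r b : ℕ, Continuous fun α : ℝ => (ζ * (1 / (1 + (X / D₀ * (α - b / r)) ^ 2)) +
      κ * (r : ℝ) ^ (-(53 / 25) : ℝ) * (1 / (1 + (X * (α - b / r)) ^ 2))) := fun r b =>
    (continuous_const.mul (h _ _)).add (continuous_const.mul (h _ _))
  unfold arcMajorant
  rw [intervalIntegral.integral_finsetSum fun r _ => Continuous.intervalIntegrable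
    (continuous_finsetSum _ fun b _ => hcont r b) _ _]
  have hr : ∀ r ∈ Icc 1 D₀, ∫ α in (0 : ℝ)..1, ∑ b ∈ range (r + 1),
      (ζ * (1 / (1 + (X / D₀ * (α - b / r)) ^ 2)) +
        κ * (r : ℝ) ^ (-(53 / 25) : ℝ) * (1 / (1 + (X * (α - b / r)) ^ 2))) ≤
      2 * Real.pi * ζ * D₀ ^ 2 / X + 2 * Real.pi * κ / X * (r : ℝ) ^ (-(28 / 25) : ℝ) := by
    intro r hr
    have hr1 := mem_Icc.mp hr
    have hrp : (0 : ℝ) < r := by exact_mod_cast hr1.1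
    have hr1' : (1 : ℝ) ≤ r := by exact_mod_cast hr1.1
    have hrD : (r : ℝ) ≤ D₀ := by exact_mod_cast hr1.2
    rw [intervalIntegral.integral_finsetSum fun b _ => Continuous.intervalIntegrable (hcont r b) _ _]
    have hb : ∀ b ∈ range (r + 1), ∫ α in (0 : ℝ)..1, (ζ * (1 / (1 + (X / D₀ * (α - b / r)) ^ 2)) +
        κ * (r : ℝ) ^ (-(53 / 25) : ℝ) * (1 / (1 + (X * (α - b / r)) ^ 2))) ≤
        ζ * (Real.pi / (X / D₀)) + κ * (r : ℝ) ^ (-(53 / 25) : ℝ) * (Real.pi / X) := by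
      intro b _
      have h' : ∀ c d x₀ : ℝ, IntervalIntegrable (fun α : ℝ => d * (1 / (1 + (c * (α - x₀)) ^ 2))) volume 0 1 :=
        fun c d x₀ => Continuous.intervalIntegrable (continuous_const.mul (h c x₀)) _ _
      rw [intervalIntegral.integral_add (h' _ _ _) (h' _ _ _),
        intervalIntegral.integral_const_mul, intervalIntegral.integral_const_mul]
      refine add_le_add (mul_le_mul_of_nonneg_left (integral_inv_one_add_sq_le (by positivity) _) hζ)
        (mul_le_mul_of_nonneg_left (integral_inv_one_add_sq_le (by positivity) _) (by positivity))
    refine (sum_le_sum hb).trans ?_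
    rw [sum_const, card_range, nsmul_eq_mul]
    push_cast
    have hsplit : (r : ℝ) * (r : ℝ) ^ (-(53 / 25) : ℝ) = (r : ℝ) ^ (-(28 / 25) : ℝ) := by
      rw [← Real.rpow_one_add' hrp.le (by norm_num)]; norm_num
    rw [mul_add]
    refine add_le_add ?_ ?_
    · calc ((r : ℝ) + 1) * (ζ * (Real.pi / (X / D₀))) ≤ (2 * D₀) * (ζ * (Real.pi / (X / D₀))) := by
            gcongr; linarith
        _ = _ := by field_simp
    · calc ((r : ℝ) + 1) * (κ * (r : ℝ) ^ (-(53 / 25) : ℝ) * (Real.pi / X)) ≤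
            (2 * r) * (κ * (r : ℝ) ^ (-(53 / 25) : ℝ) * (Real.pi / X)) := by gcongr; linarith
        _ = 2 * Real.pi * κ / X * (r * (r : ℝ) ^ (-(53 / 25) : ℝ)) := by ring
        _ = _ := by rw [hsplit]
  refine (sum_le_sum hr).trans ?_
  rw [sum_add_distrib, sum_const, Nat.card_Icc, nsmul_eq_mul, ← mul_sum, Nat.add_sub_cancel]
  have hs : ∑ r ∈ Icc 1 D₀, (r : ℝ) ^ (-(28 / 25) : ℝ) ≤ Z := hsum.sum_le_tsum _ fun r _ => by positivity
  refine add_le_add ?_ ?_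
  · calc (D₀ : ℝ) * (2 * Real.pi * ζ * D₀ ^ 2 / X) = (2 * Real.pi * 1) * ζ * D₀ ^ 3 / X := by ring
      _ ≤ _ := by gcongr; linarith
  · calc 2 * Real.pi * κ / X * ∑ r ∈ Icc 1 D₀, (r : ℝ) ^ (-(28 / 25) : ℝ) ≤ 2 * Real.pi * κ / X * (1 + Z) := by
          gcongr; linarith
      _ = _ := by ring

theorem abs_fejerSum_le_of_bounds {A : Finset ℕ} {a : ℕ → ℝ} {Cg : ℝ}
    (hCg : ∀ r M : ℕ, 0 < r →
      ∑ m ∈ Ico 1 M, ((m.gcd r : ℕ) : ℝ) * (r : ℝ) ^ (-(17 / 20) : ℝ) ≤ Cg * M * (r : ℝ) ^ (-(21 / 25) : ℝ))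
    {M r : ℕ} (hr : 0 < r) {V R α : ℝ} (hV : 0 ≤ V) (hR : 0 ≤ R)
    (h : ∀ m ∈ Ico 1 M, ‖expSum A a (m * α)‖ ≤ V * (m.gcd r * (r : ℝ) ^ (-(17 / 20) : ℝ)) + R) :
    |fejerSum A a M α| ≤ 2 * Cg * M ^ 2 * V * (r : ℝ) ^ (-(21 / 25) : ℝ) + 2 * M ^ 2 * R := by
  refine (abs_fejerSum_le A a M α).trans ?_
  have h1 : ∑ m ∈ Ico 1 M, ‖expSum A a (m * α)‖ ≤ V * (Cg * M * (r : ℝ) ^ (-(21 / 25) : ℝ)) + M * R := by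
    refine (sum_le_sum h).trans ?_
    rw [sum_add_distrib, ← mul_sum, sum_const, Nat.card_Ico, nsmul_eq_mul]
    have : ((M - 1 : ℕ) : ℝ) ≤ M := by exact_mod_cast Nat.sub_le _ _
    gcongr
    exact hCg r M hr
  calc 2 * (M : ℝ) * ∑ m ∈ Ico 1 M, ‖expSum A a (m * α)‖ ≤ 2 * M * (V * (Cg * M * (r : ℝ) ^ (-(21 / 25) : ℝ)) + M * R) := by
        gcongr
    _ = _ := by ring

set_option maxHeartbeats 1000000 in
theorem pointwise_major_minor {A D : Finset ℕ} {a b : ℕ → ℝ} (ha : ∀ n ∈ A, 0 ≤ a n) {Cg : ℝ} (hCg1 : 1 ≤ Cg)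
    (hCg : ∀ r M : ℕ, 0 < r →
      ∑ m ∈ Ico 1 M, ((m.gcd r : ℕ) : ℝ) * (r : ℝ) ^ (-(17 / 20) : ℝ) ≤ Cg * M * (r : ℝ) ^ (-(21 / 25) : ℝ))
    {M N D₀ : ℕ} (hN : 0 < N) (hD₀ : 0 < D₀) {Y X VA VB E α : ℝ} (hY : 1 ≤ Y) (hX : 0 < X)
    (hVA : 0 ≤ VA) (hE : 0 ≤ E) {r c : ℕ} (hr : 0 < r) (hrN : r ≤ N) (hc : c ≤ r)
    (hβ : r * |α - c / r| ≤ 1 / N)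
    (hB : ‖expSum D b α‖ ≤ VB * (r : ℝ) ^ (-(17 / 20) : ℝ) / (1 + X * |α - c / r|) +
      E * √(r * (1 + X * |α - c / r|)))
    (hA : ∀ m ∈ Ico 1 M, ‖expSum A a (m * α)‖ ≤
      VA / (1 + X * |α - c / r| / Y) * (m.gcd r * (r : ℝ) ^ (-(17 / 20) : ℝ)) + E * √(r * (1 + X * |α - c / r|))) :
    0 ≤ ‖expSum D b α‖ ^ 2 * fejerSum A a M α +
      (2 * M ^ 2 * E * √(N + X / N) + 2 * Cg * M ^ 2 * VA * Y * (D₀ : ℝ) ^ (-(21 / 25) : ℝ)) * ‖expSum D b α‖ ^ 2 +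
      arcMajorant D₀ (4 * E ^ 2 * D₀ * (M * ∑ n ∈ A, a n)) (2 * VB ^ 2 * √(2 * Cg * M ^ 3 * (∑ n ∈ A, a n) * VA)) X α := by
  set x := X * |α - c / r| with hx
  have hx0 : 0 ≤ x := by positivity
  have hr1 : (1 : ℝ) ≤ r := by exact_mod_cast hr
  have hr0 : (0 : ℝ) < r := by linarith
  have hN' : (0 : ℝ) < N := by exact_mod_cast hN
  have hD0' : (0 : ℝ) < D₀ := by exact_mod_cast hD₀
  have hS : 0 ≤ ∑ n ∈ A, a n := sum_nonneg ha
  set S := ∑ n ∈ A, a n with hSdef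
  set Bq := ‖expSum D b α‖ ^ 2 with hBq
  have hBq0 : 0 ≤ Bq := by positivity
  set F := fejerSum A a M α with hF
  have hDle : r * (1 + x) ≤ N + X / N := by
    have h1 : (r : ℝ) ≤ N := by exact_mod_cast hrN
    have h2 : r * x ≤ X / N := by
      calc r * x = X * (r * |α - c / r|) := by rw [hx]; ring
        _ ≤ X * (1 / N) := by gcongr
        _ = _ := by ring
    linarith
  have hER : E * √(r * (1 + x)) ≤ E * √(N + X / N) := by gcongr
  have hF1 : -(M * S) ≤ F := neg_le_fejerSum ha M α
  have hF2 := abs_fejerSum_le_of_bounds hCg hr (by positivity) (by positivity) hA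
  rw [← hF] at hF2
  have hF3 : -(2 * Cg * M ^ 2 * (VA / (1 + x / Y)) * (r : ℝ) ^ (-(21 / 25) : ℝ)) - 2 * M ^ 2 * E * √(N + X / N) ≤ F := by
    have := (abs_le.mp hF2).1
    have h3 : 2 * (M : ℝ) ^ 2 * (E * √(r * (1 + x))) ≤ 2 * M ^ 2 * (E * √(N + X / N)) := by gcongr
    linarith
  have harc := arcMajorant_nonneg D₀ (show 0 ≤ 4 * E ^ 2 * D₀ * (M * S) by positivity)
    (show 0 ≤ 2 * VB ^ 2 * √(2 * Cg * M ^ 3 * S * VA) by positivity) X α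
  have hCg0 : 0 < Cg := by linarith
  rcases le_or_gt (D₀ : ℝ) (r * (1 + x)) with hbig | hsmall
  · have h1 : (r : ℝ) ^ (-(21 / 25) : ℝ) / (1 + x / Y) ≤ Y * (D₀ : ℝ) ^ (-(21 / 25) : ℝ) := by
      have e1 : (1 + x) ^ (21 / 25 : ℝ) ≤ 1 + x := by
        calc (1 + x) ^ (21 / 25 : ℝ) ≤ (1 + x) ^ (1 : ℝ) :=
              Real.rpow_le_rpow_of_exponent_le (by linarith) (by norm_num)
          _ = _ := Real.rpow_one _
      have e2 : (1 + x) / Y ≤ 1 + x / Y := by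
        rw [add_div]; gcongr; exact div_le_one_of_le₀ hY (by linarith)
      have e3 : (D₀ : ℝ) ^ (21 / 25 : ℝ) ≤ (r : ℝ) ^ (21 / 25 : ℝ) * (1 + x) ^ (21 / 25 : ℝ) := by
        rw [← Real.mul_rpow hr0.le (by linarith)]; gcongr
      have hp1 : 0 < (r : ℝ) ^ (21 / 25 : ℝ) := by positivity
      have hp2 : 0 < (D₀ : ℝ) ^ (21 / 25 : ℝ) := by positivity
      rw [Real.rpow_neg hr0.le, Real.rpow_neg hD0'.le, ← div_eq_mul_inv, inv_eq_one_div, div_div,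
        div_le_div_iff₀ (by positivity) hp2, one_mul]
      calc (D₀ : ℝ) ^ (21 / 25 : ℝ) ≤ (r : ℝ) ^ (21 / 25 : ℝ) * (1 + x) := e3.trans (by gcongr)
        _ = Y * ((r : ℝ) ^ (21 / 25 : ℝ) * ((1 + x) / Y)) := by field_simp
        _ ≤ _ := by gcongr
    have h2 : 2 * Cg * M ^ 2 * (VA / (1 + x / Y)) * (r : ℝ) ^ (-(21 / 25) : ℝ) ≤
        2 * Cg * M ^ 2 * VA * Y * (D₀ : ℝ) ^ (-(21 / 25) : ℝ) := by
      calc 2 * Cg * M ^ 2 * (VA / (1 + x / Y)) * (r : ℝ) ^ (-(21 / 25) : ℝ) =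
          2 * Cg * M ^ 2 * VA * ((r : ℝ) ^ (-(21 / 25) : ℝ) / (1 + x / Y)) := by ring
        _ ≤ 2 * Cg * M ^ 2 * VA * (Y * (D₀ : ℝ) ^ (-(21 / 25) : ℝ)) := by gcongr
        _ = _ := by ring
    have h3 : 0 ≤ F + (2 * M ^ 2 * E * √(N + X / N) + 2 * Cg * M ^ 2 * VA * Y * (D₀ : ℝ) ^ (-(21 / 25) : ℝ)) := by
      linarith
    have h4 := mul_nonneg hBq0 h3
    rw [mul_add, mul_comm Bq (_ + _)] at h4
    linarith
  · have hrD : r ≤ D₀ := by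
      have : (r : ℝ) ≤ D₀ := by nlinarith
      exact_mod_cast this
    have hxD : x ≤ D₀ := by nlinarith
    set PrF := 2 * Cg * M ^ 2 * VA * (r : ℝ) ^ (-(21 / 25) : ℝ) with hPrF
    have hPrF0 : 0 ≤ PrF := by positivity
    have hPr : 2 * Cg * M ^ 2 * (VA / (1 + x / Y)) * (r : ℝ) ^ (-(21 / 25) : ℝ) ≤ PrF := by
      rw [hPrF]
      gcongr
      refine div_le_self hVA ?_
      rw [le_add_iff_nonneg_right]; positivity
    set mn := min (M * S) PrF with hmn
    have hmn0 : 0 ≤ mn := le_min (by positivity) hPrF0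
    have hFm : -mn - 2 * M ^ 2 * E * √(N + X / N) ≤ F := by
      have hp : 0 ≤ 2 * M ^ 2 * E * √(N + X / N) := by positivity
      rcases min_choice (M * S) PrF with h | h <;> rw [hmn, h] <;> linarith
    have hmn1 : mn ≤ M * S := min_le_left _ _
    have hmn2 : mn ≤ √(2 * Cg * M ^ 3 * S * VA) * (r : ℝ) ^ (-(21 / 50) : ℝ) := by
      have e1 : mn ^ 2 ≤ M * S * PrF := by
        rw [sq]; exact mul_le_mul (min_le_left _ _) (min_le_right _ _) hmn0 (by positivity)
      have e2 : mn ≤ √(M * S * PrF) := Real.le_sqrt_of_sq_le e1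
      have e3 : M * S * PrF = (2 * Cg * M ^ 3 * S * VA) * ((r : ℝ) ^ (-(21 / 50) : ℝ)) ^ 2 := by
        rw [hPrF, ← Real.rpow_mul_natCast hr0.le]; norm_num; ring
      rwa [e3, Real.sqrt_mul (by positivity), Real.sqrt_sq (by positivity)] at e2
    have hBq2 : Bq ≤ 2 * VB ^ 2 * ((r : ℝ) ^ (-(17 / 10) : ℝ) * (1 / (1 + x ^ 2))) + 2 * E ^ 2 * D₀ := by
      have e0 : Bq ≤ (VB * (r : ℝ) ^ (-(17 / 20) : ℝ) / (1 + x) + E * √(r * (1 + x))) ^ 2 := by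
        rw [hBq]; gcongr
      have e1 : (E * √(r * (1 + x))) ^ 2 ≤ E ^ 2 * D₀ := by
        rw [mul_pow, Real.sq_sqrt (by positivity)]; gcongr
      have e2 : (VB * (r : ℝ) ^ (-(17 / 20) : ℝ) / (1 + x)) ^ 2 ≤
          VB ^ 2 * ((r : ℝ) ^ (-(17 / 10) : ℝ) * (1 / (1 + x ^ 2))) := by
        rw [div_pow, mul_pow, ← Real.rpow_mul_natCast hr0.le, mul_div_assoc, div_eq_mul_one_div]
        norm_num
        gcongr
        nlinarith
      have e3 : ∀ u v : ℝ, (u + v) ^ 2 ≤ 2 * u ^ 2 + 2 * v ^ 2 := fun u v => by nlinarith [sq_nonneg (u - v)]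
      have e4 := e3 (VB * (r : ℝ) ^ (-(17 / 20) : ℝ) / (1 + x)) (E * √(r * (1 + x)))
      linarith
    have hq1 : 1 / (1 + (X * (α - c / r)) ^ 2) = 1 / (1 + x ^ 2) := by
      rw [hx, mul_pow, mul_pow, sq_abs]
    have hq2 : 1 / 2 ≤ 1 / (1 + (X / D₀ * (α - c / r)) ^ 2) := by
      have : (X / D₀ * (α - c / r)) ^ 2 = (x / D₀) ^ 2 := by
        rw [hx, mul_div_right_comm, mul_pow, mul_pow, sq_abs]
      rw [this]
      have h1 : x / D₀ ≤ 1 := div_le_one_of_le₀ hxD hD0'.le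
      have h2 : 0 ≤ x / D₀ := by positivity
      gcongr
      nlinarith
    have hmain : Bq * mn ≤ arcMajorant D₀ (4 * E ^ 2 * D₀ * (M * S)) (2 * VB ^ 2 * √(2 * Cg * M ^ 3 * S * VA)) X α := by
      refine le_trans ?_ (le_arcMajorant (by positivity) (by positivity) X α hr hrD hc)
      rw [hq1]
      have t1 : 2 * E ^ 2 * D₀ * mn ≤ 4 * E ^ 2 * D₀ * (M * S) * (1 / (1 + (X / D₀ * (α - c / r)) ^ 2)) := by
        calc 2 * E ^ 2 * D₀ * mn ≤ 2 * E ^ 2 * D₀ * (M * S) := by gcongr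
          _ = 4 * E ^ 2 * D₀ * (M * S) * (1 / 2) := by ring
          _ ≤ _ := by gcongr
      have t2 : 2 * VB ^ 2 * ((r : ℝ) ^ (-(17 / 10) : ℝ) * (1 / (1 + x ^ 2))) * mn ≤
          2 * VB ^ 2 * √(2 * Cg * M ^ 3 * S * VA) * (r : ℝ) ^ (-(53 / 25) : ℝ) * (1 / (1 + x ^ 2)) := by
        have e : (r : ℝ) ^ (-(53 / 25) : ℝ) = (r : ℝ) ^ (-(17 / 10) : ℝ) * (r : ℝ) ^ (-(21 / 50) : ℝ) := by
          rw [← Real.rpow_add hr0]; norm_num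
        rw [e]
        calc _ ≤ 2 * VB ^ 2 * ((r : ℝ) ^ (-(17 / 10) : ℝ) * (1 / (1 + x ^ 2))) *
              (√(2 * Cg * M ^ 3 * S * VA) * (r : ℝ) ^ (-(21 / 50) : ℝ)) := by gcongr
          _ = _ := by ring
      calc Bq * mn ≤ (2 * VB ^ 2 * ((r : ℝ) ^ (-(17 / 10) : ℝ) * (1 / (1 + x ^ 2))) + 2 * E ^ 2 * D₀) * mn := by gcongr
        _ = 2 * E ^ 2 * D₀ * mn + 2 * VB ^ 2 * ((r : ℝ) ^ (-(17 / 10) : ℝ) * (1 / (1 + x ^ 2))) * mn := by ring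
        _ ≤ _ := add_le_add t1 t2
    have hη : 0 ≤ 2 * Cg * M ^ 2 * VA * Y * (D₀ : ℝ) ^ (-(21 / 25) : ℝ) := by positivity
    have h4 : 0 ≤ Bq * (F + mn + 2 * M ^ 2 * E * √(N + X / N)) := mul_nonneg hBq0 (by linarith)
    have h5 := mul_nonneg hBq0 hη
    rw [mul_add, mul_add, mul_comm Bq (2 * M ^ 2 * E * _)] at h4
    rw [mul_comm Bq] at h5
    rw [add_mul]
    linarith

theorem exists_circle_bound : ∃ C : ℝ, 1 ≤ C ∧ ∀ (A D : Finset ℕ) (a b : ℕ → ℝ) (M N D₀ : ℕ) (Y X α₀ VA VB E : ℝ),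
    (∀ n ∈ A, 0 ≤ a n) → (∀ n ∈ D, 0 ≤ b n) → 2 ≤ M → 0 < N → 0 < D₀ → 1 ≤ Y → 0 < X → 0 ≤ α₀ → α₀ ≤ 1 →
    0 ≤ VA → 0 ≤ E →
    (∀ n ∈ A, a n ≠ 0 → M * n * α₀ ≤ 1 / 6) → (∀ n ∈ D, b n ≠ 0 → n * α₀ ≤ 1 / 8) →
    (∀ (r c : ℕ) (β : ℝ), 0 < r → r ≤ N → c.Coprime r → r * |β| ≤ 1 / N →
      ‖expSum D b (c / r + β)‖ ≤ VB * (r : ℝ) ^ (-(17 / 20) : ℝ) / (1 + X * |β|) + E * √(r * (1 + X * |β|))) →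
    (∀ (r c m : ℕ) (β : ℝ), 0 < r → r ≤ N → c.Coprime r → r * |β| ≤ 1 / N → 1 ≤ m → m < M →
      ‖expSum A a (m * (c / r + β))‖ ≤
        VA / (1 + X * |β| / Y) * (m.gcd r * (r : ℝ) ^ (-(17 / 20) : ℝ)) + E * √(r * (1 + X * |β|))) →
    α₀ * ((∑ n ∈ D, b n) ^ 2 / 2 * (M ^ 2 / 4 * ∑ n ∈ A, a n)) ≤
      (∫ α in (0 : ℝ)..1, ‖expSum D b α‖ ^ 2 * fejerSum A a M α) +
      C * (M ^ 2 * E * √(N + X / N) + M ^ 2 * VA * Y * (D₀ : ℝ) ^ (-(21 / 25) : ℝ)) * ∑ n ∈ D, b n ^ 2 +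
      C * (D₀ ^ 4 * E ^ 2 * (M * ∑ n ∈ A, a n)) / X +
      C * (VB ^ 2 * √(M ^ 3 * (∑ n ∈ A, a n) * VA)) / X := by
  obtain ⟨Cg, hCg1, hCg⟩ := exists_sum_gcd_rpow_le
  obtain ⟨Ca, hCa1, hCa⟩ := exists_integral_arcMajorant_le
  refine ⟨4 * Cg * Ca, by nlinarith, fun A D a b M N D₀ Y X α₀ VA VB E ha hb hM hN hD₀ hY hX hα₀ hα₁ hVA hE
    hA0 hB0 hB hA => ?_⟩
  set S := ∑ n ∈ A, a n with hSdef
  have hS : 0 ≤ S := sum_nonneg ha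
  set ζ := 4 * E ^ 2 * D₀ * (M * S) with hζ
  set κ := 2 * VB ^ 2 * √(2 * Cg * M ^ 3 * S * VA) with hκ
  have hζ0 : 0 ≤ ζ := by positivity
  have hκ0 : 0 ≤ κ := by positivity
  set η := 2 * M ^ 2 * E * √(N + X / N) + 2 * Cg * M ^ 2 * VA * Y * (D₀ : ℝ) ^ (-(21 / 25) : ℝ) with hη
  have hη0 : 0 ≤ η := by positivity
  set G : ℝ → ℝ := fun α => ‖expSum D b α‖ ^ 2 * fejerSum A a M α + η * ‖expSum D b α‖ ^ 2 + arcMajorant D₀ ζ κ X α with hG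
  have hc1 := continuous_expSum D b
  have hc2 := continuous_fejerSum A a M
  have hc3 := continuous_arcMajorant D₀ ζ κ X
  have hGc : Continuous G := by simp only [hG]; fun_prop
  have hG0 : ∀ α, 0 ≤ α → α ≤ 1 → 0 ≤ G α := by
    intro α h0 h1
    obtain ⟨r, c, hr, hrN, hc, hcop, hβ⟩ := exists_rat_approx hN h0 h1
    have e : α = c / r + (α - c / r) := by ring
    have hB' := hB r c (α - c / r) hr hrN hcop hβ
    rw [← e] at hB'
    refine pointwise_major_minor ha hCg1 hCg hN hD₀ hY hX hVA hE hr hrN hc hβ hB' fun m hm => ?_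
    have hm := mem_Ico.mp hm
    have hA' := hA r c m (α - c / r) hr hrN hcop hβ hm.1 hm.2
    rwa [← e] at hA'
  have hmain : α₀ * ((∑ n ∈ D, b n) ^ 2 / 2 * (M ^ 2 / 4 * S)) ≤ ∫ α in (0 : ℝ)..1, G α := by
    have h1 : ∫ α in (0 : ℝ)..α₀, ((∑ n ∈ D, b n) ^ 2 / 2 * (M ^ 2 / 4 * S)) ≤ ∫ α in (0 : ℝ)..α₀, G α := by
      refine intervalIntegral.integral_mono_on hα₀ (by simp) (hGc.intervalIntegrable _ _) fun α hα => ?_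
      have e1 := le_norm_expSum_sq_of_small hb hα.1 fun n hn h0 =>
        le_trans (mul_le_mul_of_nonneg_left hα.2 (Nat.cast_nonneg n)) (hB0 n hn h0)
      have e2 := le_fejerSum_of_small ha hM hα.1 fun n hn h0 =>
        le_trans (mul_le_mul_of_nonneg_left hα.2 (by positivity)) (hA0 n hn h0)
      have e3 : (∑ n ∈ D, b n) ^ 2 / 2 * (M ^ 2 / 4 * S) ≤ ‖expSum D b α‖ ^ 2 * fejerSum A a M α := by gcongr
      have e4 := arcMajorant_nonneg D₀ hζ0 hκ0 X α
      have e5 : 0 ≤ η * ‖expSum D b α‖ ^ 2 := by positivity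
      simp only [hG]
      linarith
    rw [intervalIntegral.integral_const, sub_zero, smul_eq_mul] at h1
    have h2 : 0 ≤ ∫ α in α₀..1, G α :=
      intervalIntegral.integral_nonneg hα₁ fun α hα => hG0 α (hα₀.trans hα.1) hα.2
    have h3 := intervalIntegral.integral_add_adjacent_intervals (hGc.intervalIntegrable (μ := volume) 0 α₀)
      (hGc.intervalIntegrable (μ := volume) α₀ 1)
    linarith
  have hsplit : ∫ α in (0 : ℝ)..1, G α = (∫ α in (0 : ℝ)..1, ‖expSum D b α‖ ^ 2 * fejerSum A a M α) +
      η * ∑ n ∈ D, b n ^ 2 + ∫ α in (0 : ℝ)..1, arcMajorant D₀ ζ κ X α := by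
    simp only [hG]
    rw [intervalIntegral.integral_add (Continuous.intervalIntegrable (by fun_prop) _ _)
      (hc3.intervalIntegrable _ _), intervalIntegral.integral_add (Continuous.intervalIntegrable (by fun_prop) _ _)
      (Continuous.intervalIntegrable (by fun_prop) _ _), intervalIntegral.integral_const_mul, integral_norm_expSum_sq]
  rw [hsplit] at hmain
  have harc := hCa D₀ ζ κ X hD₀ hζ0 hκ0 hX
  have hCg0 : 0 < Cg := by linarith
  have b1 : η * ∑ n ∈ D, b n ^ 2 ≤
      4 * Cg * Ca * (M ^ 2 * E * √(N + X / N) + M ^ 2 * VA * Y * (D₀ : ℝ) ^ (-(21 / 25) : ℝ)) * ∑ n ∈ D, b n ^ 2 := by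
    have hs : 0 ≤ ∑ n ∈ D, b n ^ 2 := sum_nonneg fun n _ => sq_nonneg _
    refine mul_le_mul_of_nonneg_right ?_ hs
    have p1 : 0 ≤ M ^ 2 * E * √(N + X / N) := by positivity
    have p2 : 0 ≤ M ^ 2 * VA * Y * (D₀ : ℝ) ^ (-(21 / 25) : ℝ) := by positivity
    have q1 : 2 ≤ 4 * Cg * Ca := by nlinarith
    have q2 : 2 * Cg ≤ 4 * Cg * Ca := by nlinarith
    rw [hη, mul_add]
    calc _ = 2 * (M ^ 2 * E * √(N + X / N)) + 2 * Cg * (M ^ 2 * VA * Y * (D₀ : ℝ) ^ (-(21 / 25) : ℝ)) := by ring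
      _ ≤ _ := by gcongr
  have b2 : Ca * ζ * D₀ ^ 3 / X ≤ 4 * Cg * Ca * (D₀ ^ 4 * E ^ 2 * (M * S)) / X := by
    have p : 0 ≤ D₀ ^ 4 * E ^ 2 * (M * S) := by positivity
    refine div_le_div_of_nonneg_right ?_ hX.le
    calc Ca * ζ * D₀ ^ 3 = 4 * 1 * Ca * (D₀ ^ 4 * E ^ 2 * (M * S)) := by rw [hζ]; ring
      _ ≤ _ := by gcongr
  have b3 : Ca * κ / X ≤ 4 * Cg * Ca * (VB ^ 2 * √(M ^ 3 * S * VA)) / X := by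
    refine div_le_div_of_nonneg_right ?_ hX.le
    have h2 : √(2 * Cg * M ^ 3 * S * VA) ≤ 2 * Cg * √(M ^ 3 * S * VA) := by
      rw [show 2 * Cg * M ^ 3 * S * VA = 2 * Cg * (M ^ 3 * S * VA) by ring, Real.sqrt_mul (by positivity)]
      gcongr
      exact Real.sqrt_le_left (by positivity) |>.mpr (by nlinarith)
    calc Ca * κ = Ca * (2 * VB ^ 2 * √(2 * Cg * M ^ 3 * S * VA)) := by rw [hκ]
      _ ≤ Ca * (2 * VB ^ 2 * (2 * Cg * √(M ^ 3 * S * VA))) := by gcongr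
      _ = _ := by ring
  linarith

end CircleBound

end SmoothCircle

namespace SmoothCircle
open MeasureTheory Finset LGrowth
open scoped ContDiff

section Window

/-- Some logarithmic window of unit length carries its fair share of the mass. -/
theorem exists_window {P : Finset ℕ} {w : ℕ → ℝ} {Y : ℕ} (hP : ∀ p ∈ P, p.Prime ∧ p < Y)
    (hw : ∀ p, 0 ≤ w p) (k : ℕ) :
    ∃ j : ℕ, (j : ℝ) ≤ k * Real.log Y ∧ (∑ p ∈ P, w p) ^ k ≤ (k * Real.log Y + 1) *
      kMean P w k (fun n => if ⌊Real.log n⌋₊ = j then (1 : ℝ) else 0) := by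
  have hlY : 0 ≤ Real.log Y := Real.log_natCast_nonneg Y
  have hkl : 0 ≤ k * Real.log Y := by positivity
  set B := ⌊k * Real.log Y⌋₊ with hB
  have hBle : (B : ℝ) ≤ k * Real.log Y := Nat.floor_le hkl
  have key : ∑ j ∈ range (B + 1), kMean P w k (fun n => if ⌊Real.log n⌋₊ = j then (1 : ℝ) else 0)
      = (∑ p ∈ P, w p) ^ k := by
    rw [← kMean_sum]
    have h1 : (∑ p ∈ P, w p) ^ k = kMean P w k (fun _ => (1 : ℝ)) := by
      rw [kMean_const, smul_eq_mul, mul_one]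
    rw [h1, kMean_eq_sum hP, kMean_eq_sum hP]
    refine sum_congr rfl fun n hn => ?_
    by_cases h0 : kWeight P w k n = 0
    · simp [h0]
    obtain ⟨hn0, hnY, -⟩ := kWeight_support hP h0
    have hmem : ⌊Real.log n⌋₊ ∈ range (B + 1) := by
      rw [mem_range, Nat.lt_succ_iff, hB]
      refine Nat.floor_le_floor ?_
      rw [← Real.log_pow]
      exact Real.log_le_log (by exact_mod_cast hn0) (by exact_mod_cast hnY)
    simp [hmem]
  by_contra! hcon
  have h2 : ∀ j ∈ range (B + 1), (k * Real.log Y + 1) *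
      kMean P w k (fun n => if ⌊Real.log n⌋₊ = j then (1 : ℝ) else 0) < (∑ p ∈ P, w p) ^ k := by
    intro j hj
    refine hcon j (le_trans ?_ hBle)
    exact_mod_cast Nat.lt_succ_iff.mp (mem_range.mp hj)
  have h3 := sum_lt_sum_of_nonempty (by simp) h2
  rw [← mul_sum, key, sum_const, card_range, nsmul_eq_mul] at h3
  have h4 : 0 ≤ (∑ p ∈ P, w p) ^ k := pow_nonneg (sum_nonneg fun p _ => hw p) k
  push_cast at h3
  nlinarith [mul_le_mul_of_nonneg_right hBle h4]

theorem sum_primeWeight_small_le (J Y : ℕ) {x : ℝ} (hx : 0 ≤ x) :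
    ∑ p ∈ (primeSet Y).filter (fun p : ℕ => (p : ℝ) < x), primeWeight J Y p ≤ Real.log 4 * (x + 1) := by
  have h4 : 0 ≤ Real.log 4 := Real.log_nonneg (by norm_num)
  calc ∑ p ∈ (primeSet Y).filter (fun p : ℕ => (p : ℝ) < x), primeWeight J Y p
      ≤ ∑ p ∈ (primeSet Y).filter (fun p : ℕ => (p : ℝ) < x), Real.log p :=
        sum_le_sum fun p _ => primeWeight_le_log J Y p
    _ ≤ ∑ p ∈ primeSet ⌈x⌉₊, Real.log p := by
        refine sum_le_sum_of_subset_of_nonneg (fun p hp => ?_) fun p _ _ => Real.log_natCast_nonneg p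
        obtain ⟨hp, hpx⟩ := mem_filter.mp hp
        exact mem_primeSet.mpr ⟨Nat.lt_ceil.mpr hpx, (mem_primeSet.mp hp).2⟩
    _ ≤ Real.log 4 * ⌈x⌉₊ := theta_eq_sum_primeSet_le
    _ ≤ Real.log 4 * (x + 1) := by gcongr; exact (Nat.ceil_lt_add_one hx).le

/-- The mass of a window is inherited by the next product. -/
theorem half_mul_window_le {J Y k j : ℕ} {q : ℝ → ℝ} {R c : ℝ} (hR : 1 ≤ R) (hq0 : ∀ v, 0 ≤ q v)
    (hq1 : ∀ v, |v| ≤ R → q v = 1) (hY : 0 < Y)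
    (hc : c * Y ≤ ∑ p ∈ primeSet Y, primeWeight J Y p)
    (hcR : Real.log 4 * (Y * Real.exp (-R) + 1) ≤ c * Y / 2) :
    (∑ p ∈ primeSet Y, primeWeight J Y p) / 2 *
      kMean (primeSet Y) (primeWeight J Y) k (fun n => if ⌊Real.log n⌋₊ = j then (1 : ℝ) else 0) ≤
      kMean (primeSet Y) (primeWeight J Y) (k + 1)
        (fun n => q (Real.log (n / (Y * Real.exp j)))) := by
  have hP : ∀ p ∈ primeSet Y, 0 < p := fun p hp => (mem_primeSet.mp hp).2.pos
  have hYr : (0 : ℝ) < Y := by exact_mod_cast hY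
  have hw := primeWeight_nonneg J Y
  set W := kMean (primeSet Y) (primeWeight J Y) k (fun n => if ⌊Real.log n⌋₊ = j then (1 : ℝ) else 0) with hW
  have hW0 : 0 ≤ W := kMean_nonneg hw hP k fun n _ => by split_ifs <;> norm_num
  have hsplit := sum_filter_add_sum_filter_not (primeSet Y) (fun p : ℕ => (p : ℝ) < Y * Real.exp (-R)) (primeWeight J Y)
  have hsmall := sum_primeWeight_small_le J Y (x := Y * Real.exp (-R)) (by positivity)
  have hbig : (∑ p ∈ primeSet Y, primeWeight J Y p) / 2 ≤
      ∑ p ∈ (primeSet Y).filter (fun p : ℕ => ¬ (p : ℝ) < Y * Real.exp (-R)), primeWeight J Y p := by linarith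
  refine (mul_le_mul_of_nonneg_right hbig hW0).trans ?_
  rw [sum_mul]
  change _ ≤ ∑ p ∈ primeSet Y, primeWeight J Y p • kMean (primeSet Y) (primeWeight J Y) k
    (fun n => q (Real.log ((p * n : ℕ) / (Y * Real.exp j))))
  refine (sum_le_sum fun p hp => ?_).trans
    (sum_le_sum_of_subset_of_nonneg (filter_subset _ _) fun p hp _ => ?_)
  · obtain ⟨hp, hpR⟩ := mem_filter.mp hp
    rw [smul_eq_mul]
    refine mul_le_mul_of_nonneg_left ?_ (hw p)
    refine kMean_mono hw hP k fun n hn => ?_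
    split_ifs with hj
    · refine (hq1 _ ?_).ge
      have hp0 : (0 : ℝ) < p := by exact_mod_cast hP p hp
      have hn0 : (0 : ℝ) < n := by exact_mod_cast hn
      have hpY : (p : ℝ) ≤ Y := by exact_mod_cast (mem_primeSet.mp hp).1.le
      push_cast
      rw [Real.log_div (by positivity) (by positivity), Real.log_mul hp0.ne' hn0.ne',
        Real.log_mul hYr.ne' (Real.exp_pos _).ne', Real.log_exp]
      have h1 : Real.log p ≤ Real.log Y := Real.log_le_log hp0 hpY
      have h2 : Real.log Y - R ≤ Real.log p := by
        have := Real.log_le_log (by positivity) (not_lt.mp hpR)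
        rw [Real.log_mul hYr.ne' (Real.exp_pos _).ne', Real.log_exp] at this
        linarith
      have h3 : (j : ℝ) ≤ Real.log n := by
        rw [← hj]; exact Nat.floor_le (Real.log_natCast_nonneg n)
      have h4 : Real.log n < j + 1 := by
        rw [← hj]; exact Nat.lt_floor_add_one _
      rw [abs_le]; constructor <;> linarith
    · exact hq0 _
  · exact smul_nonneg (hw p) (kMean_nonneg hw hP k fun n _ => hq0 _)

theorem window_le {P : Finset ℕ} {w : ℕ → ℝ} (hw : ∀ p, 0 ≤ w p) (hP : ∀ p ∈ P, 0 < p) (k j : ℕ)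
    {q : ℝ → ℝ} {R : ℝ} (hR : 1 ≤ R) (hq0 : ∀ v, 0 ≤ q v) (hq1 : ∀ v, |v| ≤ R → q v = 1) :
    kMean P w k (fun n => if ⌊Real.log n⌋₊ = j then (1 : ℝ) else 0) ≤
      kMean P w k (fun n => q (Real.log (n / Real.exp j))) := by
  refine kMean_mono hw hP k fun n hn => ?_
  split_ifs with hj
  · refine (hq1 _ ?_).ge
    have hn0 : (0 : ℝ) < n := by exact_mod_cast hn
    rw [Real.log_div hn0.ne' (Real.exp_pos _).ne', Real.log_exp]
    have h3 : (j : ℝ) ≤ Real.log n := by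
      rw [← hj]; exact Nat.floor_le (Real.log_natCast_nonneg n)
    have h4 : Real.log n < j + 1 := by
      rw [← hj]; exact Nat.lt_floor_add_one _
    rw [abs_le]; constructor <;> linarith
  · exact hq0 _

end Window

section SimpleBound

theorem pow_rpow_three_le {η : ℝ} (hη : 0 < η) : ∃ C : ℝ, 1 ≤ C ∧ ∀ r : ℕ, 0 < r →
    (r.divisors.card : ℝ) ^ 3 * (r : ℝ) ^ (-(7 / 8) : ℝ) ≤ C * (r : ℝ) ^ (-(7 / 8) + η : ℝ) := by
  obtain ⟨C, hC1, hC⟩ := exists_card_divisors_le (η := η / 3) (by positivity)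
  refine ⟨C ^ 3, one_le_pow₀ hC1, fun r hr => ?_⟩
  have hr0 : (0 : ℝ) < r := by exact_mod_cast hr
  calc (r.divisors.card : ℝ) ^ 3 * (r : ℝ) ^ (-(7 / 8) : ℝ)
      ≤ (C * (r : ℝ) ^ (η / 3)) ^ 3 * (r : ℝ) ^ (-(7 / 8) : ℝ) := by
        gcongr; exact hC r hr
    _ = C ^ 3 * (r : ℝ) ^ (-(7 / 8) + η : ℝ) := by
        rw [mul_pow, ← Real.rpow_natCast (_ ^ _), ← Real.rpow_mul hr0.le, mul_assoc,
          ← Real.rpow_add hr0]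
        congr 2; push_cast; ring

/-- The pointwise bound with all parameters expressed through `Y` and `k`. -/
theorem exists_norm_smoothSum_le_simple (hG : GRH) {q : ℝ → ℝ} (hq : ContDiff ℝ ∞ q)
    (hs : HasCompactSupport q) {δ : ℝ} (hδ : 0 < δ) (hδ1 : δ ≤ 1) :
    ∃ c > (0 : ℝ), ∃ C : ℝ, 1 ≤ C ∧ ∃ Y₀ : ℕ, ∀ (Y k r m b N : ℕ) (X β : ℝ), Y₀ ≤ Y → 0 < k →
      k * Real.log Y ≤ c * (Y : ℝ) ^ (1 / 8 : ℝ) → 0 < r → r ≤ N → 0 < m → m ≤ Y → b.Coprime r →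
      0 < X → X ≤ (Y : ℝ) ^ (k + 1) → (N : ℝ) ≤ (Y : ℝ) ^ (k + 2) → X ≤ N * (Y : ℝ) ^ (k + 1) →
      r * |β| ≤ 1 / N →
      ‖smoothSum q (primeSet Y) (primeWeight 30 Y) k X (m * (b / r + β))‖ ≤
        C * (Y : ℝ) ^ (1 / 30 : ℝ) * (∑ p ∈ primeSet Y, primeWeight 30 Y p) ^ k / (1 + m * |β| * X) *
          (m.gcd r * (r : ℝ) ^ (-(17 / 20) : ℝ)) +
        C * (C * ((k + 4) * Real.log Y) * (Y : ℝ) ^ (1 / 2 + δ)) ^ k * √(r * (1 + m * |β| * X)) := by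
  obtain ⟨C₁, hC₁, h1⟩ := exists_norm_smoothSum_le hG hq hs hδ hδ1 (J := 30) (by norm_num)
  obtain ⟨C₂, hC₂, h2⟩ := pow_rpow_three_le (η := 1 / 40) (by norm_num)
  obtain ⟨c, hc, Y₁, h3⟩ := exists_le_sum_primeWeight 30
  refine ⟨c, hc, C₁ * C₂, by nlinarith, max Y₁ 100, ?_⟩
  intro Y k r m b N X β hY hk hkY hr hrN hm hmY hb hX hXY hNY hXN hβ
  have hY100 : 100 ≤ Y := (le_max_right _ _).trans hY
  have hYr : (100 : ℝ) ≤ Y := by exact_mod_cast hY100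
  have hY0 : (0 : ℝ) < Y := by linarith
  have hr0 : (0 : ℝ) < r := by exact_mod_cast hr
  have hm0 : (0 : ℝ) < m := by exact_mod_cast hm
  have hN0 : (0 : ℝ) < N := by exact_mod_cast hr.trans_le hrN
  have hlY4 : 4 ≤ Real.log Y := by
    rw [Real.le_log_iff_exp_le hY0]
    have := Real.exp_one_lt_d9
    calc Real.exp 4 = Real.exp 1 ^ 4 := by rw [← Real.exp_nat_mul]; norm_num
      _ ≤ 2.7182818286 ^ 4 := by gcongr
      _ ≤ Y := by norm_num; linarith
  have : NeZero r := ⟨hr.ne'⟩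
  have hP0 := h3 Y ((le_max_left _ _).trans hY)
  set P0 := ∑ p ∈ primeSet Y, primeWeight 30 Y p with hP0d
  have hmain := h1 Y k r m b X β ((Y : ℝ) ^ (1 / 60 : ℝ)) ((k + 4) * Real.log Y) k (by omega) hm hb hX
    (Real.one_le_rpow (by linarith) (by norm_num)) ?_ (by positivity) ?_ ?_ (by exact_mod_cast hk) le_rfl ?_
  · refine hmain.trans ?_
    have e1 : ((Y : ℝ) ^ (1 / 60 : ℝ)) ^ 2 = (Y : ℝ) ^ (1 / 30 : ℝ) := by
      rw [← Real.rpow_natCast, ← Real.rpow_mul hY0.le]; norm_num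
    rw [e1]
    have hP00 : 0 ≤ P0 := le_trans (by positivity) hP0
    have hd : 0 < 1 + m * |β| * X := by positivity
    have h2r := h2 r hr
    rw [show (-(7 / 8) + 1 / 40 : ℝ) = -(17 / 20) by norm_num] at h2r
    refine add_le_add ?_ ?_
    · calc _ ≤ C₁ * ((Y : ℝ) ^ (1 / 30 : ℝ) / (1 + m * |β| * X)) *
            (P0 ^ k * (m.gcd r * (C₂ * (r : ℝ) ^ (-(17 / 20) : ℝ)))) := by gcongr
        _ = _ := by ring
    · have : C₁ ≤ C₁ * C₂ := by nlinarith
      rw [mul_right_comm]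
      gcongr
  · rw [div_le_iff₀ (by positivity)]
    have h31 : (Y : ℝ) ^ (1 / 2 : ℝ) ≤ (1 + (Y : ℝ) ^ (1 / 60 : ℝ)) ^ (30 + 1) :=
      calc (Y : ℝ) ^ (1 / 2 : ℝ) ≤ (Y : ℝ) ^ (31 / 60 : ℝ) :=
            Real.rpow_le_rpow_of_exponent_le (by linarith) (by norm_num)
        _ = ((Y : ℝ) ^ (1 / 60 : ℝ)) ^ (30 + 1) := by
            rw [← Real.rpow_natCast, ← Real.rpow_mul hY0.le]; norm_num
        _ ≤ _ := by gcongr; linarith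
    calc (Y : ℝ) = (Y : ℝ) ^ (1 / 2 : ℝ) * (Y : ℝ) ^ (1 / 2 : ℝ) := by
          rw [← Real.rpow_add hY0]; norm_num
      _ ≤ _ := by gcongr
  · have hrm : 4 * r * (1 + m * |β| * X) ≤ (Y : ℝ) ^ (k + 4) := by
      have a1 : (r : ℝ) ≤ (Y : ℝ) ^ (k + 2) := le_trans (by exact_mod_cast hrN) hNY
      have a2 : m * (r * |β|) * X ≤ (Y : ℝ) ^ (k + 2) := by
        calc m * (r * |β|) * X ≤ Y * (1 / N) * (N * (Y : ℝ) ^ (k + 1)) := by gcongr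
          _ = (Y : ℝ) ^ (k + 2) := by field_simp; ring
      have a3 : (Y : ℝ) ^ (k + 4) = (Y : ℝ) ^ (k + 2) * Y ^ 2 := by ring
      have a4 : 0 < (Y : ℝ) ^ (k + 2) := by positivity
      have a5 : (8 : ℝ) ≤ (Y : ℝ) ^ 2 := by nlinarith
      rw [a3]
      nlinarith
    calc Real.log (4 * r * (1 + m * |β| * X)) ≤ Real.log ((Y : ℝ) ^ (k + 4)) :=
          Real.log_le_log (by positivity) hrm
      _ = _ := by rw [Real.log_pow]; push_cast; ring
  · nlinarith
  · intro p hp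
    obtain ⟨hpY, hpp⟩ := mem_primeSet.mp hp
    have hp0 : (0 : ℝ) < p := by exact_mod_cast hpp.pos
    have hpYr : (p : ℝ) ≤ Y := by exact_mod_cast hpY.le
    calc primeWeight 30 Y p * k ≤ Real.log Y * k := by
          gcongr
          exact (primeWeight_le_log 30 Y p).trans (Real.log_le_log hp0 hpYr)
      _ ≤ c * (Y : ℝ) ^ (1 / 8 : ℝ) := by linarith
      _ = c * Y * (Y : ℝ) ^ (-(7 / 8) : ℝ) := by
          rw [mul_assoc]
          congr 1
          nth_rewrite 2 [← Real.rpow_one (Y : ℝ)]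
          rw [← Real.rpow_add hY0]; norm_num
      _ ≤ P0 * (p : ℝ) ^ (-(7 / 8) : ℝ) := by
          refine mul_le_mul hP0 ?_ (by positivity) (le_trans (by positivity) hP0)
          exact Real.rpow_le_rpow_of_nonpos hp0 hpYr (by norm_num)

end SimpleBound

end SmoothCircle

namespace SmoothCircle
open MeasureTheory Finset LGrowth PadeUnit

section Count

/-- Weighted solutions of `u + m n = v` are controlled by primitive unit solutions. -/
theorem weighted_count_le {A D : Finset ℕ} {a b : ℕ → ℝ} {M G : ℕ} {f : ℝ} (hf0 : 0 ≤ f)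
    (hfa : ∀ n ∈ A, 0 ≤ a n ∧ a n ≤ f) (hfb : ∀ n ∈ D, 0 ≤ b n ∧ b n ≤ f)
    (ha : ∀ n ∈ A, a n ≠ 0 → 0 < n ∧ ∀ p, p.Prime → p ∣ n → p ∈ primeSet M)
    (hb : ∀ n ∈ D, b n ≠ 0 → 0 < n ∧ n ≤ G ∧ ∀ p, p.Prime → p ∣ n → p ∈ primeSet M) :
    ∑ m ∈ Ico 1 M, ∑ n ∈ A, ∑ u ∈ D, ∑ v ∈ D,
      2 * ((M : ℝ) - m) * (a n * (b u * b v)) * (if u + m * n = v then 1 else 0) ≤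
      2 * M * f ^ 3 * (M * G * Nat.card (unitSolutions (primeSet M))) := by
  classical
  have hfin := unitSolutions_finite (primeSet M) fun p hp => (mem_primeSet.mp hp).2
  rw [show Nat.card (unitSolutions (primeSet M)) = hfin.toFinset.card by
    rw [Nat.card_coe_set_eq, Set.ncard_eq_toFinset_card _ hfin]]
  set U := Ico 1 M ×ˢ A ×ˢ D ×ˢ D with hU
  set Q := U.filter fun t => a t.2.1 ≠ 0 ∧ b t.2.2.1 ≠ 0 ∧ b t.2.2.2 ≠ 0 ∧
    t.2.2.1 + t.1 * t.2.1 = t.2.2.2 with hQ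
  have hcard : Q.card ≤ (Ico 1 M ×ˢ Icc 1 G ×ˢ hfin.toFinset).card := by
    refine card_le_card_of_injOn (fun t => (t.1, Nat.gcd t.2.2.1 t.2.2.2,
      (t.1 * t.2.1 / Nat.gcd t.2.2.1 t.2.2.2, t.2.2.1 / Nat.gcd t.2.2.1 t.2.2.2,
        t.2.2.2 / Nat.gcd t.2.2.1 t.2.2.2))) ?_ ?_
    · rintro ⟨m, n, u, v⟩ ht
      simp only [hQ, hU, mem_coe, mem_filter, mem_product] at ht
      obtain ⟨⟨hm, hn, hu, hv⟩, han, hbu, hbv, heq⟩ := ht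
      obtain ⟨hn0, hnp⟩ := ha n hn han
      obtain ⟨hu0, huG, hup⟩ := hb u hu hbu
      obtain ⟨hv0, hvG, hvp⟩ := hb v hv hbv
      have hm' := mem_Ico.mp hm
      have hg0 : 0 < Nat.gcd u v := Nat.gcd_pos_of_pos_left _ hu0
      have hgu := Nat.gcd_dvd_left u v
      have hgv := Nat.gcd_dvd_right u v
      have hgmn : Nat.gcd u v ∣ m * n := by
        have : m * n = v - u := by omega
        rw [this]; exact Nat.dvd_sub hgv hgu
      have hmp : ∀ p, p.Prime → p ∣ m → p ∈ primeSet M := fun p hp hpm =>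
        mem_primeSet.mpr ⟨(Nat.le_of_dvd (by omega) hpm).trans_lt hm'.2, hp⟩
      simp only [coe_product, Set.mem_prod, mem_coe, Set.Finite.mem_toFinset, mem_Icc]
      refine ⟨hm, ⟨hg0, (Nat.le_of_dvd hu0 hgu).trans huG⟩, ?_⟩
      refine ⟨Nat.div_pos (Nat.le_of_dvd (Nat.mul_pos (by omega) hn0) hgmn) hg0,
        Nat.div_pos (Nat.le_of_dvd hu0 hgu) hg0, ?_, ?_, ?_⟩
      · change m * n / _ + u / _ = v / _
        rw [← Nat.add_div_of_dvd_right hgmn, add_comm, heq]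
      · change Nat.gcd _ (Nat.gcd (u / _) (v / _)) = 1
        rw [Nat.coprime_div_gcd_div_gcd hg0, Nat.gcd_one_right]
      · intro p hp hpd
        rcases (Nat.Prime.dvd_mul hp).mp hpd with h | h
        · rcases (Nat.Prime.dvd_mul hp).mp h with h | h
          · rcases (Nat.Prime.dvd_mul hp).mp (h.trans (Nat.div_dvd_of_dvd hgmn)) with h | h
            · exact hmp p hp h
            · exact hnp p hp h
          · exact hup p hp (h.trans (Nat.div_dvd_of_dvd hgu))
        · exact hvp p hp (h.trans (Nat.div_dvd_of_dvd hgv))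
    · rintro ⟨m, n, u, v⟩ ht ⟨m', n', u', v'⟩ ht' h
      simp only [hQ, hU, mem_coe, mem_filter, mem_product] at ht ht'
      simp only [Prod.mk.injEq] at h
      obtain ⟨rfl, hg, h1, h2, h3⟩ := h
      have hm' := mem_Ico.mp ht.1.1
      rw [← hg] at h2 h3
      have e2 : u = u' := (Nat.div_left_inj (Nat.gcd_dvd_left u v) (hg ▸ Nat.gcd_dvd_left u' v')).mp h2
      have e3 : v = v' := (Nat.div_left_inj (Nat.gcd_dvd_right u v) (hg ▸ Nat.gcd_dvd_right u' v')).mp h3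
      subst e2 e3
      have e4 : m * n = m * n' := by
        have := ht.2.2.2.2
        have := ht'.2.2.2.2
        omega
      have e5 : n = n' := Nat.eq_of_mul_eq_mul_left (by omega) e4
      rw [e5]
  have hsum : ∑ m ∈ Ico 1 M, ∑ n ∈ A, ∑ u ∈ D, ∑ v ∈ D,
      2 * ((M : ℝ) - m) * (a n * (b u * b v)) * (if u + m * n = v then 1 else 0) =
      ∑ t ∈ U, 2 * ((M : ℝ) - t.1) * (a t.2.1 * (b t.2.2.1 * b t.2.2.2)) *
        (if t.2.2.1 + t.1 * t.2.1 = t.2.2.2 then 1 else 0) := by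
    simp only [hU, sum_product]
  have hsum2 : ∑ t ∈ U, 2 * ((M : ℝ) - t.1) * (a t.2.1 * (b t.2.2.1 * b t.2.2.2)) *
        (if t.2.2.1 + t.1 * t.2.1 = t.2.2.2 then 1 else 0) ≤ ∑ t ∈ Q, 2 * (M : ℝ) * f ^ 3 := by
    rw [hQ, sum_filter]
    refine sum_le_sum fun t ht => ?_
    simp only [hU, mem_product] at ht
    obtain ⟨hm, hn, hu, hv⟩ := ht
    have hm' := mem_Ico.mp hm
    have hmM : (t.1 : ℝ) ≤ M := by exact_mod_cast hm'.2.le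
    obtain ⟨ha0, haf⟩ := hfa _ hn
    obtain ⟨hu0, huf⟩ := hfb _ hu
    obtain ⟨hv0, hvf⟩ := hfb _ hv
    split_ifs with h1 h2 h3
    · rw [mul_one]
      calc 2 * ((M : ℝ) - t.1) * (a t.2.1 * (b t.2.2.1 * b t.2.2.2))
          ≤ 2 * (M : ℝ) * (f * (f * f)) := by
            gcongr
            · linarith [(Nat.cast_nonneg t.1 : (0 : ℝ) ≤ t.1)]
        _ = 2 * (M : ℝ) * f ^ 3 := by ring
    · have : a t.2.1 = 0 ∨ b t.2.2.1 = 0 ∨ b t.2.2.2 = 0 := by tauto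
      rcases this with h | h | h <;> simp [h]
    · simp only [mul_zero]; positivity
    · simp
  rw [hsum]
  refine hsum2.trans ?_
  rw [sum_const, nsmul_eq_mul, mul_comm]
  refine mul_le_mul_of_nonneg_left ?_ (by positivity)
  have h4 : (Q.card : ℝ) ≤ ((Ico 1 M ×ˢ Icc 1 G ×ˢ hfin.toFinset).card : ℝ) := by exact_mod_cast hcard
  refine h4.trans ?_
  rw [card_product, card_product, Nat.card_Ico, Nat.card_Icc]
  have : (M - 1) * ((G + 1 - 1) * hfin.toFinset.card) ≤ M * G * hfin.toFinset.card := by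
    rw [Nat.add_sub_cancel, ← mul_assoc]
    gcongr; omega
  exact_mod_cast this

end Count

end SmoothCircle

namespace SmoothCircle
open MeasureTheory Finset LGrowth PadeUnit
open scoped ContDiff

section Apply

/-- The number of ordered factorisations of `n`, weighted and localised near `X`. -/
noncomputable def windowWeight (q : ℝ → ℝ) (P : Finset ℕ) (w : ℕ → ℝ) (k : ℕ) (X : ℝ) (n : ℕ) : ℝ :=
  kWeight P w k n * q (Real.log (n / X))

theorem smoothSum_eq_expSum {P : Finset ℕ} {w : ℕ → ℝ} {Y : ℕ} (hP : ∀ p ∈ P, p.Prime ∧ p < Y)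
    (q : ℝ → ℝ) (k : ℕ) (X α : ℝ) :
    smoothSum q P w k X α = expSum (range (Y ^ k + 1)) (windowWeight q P w k X) α := by
  unfold smoothSum expSum windowWeight
  rw [kMean_eq_sum hP]
  refine sum_congr rfl fun n _ => ?_
  rw [Complex.real_smul]; push_cast; ring

theorem sum_windowWeight {P : Finset ℕ} {w : ℕ → ℝ} {Y : ℕ} (hP : ∀ p ∈ P, p.Prime ∧ p < Y)
    (q : ℝ → ℝ) (k : ℕ) (X : ℝ) :
    ∑ n ∈ range (Y ^ k + 1), windowWeight q P w k X n = kMean P w k fun n => q (Real.log (n / X)) := by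
  rw [kMean_eq_sum hP]
  rfl

theorem windowWeight_ne_zero {P : Finset ℕ} {w : ℕ → ℝ} {Y : ℕ} (hP : ∀ p ∈ P, p.Prime ∧ p < Y)
    {q : ℝ → ℝ} {B : ℝ} (hqs : ∀ v, B ≤ |v| → q v = 0) {k n : ℕ} {X : ℝ} (hX : 0 < X)
    (h : windowWeight q P w k X n ≠ 0) :
    0 < n ∧ n ≤ Y ^ k ∧ (∀ p, p.Prime → p ∣ n → p ∈ P) ∧ n ≤ Real.exp B * X := by
  have h1 := left_ne_zero_of_mul h
  have h2 := right_ne_zero_of_mul h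
  obtain ⟨hn, hnY, hp⟩ := kWeight_support hP h1
  refine ⟨hn, hnY, hp, ?_⟩
  have hn0 : (0 : ℝ) < n := by exact_mod_cast hn
  have h3 : |Real.log (n / X)| < B := by
    by_contra hcon
    exact h2 (hqs _ (not_lt.mp hcon))
  rw [← div_le_iff₀ hX, ← Real.log_le_iff_le_exp (by positivity)]
  exact (le_abs_self _).trans h3.le

theorem windowWeight_bounds {P : Finset ℕ} {w : ℕ → ℝ} {Y : ℕ} (hP : ∀ p ∈ P, p.Prime ∧ p < Y)
    (hw : ∀ p, 0 ≤ w p) (hw1 : ∀ p, w p ≤ Real.log p) {q : ℝ → ℝ} (hq0 : ∀ v, 0 ≤ q v)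
    (hq1 : ∀ v, q v ≤ 1) (k n : ℕ) (X : ℝ) :
    0 ≤ windowWeight q P w k X n ∧ windowWeight q P w k X n ≤ (k * Real.log Y) ^ k := by
  have hk := kWeight_nonneg (P := P) hw k n
  refine ⟨mul_nonneg hk (hq0 _), ?_⟩
  have hlY : 0 ≤ Real.log Y := Real.log_natCast_nonneg Y
  refine (mul_le_of_le_one_right hk (hq1 _)).trans ?_
  by_cases h0 : kWeight P w k n = 0
  · rw [h0]; positivity
  obtain ⟨hn, hnY, -⟩ := kWeight_support hP h0
  refine (kWeight_le (fun p hp => (hP p hp).1) hw hw1 k hn).trans ?_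
  have hn0 : (0 : ℝ) < n := by exact_mod_cast hn
  refine pow_le_pow_left₀ (Real.log_natCast_nonneg n) ?_ k
  rw [← Real.log_pow]
  exact Real.log_le_log hn0 (by exact_mod_cast hnY)

theorem sqrt_ceil_bounds {X : ℝ} (hX : 1 ≤ X) :
    0 < ⌈√X⌉₊ ∧ √X ≤ ⌈√X⌉₊ ∧ ((⌈√X⌉₊ : ℕ) : ℝ) ≤ 2 * √X ∧
      √((⌈√X⌉₊ : ℕ) + X / (⌈√X⌉₊ : ℕ)) ≤ 2 * X ^ (1 / 4 : ℝ) := by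
  have h1 : 1 ≤ √X := Real.one_le_sqrt.mpr hX
  have h2 : √X ≤ ⌈√X⌉₊ := Nat.le_ceil _
  have h3 : ((⌈√X⌉₊ : ℕ) : ℝ) ≤ 2 * √X := by
    have := Nat.ceil_lt_add_one (Real.sqrt_nonneg X)
    linarith
  have h4 : X / (⌈√X⌉₊ : ℕ) ≤ √X := by
    rw [div_le_iff₀ (by linarith)]
    nlinarith [Real.mul_self_sqrt (by linarith : 0 ≤ X)]
  refine ⟨by exact_mod_cast (lt_of_lt_of_le (by linarith) h2 : (0 : ℝ) < _), h2, h3, ?_⟩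
  refine Real.sqrt_le_iff.mpr ⟨by positivity, ?_⟩
  have : (2 * X ^ (1 / 4 : ℝ)) ^ 2 = 4 * √X := by
    rw [mul_pow, ← Real.rpow_natCast (X ^ _), ← Real.rpow_mul (by linarith), Real.sqrt_eq_rpow]
    norm_num
  rw [this]
  linarith

theorem mul_pow_le_mul_pow {C₂ C x y l z : ℝ} {m n : ℕ} (hC₂ : 1 ≤ C₂) (hC : C₂ ≤ C) (hx : 0 ≤ x)
    (hxy : x ≤ y + 1) (hl : 1 ≤ l) (hz : 1 ≤ z) (hmn : m ≤ n) :
    C₂ * (C₂ * ((x + 4) * l) * z) ^ m ≤ C * (C * ((y + 5) * l) * z) ^ n := by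
  have h1 : 1 ≤ C := hC₂.trans hC
  have h2 : 1 ≤ (y + 5) * l := one_le_mul_of_one_le_of_one_le (by linarith) hl
  have hbase : 1 ≤ C * ((y + 5) * l) * z :=
    one_le_mul_of_one_le_of_one_le (one_le_mul_of_one_le_of_one_le h1 h2) hz
  calc C₂ * (C₂ * ((x + 4) * l) * z) ^ m ≤ C * (C * ((y + 5) * l) * z) ^ m := by
        gcongr ?_ * (?_ * (?_ * _) * _) ^ m
        linarith
    _ ≤ _ := mul_le_mul_of_nonneg_left (pow_le_pow_right₀ hbase hmn) (by linarith)

set_option maxHeartbeats 2000000 in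
/-- The circle method inequality for smooth numbers. -/
theorem exists_smooth_circle_bound (hG : GRH) {δ : ℝ} (hδ : 0 < δ) (hδ1 : δ ≤ 1) :
    ∃ κ > (0 : ℝ), ∃ c > (0 : ℝ), ∃ C : ℝ, 1 ≤ C ∧ ∃ Y₀ : ℕ, ∀ Y k D₀ : ℕ, Y₀ ≤ Y → 0 < k → 0 < D₀ →
      ((k + 1 : ℕ) : ℝ) * Real.log Y ≤ c * (Y : ℝ) ^ (1 / 8 : ℝ) →
      ∃ X P0 ΨA ΨB S VA VB E : ℝ, 1 ≤ X ∧ X ≤ (Y : ℝ) ^ (k + 1) ∧ c * Y ≤ P0 ∧ P0 ≤ Real.log 4 * Y ∧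
        P0 ^ k ≤ (k * Real.log Y + 1) * ΨA ∧ ΨA ≤ P0 ^ k ∧
        P0 ^ (k + 1) ≤ 2 * (k * Real.log Y + 1) * ΨB ∧
        0 ≤ S ∧ S ≤ (((k + 1 : ℕ) : ℝ) * Real.log Y) ^ (k + 1) * P0 ^ (k + 1) ∧
        VA = C * (Y : ℝ) ^ (1 / 30 : ℝ) * P0 ^ k ∧ VB = C * (Y : ℝ) ^ (1 / 30 : ℝ) * P0 ^ (k + 1) ∧
        E = C * (C * ((k + 5) * Real.log Y) * (Y : ℝ) ^ (1 / 2 + δ)) ^ (k + 1) ∧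
        κ / X * (ΨB ^ 2 / 2 * ((Y : ℝ) ^ 2 / 4 * ΨA)) ≤
          2 * Y * ((((k + 1 : ℕ) : ℝ) * Real.log Y) ^ (k + 1)) ^ 3 *
            (Y * (Y : ℝ) ^ (k + 1) * Nat.card (unitSolutions (primeSet Y))) +
          C * ((Y : ℝ) ^ 2 * E * (2 * X ^ (1 / 4 : ℝ)) +
            (Y : ℝ) ^ 2 * VA * Y * (D₀ : ℝ) ^ (-(21 / 25) : ℝ)) * S +
          C * ((D₀ : ℝ) ^ 4 * E ^ 2 * (Y * ΨA)) / X +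
          C * (VB ^ 2 * √((Y : ℝ) ^ 3 * ΨA * VA)) / X := by
  obtain ⟨c₁, hc₁, Y₁, h1⟩ := exists_le_sum_primeWeight 30
  obtain ⟨R, hR1, hR⟩ : ∃ R : ℝ, 1 ≤ R ∧ Real.log 4 * Real.exp (-R) ≤ c₁ / 4 := by
    refine ⟨max 1 (-Real.log (c₁ / 4 / Real.log 4)), le_max_left _ _, ?_⟩
    have h4 : 0 < Real.log 4 := Real.log_pos (by norm_num)
    rw [mul_comm, ← le_div_iff₀ h4, ← Real.le_log_iff_exp_le (by positivity)]
    linarith [le_max_right 1 (-Real.log (c₁ / 4 / Real.log 4))]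
  let f : ContDiffBump (0 : ℝ) := ⟨R, R + 1, by linarith, by linarith⟩
  set q : ℝ → ℝ := fun v => f v with hq
  have hq0 : ∀ v, 0 ≤ q v := fun v => f.nonneg
  have hq1 : ∀ v, q v ≤ 1 := fun v => f.le_one
  have hqR : ∀ v, |v| ≤ R → q v = 1 := fun v hv =>
    f.one_of_mem_closedBall (by simpa [Real.dist_eq] using hv)
  have hqs : ∀ v, R + 1 ≤ |v| → q v = 0 := fun v hv =>
    f.zero_of_le_dist (by simpa [Real.dist_eq] using hv)
  obtain ⟨c₂, hc₂, C₂, hC₂, Y₂, h2⟩ := exists_norm_smoothSum_le_simple hG (q := q) f.contDiff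
    f.hasCompactSupport hδ hδ1
  obtain ⟨C₃, hC₃, h3⟩ := exists_circle_bound
  refine ⟨Real.exp (-(R + 1)) / 8, by positivity, min c₁ c₂, lt_min hc₁ hc₂, max C₂ C₃,
    hC₂.trans (le_max_left _ _), max (max Y₁ Y₂) (max 3 ⌈4 * Real.log 4 / c₁⌉₊), ?_⟩
  intro Y k D₀ hY hk hD₀ hkY
  have hYY₁ : Y₁ ≤ Y := ((le_max_left _ _).trans (le_max_left _ _)).trans hY
  have hYY₂ : Y₂ ≤ Y := ((le_max_right _ _).trans (le_max_left _ _)).trans hY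
  have hY3 : 3 ≤ Y := ((le_max_left _ _).trans (le_max_right _ _)).trans hY
  have hYc : Real.log 4 ≤ c₁ * Y / 4 := by
    have : 4 * Real.log 4 / c₁ ≤ Y := Nat.ceil_le.mp (((le_max_right _ _).trans (le_max_right _ _)).trans hY)
    rw [div_le_iff₀ hc₁] at this
    linarith
  have hYr3 : (3 : ℝ) ≤ Y := by exact_mod_cast hY3
  have hY0 : (0 : ℝ) < Y := by linarith
  have hlY : 1 ≤ Real.log Y := by
    rw [Real.le_log_iff_exp_le hY0]
    linarith [Real.exp_one_lt_d9]
  set C := max C₂ C₃ with hC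
  have hC2C : C₂ ≤ C := le_max_left _ _
  have hC3C : C₃ ≤ C := le_max_right _ _
  have hC0 : 0 < C := by linarith
  set P := primeSet Y with hPd
  set w := primeWeight 30 Y with hwd
  have hw : ∀ p, 0 ≤ w p := primeWeight_nonneg 30 Y
  have hw1 : ∀ p, w p ≤ Real.log p := primeWeight_le_log 30 Y
  have hP : ∀ p ∈ P, p.Prime ∧ p < Y := fun p hp => ((mem_primeSet.mp hp)).symm
  have hPpos : ∀ p ∈ P, 0 < p := fun p hp => (hP p hp).1.pos
  have hP0l := h1 Y hYY₁
  set P0 := ∑ p ∈ P, w p with hP0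
  have hP0pos : 0 < P0 := lt_of_lt_of_le (by positivity) hP0l
  have hP0u : P0 ≤ Real.log 4 * Y := (sum_le_sum fun p _ => hw1 p).trans theta_eq_sum_primeSet_le
  obtain ⟨j, hj, hW⟩ := exists_window (k := k) hP hw
  set W := kMean P w k (fun n => if ⌊Real.log n⌋₊ = j then (1 : ℝ) else 0) with hWd
  set Xl := Real.exp j with hXl
  have hXl1 : 1 ≤ Xl := Real.one_le_exp (by positivity)
  have hXlY : Xl ≤ (Y : ℝ) ^ k := by
    rw [hXl, ← Real.exp_log (by positivity : (0 : ℝ) < (Y : ℝ) ^ k), Real.log_pow]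
    exact Real.exp_le_exp.mpr hj
  set X := Y * Xl with hX
  have hX1 : 1 ≤ X := one_le_mul_of_one_le_of_one_le (by linarith) hXl1
  have hX0 : 0 < X := by linarith
  have hXY : X ≤ (Y : ℝ) ^ (k + 1) := by rw [pow_succ', hX]; gcongr
  set a := windowWeight q P w k Xl with ha
  set b := windowWeight q P w (k + 1) X with hb
  set A := range (Y ^ k + 1) with hA
  set D := range (Y ^ (k + 1) + 1) with hD
  have hlk : 0 ≤ k * Real.log Y := by positivity
  have hWA : W ≤ ∑ n ∈ A, a n := by
    rw [hA, ha, sum_windowWeight hP]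
    exact window_le hw hPpos k j hR1 hq0 hqR
  have hWB : P0 / 2 * W ≤ ∑ n ∈ D, b n := by
    rw [hD, hb, sum_windowWeight hP]
    refine half_mul_window_le hR1 hq0 hqR (by omega) hP0l ?_
    have : Real.log 4 * (Y * Real.exp (-R) + 1) = (Real.log 4 * Real.exp (-R)) * Y + Real.log 4 := by ring
    rw [this]
    linarith [mul_le_mul_of_nonneg_right hR hY0.le]
  have habd : ∀ n, 0 ≤ a n ∧ a n ≤ (k * Real.log Y) ^ k := fun n =>
    windowWeight_bounds hP hw hw1 hq0 hq1 k n Xl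
  have hbbd : ∀ n, 0 ≤ b n ∧ b n ≤ (((k + 1 : ℕ) : ℝ) * Real.log Y) ^ (k + 1) := fun n =>
    windowWeight_bounds hP hw hw1 hq0 hq1 (k + 1) n X
  have hA_le : ∑ n ∈ A, a n ≤ P0 ^ k := by
    rw [hA, ha, sum_windowWeight hP]
    refine (kMean_mono hw hPpos k fun n _ => hq1 _).trans ?_
    rw [kMean_const, smul_eq_mul, mul_one]
  have hB_le : ∑ n ∈ D, b n ≤ P0 ^ (k + 1) := by
    rw [hD, hb, sum_windowWeight hP]
    refine (kMean_mono hw hPpos (k + 1) fun n _ => hq1 _).trans ?_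
    rw [kMean_const, smul_eq_mul, mul_one]
  set F := (((k + 1 : ℕ) : ℝ) * Real.log Y) ^ (k + 1) with hF
  have hF0 : 0 ≤ F := by positivity
  have haF : (k * Real.log Y) ^ k ≤ F := by
    calc (k * Real.log Y) ^ k ≤ (((k + 1 : ℕ) : ℝ) * Real.log Y) ^ k := by
          gcongr; linarith
      _ ≤ F := by
          refine pow_le_pow_right₀ ?_ (Nat.le_succ k)
          push_cast
          exact one_le_mul_of_one_le_of_one_le (by linarith [(Nat.cast_nonneg k : (0 : ℝ) ≤ k)]) hlY
  set VA := C * (Y : ℝ) ^ (1 / 30 : ℝ) * P0 ^ k with hVA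
  set VB := C * (Y : ℝ) ^ (1 / 30 : ℝ) * P0 ^ (k + 1) with hVB
  set E := C * (C * ((k + 5) * Real.log Y) * (Y : ℝ) ^ (1 / 2 + δ)) ^ (k + 1) with hE
  have hE1 : ∀ k' : ℕ, k' = k ∨ k' = k + 1 →
      C₂ * (C₂ * ((k' + 4) * Real.log Y) * (Y : ℝ) ^ (1 / 2 + δ)) ^ k' ≤ E := by
    intro k' hk'
    have hk'1 : (k' : ℝ) ≤ k + 1 := by rcases hk' with rfl | rfl <;> push_cast <;> linarith
    exact mul_pow_le_mul_pow hC₂ hC2C (Nat.cast_nonneg k') hk'1 hlY (Real.one_le_rpow (by linarith) (by positivity)) (by omega)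
  obtain ⟨hN0, hNl, hNu, hN4⟩ := sqrt_ceil_bounds hX1
  set N := ⌈√X⌉₊ with hN
  have hNr0 : (0 : ℝ) < N := by exact_mod_cast hN0
  have hsX : √X ≤ X := Real.sqrt_le_iff.mpr ⟨hX0.le, by rw [sq]; exact le_mul_of_one_le_left hX0.le hX1⟩
  have hNY : (N : ℝ) ≤ (Y : ℝ) ^ (k + 2) := by
    calc (N : ℝ) ≤ 2 * X := by linarith
      _ ≤ Y * (Y : ℝ) ^ (k + 1) := by gcongr; linarith
      _ = _ := by ring
  have hXN : X ≤ N * (Y : ℝ) ^ (k + 1) := by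
    have : (1 : ℝ) ≤ N := by exact_mod_cast hN0
    exact hXY.trans (le_mul_of_one_le_left (by positivity) this)
  have hXN' : X ≤ N * (Y : ℝ) ^ (k + 1 + 1) := by
    refine hXN.trans ?_
    gcongr
    · linarith
    · omega
  have hkY' : (k : ℝ) * Real.log Y ≤ c₂ * (Y : ℝ) ^ (1 / 8 : ℝ) := by
    refine le_trans ?_ (hkY.trans (by gcongr; exact min_le_right _ _))
    gcongr; linarith
  have hkY'' : ((k + 1 : ℕ) : ℝ) * Real.log Y ≤ c₂ * (Y : ℝ) ^ (1 / 8 : ℝ) :=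
    hkY.trans (by gcongr; exact min_le_right _ _)
  have hcirc := h3 A D a b Y N D₀ Y X (Real.exp (-(R + 1)) / 8 / X) VA VB E (fun n _ => (habd n).1)
    (fun n _ => (hbbd n).1) (by omega) hN0 hD₀ (by linarith) hX0 (by positivity) ?_ (by positivity)
    (by positivity) ?_ ?_ ?_ ?_
  · rw [integral_norm_expSum_sq_mul_fejerSum] at hcirc
    have hcount := weighted_count_le (A := A) (D := D) (a := a) (b := b) (M := Y) (G := Y ^ (k + 1)) hF0
      (fun n _ => ⟨(habd n).1, (habd n).2.trans haF⟩) (fun n _ => hbbd n)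
      (fun n _ h => by
        obtain ⟨h1, -, h3, -⟩ := windowWeight_ne_zero hP hqs (by linarith) h
        exact ⟨h1, h3⟩)
      (fun n _ h => by
        obtain ⟨h1, h2, h3, -⟩ := windowWeight_ne_zero hP hqs hX0 h
        exact ⟨h1, h2, h3⟩)
    push_cast at hcount
    have hS0 : 0 ≤ ∑ n ∈ D, b n ^ 2 := sum_nonneg fun n _ => sq_nonneg _
    have hΨA0 : 0 ≤ ∑ n ∈ A, a n := sum_nonneg fun n _ => (habd n).1
    refine ⟨X, P0, ∑ n ∈ A, a n, ∑ n ∈ D, b n, ∑ n ∈ D, b n ^ 2, VA, VB, E, hX1, hXY,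
      le_trans (by gcongr; exact min_le_left _ _) hP0l, hP0u, ?_, hA_le, ?_, hS0, ?_, rfl, rfl, rfl, ?_⟩
    · refine hW.trans ?_
      gcongr
    · calc P0 ^ (k + 1) = P0 * P0 ^ k := by ring
        _ ≤ P0 * ((k * Real.log Y + 1) * W) := by gcongr
        _ = 2 * (k * Real.log Y + 1) * (P0 / 2 * W) := by ring
        _ ≤ _ := by gcongr
    · calc ∑ n ∈ D, b n ^ 2 ≤ ∑ n ∈ D, F * b n := by
            refine sum_le_sum fun n _ => ?_
            rw [sq]
            exact mul_le_mul_of_nonneg_right (hbbd n).2 (hbbd n).1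
        _ = F * ∑ n ∈ D, b n := by rw [mul_sum]
        _ ≤ F * P0 ^ (k + 1) := by gcongr
    · refine hcirc.trans ?_
      gcongr
  · rw [div_div, div_le_one (by positivity)]
    have : Real.exp (-(R + 1)) ≤ 1 := Real.exp_le_one_iff.mpr (by linarith)
    linarith
  · intro n _ hn
    obtain ⟨-, -, -, hle⟩ := windowWeight_ne_zero hP hqs (by linarith) hn
    calc (Y : ℝ) * n * (Real.exp (-(R + 1)) / 8 / X)
        ≤ Y * (Real.exp (R + 1) * Xl) * (Real.exp (-(R + 1)) / 8 / X) := by gcongr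
      _ = (Real.exp (R + 1) * Real.exp (-(R + 1))) / 8 := by
          rw [hX]; field_simp
      _ ≤ 1 / 6 := by rw [← Real.exp_add]; norm_num
  · intro n _ hn
    obtain ⟨-, -, -, hle⟩ := windowWeight_ne_zero hP hqs hX0 hn
    calc (n : ℝ) * (Real.exp (-(R + 1)) / 8 / X)
        ≤ (Real.exp (R + 1) * X) * (Real.exp (-(R + 1)) / 8 / X) := by gcongr
      _ = (Real.exp (R + 1) * Real.exp (-(R + 1))) / 8 := by
          field_simp
      _ ≤ 1 / 8 := by rw [← Real.exp_add]; norm_num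
  · intro r c β hr hrN hcr hβ
    have h := h2 Y (k + 1) r 1 c N X β hYY₂ (by omega) hkY'' hr hrN one_pos (by omega) hcr hX0
      (hXY.trans (by gcongr; linarith; omega)) (hNY.trans (by gcongr; linarith; omega)) hXN' hβ
    rw [smoothSum_eq_expSum hP] at h
    simp only [Nat.cast_one, one_mul, Nat.gcd_one_left] at h
    refine h.trans (add_le_add ?_ ?_)
    · rw [hVB, mul_comm |β| X, div_mul_eq_mul_div]
      gcongr
    · rw [mul_comm |β| X]
      exact mul_le_mul_of_nonneg_right (hE1 (k + 1) (Or.inr rfl)) (Real.sqrt_nonneg _)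
  · intro r c m β hr hrN hcr hβ hm hmY
    have hm0 : (1 : ℝ) ≤ m := by exact_mod_cast hm
    have hmYr : (m : ℝ) ≤ Y := by exact_mod_cast hmY.le
    have h := h2 Y k r m c N Xl β hYY₂ hk hkY' hr hrN hm hmY.le hcr (by linarith)
      (hXlY.trans (by gcongr; linarith; omega)) hNY (le_trans (le_mul_of_one_le_left (by linarith) (by linarith)) hXN) hβ
    rw [smoothSum_eq_expSum hP] at h
    refine h.trans (add_le_add ?_ ?_)
    · have : X * |β| / Y ≤ m * |β| * Xl := by
        rw [hX, div_le_iff₀ hY0]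
        have : 0 ≤ |β| * Xl * Y := by positivity
        linarith [mul_le_mul_of_nonneg_right hm0 this]
      have hd : 0 < 1 + X * |β| / Y := by positivity
      rw [hVA]
      gcongr
    · have h5 : m * |β| * Xl ≤ X * |β| := by
        rw [hX]
        have : 0 ≤ |β| * Xl := by positivity
        linarith [mul_le_mul_of_nonneg_right hmYr this]
      refine mul_le_mul (hE1 k (Or.inl rfl)) ?_ (Real.sqrt_nonneg _) (by positivity)
      gcongr

end Apply

end SmoothCircle

namespace SmoothCircle
open MeasureTheory Finset LGrowth PadeUnit

section Exponents

theorem mul_le_rpow {y a b s t : ℝ} (hy : 0 < y) (hb : 0 ≤ b) (h1 : a ≤ y ^ s)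
    (h2 : b ≤ y ^ t) : a * b ≤ y ^ (s + t) := by
  rw [Real.rpow_add hy]
  exact mul_le_mul h1 h2 hb (by positivity)

theorem rpow_le_mul {y a b s t : ℝ} (hy : 0 < y) (h1 : y ^ s ≤ a)
    (h2 : y ^ t ≤ b) : y ^ (s + t) ≤ a * b := by
  rw [Real.rpow_add hy]
  exact mul_le_mul h1 h2 (by positivity) (le_trans (by positivity) h1)

theorem pow_le_rpow {y a s : ℝ} (hy : 0 ≤ y) (ha : 0 ≤ a) (h : a ≤ y ^ s) (k : ℕ) : a ^ k ≤ y ^ (s * k) := by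
  rw [Real.rpow_mul hy, Real.rpow_natCast]
  exact pow_le_pow_left₀ ha h k

theorem rpow_le_pow {y a s : ℝ} (hy : 0 ≤ y) (h : y ^ s ≤ a) (k : ℕ) : y ^ (s * k) ≤ a ^ k := by
  rw [Real.rpow_mul hy, Real.rpow_natCast]
  exact pow_le_pow_left₀ (by positivity) h k

set_option maxHeartbeats 1000000 in
/-- Comparison of the main term and the error terms in the circle method inequality. -/
theorem rpow_half_le_count {y K η κ C X ΨA ΨB S VA VB E D U Q : ℝ} (hy : 1 ≤ y) (hη : 0 < η)
    (hη2 : η ≤ 1 / 2000) (hK : 1 ≤ K * η) (hC : 16 * C ≤ y ^ η) (hC0 : 0 ≤ C) (hκ0 : 0 < κ) (hκ : 64 ≤ κ * y ^ η)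
    (hX1 : 1 ≤ X) (hX : X ≤ y ^ (K + 1)) (hA : y ^ ((1 - η) * K - 1 / 8) ≤ ΨA) (hA' : ΨA ≤ y ^ ((1 + η) * K))
    (hB : y ^ ((1 - η) * (K + 1) - 1 / 8) ≤ ΨB) (hS0 : 0 ≤ S) (hS : S ≤ y ^ ((9 / 8 - 18 * η) * (K + 1)))
    (hVA0 : 0 ≤ VA) (hVA : VA ≤ y ^ (η + 1 / 30 + (1 + η) * K)) (hVA' : VA ≤ y ^ (η + 1 / 30 + 1 / 8) * ΨA)
    (hVB0 : 0 ≤ VB) (hVB : VB ≤ y ^ (η + 1 / 30 + 1 / 8) * ΨB) (hE0 : 0 ≤ E)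
    (hE : E ≤ y ^ (η + (5 / 8 - 17 * η) * (K + 1))) (hD : y ^ (K / 6) ≤ D) (hD' : D ≤ 2 * y ^ (K / 6))
    (hU : 0 ≤ U) (hQ0 : 0 ≤ Q) (hQ : Q ≤ y ^ (η + 2 + 3 / 8 * (K + 1) + (K + 1)))
    (hmain : κ / X * (ΨB ^ 2 / 2 * (y ^ 2 / 4 * ΨA)) ≤ Q * U +
      C * (y ^ 2 * E * (2 * X ^ (1 / 4 : ℝ)) + y ^ 2 * VA * y * D ^ (-(21 / 25) : ℝ)) * S +
      C * (D ^ 4 * E ^ 2 * (y * ΨA)) / X + C * (VB ^ 2 * √(y ^ 3 * ΨA * VA)) / X) :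
    y ^ (K / 2) ≤ U := by
  have hy0 : 0 < y := by linarith
  have hX0 : 0 < X := by linarith
  have hK2 : 2000 ≤ K := by
    by_contra! h
    nlinarith
  have hA0 : 0 < ΨA := lt_of_lt_of_le (by positivity) hA
  have hB0 : 0 < ΨB := lt_of_lt_of_le (by positivity) hB
  have hD0 : 0 < D := lt_of_lt_of_le (by positivity) hD
  have hyn : ∀ n : ℕ, y ^ n ≤ y ^ (n : ℝ) := fun n => (Real.rpow_natCast y n).ge
  have hyn' : ∀ n : ℕ, y ^ (n : ℝ) ≤ y ^ n := fun n => (Real.rpow_natCast y n).le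
  have mono : ∀ {s t : ℝ}, s ≤ t → y ^ s ≤ y ^ t := fun h => Real.rpow_le_rpow_of_exponent_le hy h
  set G := κ * y ^ 2 * ΨB ^ 2 * ΨA / 64 with hG
  have hκ' : y ^ (-η) ≤ κ / 64 := by
    rw [Real.rpow_neg hy0.le, le_div_iff₀ (by norm_num), inv_mul_le_iff₀ (by positivity)]
    linarith
  have hGl : y ^ ((3 - 3 * η) * K + 3) ≤ G := by
    have h1 := rpow_le_mul hy0 (rpow_le_mul hy0 (rpow_le_mul hy0 hκ' (hyn' 2)) (rpow_le_pow hy0.le hB 2)) hA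
    calc _ ≤ _ := mono (by push_cast; linarith)
      _ ≤ _ := h1
      _ = G := by rw [hG]; ring
  have t1 : X * (C * (y ^ 2 * E * (2 * X ^ (1 / 4 : ℝ))) * S) ≤ G := by
    have hX4 : X ^ (1 / 4 : ℝ) ≤ y ^ ((K + 1) * (1 / 4)) := by
      rw [Real.rpow_mul hy0.le]; gcongr
    have h2C : 2 * C ≤ y ^ η := by linarith
    have h1 := mul_le_rpow hy0 hS0 (mul_le_rpow hy0 (by positivity) (mul_le_rpow hy0 (by positivity)
      (mul_le_rpow hy0 hE0 (mul_le_rpow hy0 (by positivity) h2C (hyn 2)) hE) hX) hX4) hS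
    calc X * (C * (y ^ 2 * E * (2 * X ^ (1 / 4 : ℝ))) * S) = 2 * C * y ^ 2 * E * X * X ^ (1 / 4 : ℝ) * S := by ring
      _ ≤ _ := h1
      _ ≤ _ := mono (by push_cast; linarith)
      _ ≤ G := hGl
  have t2 : X * (C * (y ^ 2 * VA * y * D ^ (-(21 / 25) : ℝ)) * S) ≤ G := by
    have hD4 : D ^ (-(21 / 25) : ℝ) ≤ y ^ (K / 6 * (-(21 / 25))) := by
      rw [Real.rpow_mul hy0.le]
      exact Real.rpow_le_rpow_of_nonpos (by positivity) hD (by norm_num)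
    have hC1 : C ≤ y ^ η := by linarith
    have h1 := mul_le_rpow hy0 hS0 (mul_le_rpow hy0 (by positivity) (mul_le_rpow hy0 hX0.le
      (mul_le_rpow hy0 hVA0 (mul_le_rpow hy0 (by positivity) hC1 (hyn 3)) hVA) hX) hD4) hS
    calc X * (C * (y ^ 2 * VA * y * D ^ (-(21 / 25) : ℝ)) * S) = C * y ^ 3 * VA * X * D ^ (-(21 / 25) : ℝ) * S := by ring
      _ ≤ _ := h1
      _ ≤ _ := mono (by push_cast; linarith)
      _ ≤ G := hGl
  have t3 : C * (D ^ 4 * E ^ 2 * (y * ΨA)) ≤ G := by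
    have hD4 : D ^ 4 ≤ 16 * y ^ (K / 6 * (4 : ℕ)) := by
      rw [Real.rpow_mul hy0.le, Real.rpow_natCast]
      calc D ^ 4 ≤ (2 * y ^ (K / 6)) ^ 4 := by gcongr
        _ = _ := by ring
    have h1 := mul_le_rpow hy0 hA0.le (mul_le_rpow hy0 hy0.le (mul_le_rpow hy0 (by positivity)
      (mul_le_rpow hy0 (by positivity) hC (le_refl (y ^ (K / 6 * (4 : ℕ))))) (pow_le_rpow hy0.le hE0 hE 2))
      (Real.rpow_one y).ge) hA'
    calc C * (D ^ 4 * E ^ 2 * (y * ΨA)) ≤ C * (16 * y ^ (K / 6 * (4 : ℕ)) * E ^ 2 * (y * ΨA)) := by gcongr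
      _ = 16 * C * y ^ (K / 6 * (4 : ℕ)) * E ^ 2 * y * ΨA := by ring
      _ ≤ _ := h1
      _ ≤ _ := mono (by push_cast; linarith)
      _ ≤ G := hGl
  have t4 : C * (VB ^ 2 * √(y ^ 3 * ΨA * VA)) ≤ G := by
    set z := y ^ (η + 1 / 30 + 1 / 8) with hz
    have hz0 : 0 < z := by positivity
    have hsq : √(y ^ 3 * ΨA * VA) ≤ y ^ ((3 + (η + 1 / 30 + 1 / 8)) * (1 / 2)) * ΨA := by
      refine Real.sqrt_le_iff.mpr ⟨by positivity, ?_⟩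
      rw [mul_pow, ← Real.rpow_natCast (y ^ _), ← Real.rpow_mul hy0.le]
      have : (3 + (η + 1 / 30 + 1 / 8)) * (1 / 2) * ((2 : ℕ) : ℝ) = (3 : ℕ) + (η + 1 / 30 + 1 / 8) := by
        push_cast; ring
      rw [this, Real.rpow_add hy0, Real.rpow_natCast, ← hz]
      calc y ^ 3 * ΨA * VA ≤ y ^ 3 * ΨA * (z * ΨA) := by gcongr
        _ = _ := by ring
    have hC1 : C ≤ y ^ η := by linarith
    have hz2 : z ^ 2 ≤ y ^ ((η + 1 / 30 + 1 / 8) * (2 : ℕ)) := pow_le_rpow hy0.le hz0.le le_rfl 2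
    have h1 : C * z ^ 2 * y ^ ((3 + (η + 1 / 30 + 1 / 8)) * (1 / 2)) ≤ κ / 64 * y ^ 2 := by
      calc _ ≤ _ := mul_le_rpow hy0 (by positivity) (mul_le_rpow hy0 (by positivity) hC1 hz2) le_rfl
        _ ≤ y ^ (-η + (2 : ℕ)) := mono (by push_cast; linarith)
        _ ≤ _ := rpow_le_mul hy0 hκ' (hyn' 2)
    calc C * (VB ^ 2 * √(y ^ 3 * ΨA * VA))
        ≤ C * ((z * ΨB) ^ 2 * (y ^ ((3 + (η + 1 / 30 + 1 / 8)) * (1 / 2)) * ΨA)) := by gcongr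
      _ = C * z ^ 2 * y ^ ((3 + (η + 1 / 30 + 1 / 8)) * (1 / 2)) * (ΨB ^ 2 * ΨA) := by ring
      _ ≤ κ / 64 * y ^ 2 * (ΨB ^ 2 * ΨA) := by gcongr
      _ = G := by rw [hG]; ring
  have hQU : G ≤ X * (Q * U) := by
    have h := mul_le_mul_of_nonneg_left hmain hX0.le
    have e1 : X * (κ / X * (ΨB ^ 2 / 2 * (y ^ 2 / 4 * ΨA))) = 8 * G := by
      rw [hG]; field_simp; ring
    have e2 : X * (Q * U +
      C * (y ^ 2 * E * (2 * X ^ (1 / 4 : ℝ)) + y ^ 2 * VA * y * D ^ (-(21 / 25) : ℝ)) * S +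
      C * (D ^ 4 * E ^ 2 * (y * ΨA)) / X + C * (VB ^ 2 * √(y ^ 3 * ΨA * VA)) / X) =
      X * (Q * U) + X * (C * (y ^ 2 * E * (2 * X ^ (1 / 4 : ℝ))) * S) +
      X * (C * (y ^ 2 * VA * y * D ^ (-(21 / 25) : ℝ)) * S) + C * (D ^ 4 * E ^ 2 * (y * ΨA)) +
      C * (VB ^ 2 * √(y ^ 3 * ΨA * VA)) := by
      field_simp; ring
    have hG0 : 0 < G := by positivity
    rw [e1, e2] at h
    linarith
  have h5 : y ^ ((3 - 3 * η) * K + 3) ≤ y ^ (K + 1 + (η + 2 + 3 / 8 * (K + 1) + (K + 1))) * U := by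
    calc _ ≤ G := hGl
      _ ≤ X * Q * U := by rw [mul_assoc]; exact hQU
      _ ≤ _ := mul_le_mul_of_nonneg_right (mul_le_rpow hy0 hQ0 hX hQ) hU
  have h6 : y ^ (K / 2) * y ^ (K + 1 + (η + 2 + 3 / 8 * (K + 1) + (K + 1))) ≤ y ^ ((3 - 3 * η) * K + 3) := by
    rw [← Real.rpow_add hy0]
    exact mono (by linarith [mul_le_mul_of_nonneg_left hη2 (by linarith : 0 ≤ K)])
  have h7 := h6.trans h5
  rw [mul_comm] at h7
  exact le_of_mul_le_mul_left h7 (by positivity)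

end Exponents

end SmoothCircle

namespace SmoothCircle
open MeasureTheory Finset LGrowth PadeUnit Filter

section Final

theorem eventually_le_mul_rpow {s : ℝ} (hs : 0 < s) {c : ℝ} (hc : 0 < c) (B : ℝ) :
    ∀ᶠ Y : ℕ in atTop, B ≤ c * (Y : ℝ) ^ s :=
  (((tendsto_rpow_atTop hs).comp tendsto_natCast_atTop_atTop).const_mul_atTop hc).eventually_ge_atTop B

theorem eventually_mul_log_le_rpow {s : ℝ} (hs : 0 < s) {B : ℝ} (hB : 0 < B) :
    ∀ᶠ Y : ℕ in atTop, B * Real.log Y ≤ (Y : ℝ) ^ s := by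
  have h := ((isLittleO_log_rpow_atTop hs).bound (c := 1 / B) (by positivity)).natCast_atTop
  filter_upwards [h] with Y hY
  rw [Real.norm_of_nonneg (Real.log_natCast_nonneg Y), Real.norm_of_nonneg (by positivity)] at hY
  rwa [div_mul_eq_mul_div, one_mul, le_div_iff₀ hB, mul_comm] at hY

theorem ceil_rpow_bounds {y s : ℝ} (hy : 1 ≤ y) (hs : 0 ≤ s) :
    0 < ⌈y ^ s⌉₊ ∧ y ^ s ≤ ⌈y ^ s⌉₊ ∧ ((⌈y ^ s⌉₊ : ℕ) : ℝ) ≤ 2 * y ^ s := by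
  have h1 : 1 ≤ y ^ s := Real.one_le_rpow hy hs
  refine ⟨Nat.ceil_pos.mpr (by linarith), Nat.le_ceil _, ?_⟩
  have := Nat.ceil_lt_add_one (by linarith : 0 ≤ y ^ s)
  linarith

theorem rpow_sub_le_of_le_mul {y p t A s u : ℝ} (hy : 0 < y) (h1 : y ^ s ≤ p) (h2 : p ≤ t * A)
    (ht : t ≤ y ^ u) (hA : 0 ≤ A) : y ^ (s - u) ≤ A := by
  rw [Real.rpow_sub hy, div_le_iff₀ (by positivity), mul_comm]
  exact h1.trans (h2.trans (mul_le_mul_of_nonneg_right ht hA))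

set_option maxHeartbeats 1000000 in
/-- Under GRH the primes below `Y` support many solutions of the unit equation. -/
theorem exists_exp_le_card_unitSolutions (hG : GRH) {η : ℝ} (hη : 0 < η) (hη2 : η ≤ 1 / 2000) :
    ∃ Y₀ : ℕ, ∀ Y ≥ Y₀, Real.exp ((Y : ℝ) ^ (1 / 8 - 20 * η)) ≤ Nat.card (unitSolutions (primeSet Y)) := by
  obtain ⟨κ, hκ, c, hc, C, hC1, Y₁, hmain⟩ := exists_smooth_circle_bound hG hη (by linarith)
  obtain ⟨Y₀, hY₀⟩ := eventually_atTop.mp ((eventually_ge_atTop Y₁).and ((eventually_ge_atTop 100).and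
    ((eventually_le_mul_rpow hη one_pos (16 * C)).and ((eventually_le_mul_rpow hη hκ 64).and
    ((eventually_le_mul_rpow hη hc 1).and ((eventually_le_mul_rpow hη one_pos 2).and
    ((eventually_mul_log_le_rpow hη (by norm_num : (0 : ℝ) < 6)).and
    (eventually_le_mul_rpow (by linarith : 0 < 1 / 8 - 20 * η) one_pos (1 / η + 1)))))))))
  refine ⟨Y₀, fun Y hY => ?_⟩
  obtain ⟨hYY₁, hY100, h16, h64, h1c, h2, hlog, hz⟩ := hY₀ Y hY
  rw [one_mul] at h16 h2 hz
  have hy100 : (100 : ℝ) ≤ Y := by exact_mod_cast hY100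
  set y : ℝ := (Y : ℝ) with hyd
  have hy1 : 1 ≤ y := by linarith
  have hy0 : 0 < y := by linarith
  have hl4 : 4 ≤ Real.log y := by
    rw [Real.le_log_iff_exp_le hy0]
    have := Real.exp_one_lt_d9
    calc Real.exp 4 = Real.exp 1 ^ 4 := by rw [← Real.exp_nat_mul]; norm_num
      _ ≤ 2.7182818286 ^ 4 := by gcongr
      _ ≤ y := by norm_num; linarith
  have hlog4 : Real.log 4 ≤ y ^ η := by
    refine le_trans ?_ h2
    have := Real.log_le_sub_one_of_pos (by norm_num : (0 : ℝ) < 2)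
    have e : Real.log 4 = 2 * Real.log 2 := by
      rw [show (4 : ℝ) = 2 ^ 2 by norm_num, Real.log_pow]; norm_num
    linarith
  set z := y ^ (1 / 8 - 20 * η) with hzd
  have hη1 : 1 / η ≥ 2000 := by
    rw [ge_iff_le, le_div_iff₀ hη]; linarith
  have hz1 : 2001 ≤ z := by linarith
  set k := ⌊z⌋₊ with hk
  have hkz : (k : ℝ) ≤ z := Nat.floor_le (by linarith)
  have hzk : z < k + 1 := Nat.lt_floor_add_one z
  have hkη : 1 ≤ (k : ℝ) * η := by
    have : 1 / η ≤ k := by linarith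
    rwa [div_le_iff₀ hη] at this
  have hk0 : 0 < k := by
    have : (0 : ℝ) < k := by linarith
    exact_mod_cast this
  have hkr : (2000 : ℝ) ≤ k := by linarith
  have hzy : z * y ^ η = y ^ (1 / 8 - 19 * η) := by
    rw [hzd, ← Real.rpow_add hy0]; congr 1; ring
  have mono : ∀ {s t : ℝ}, s ≤ t → y ^ s ≤ y ^ t := fun h => Real.rpow_le_rpow_of_exponent_le hy1 h
  have hlogs : ∀ u : ℝ, u ≤ 6 * z → u * Real.log y ≤ y ^ (1 / 8 - 19 * η) := by
    intro u hu
    rw [← hzy]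
    calc u * Real.log y ≤ 6 * z * Real.log y := by gcongr
      _ = z * (6 * Real.log y) := by ring
      _ ≤ z * y ^ η := by gcongr
  have hf : ((k + 1 : ℕ) : ℝ) * Real.log y ≤ y ^ (1 / 8 - 19 * η) := hlogs _ (by push_cast; linarith)
  have h5 : ((k : ℝ) + 5) * Real.log y ≤ y ^ (1 / 8 - 19 * η) := hlogs _ (by linarith)
  have hell : 2 * ((k : ℝ) * Real.log y + 1) ≤ y ^ (1 / 8 : ℝ) := by
    calc 2 * ((k : ℝ) * Real.log y + 1) ≤ (2 * k + 2) * Real.log y := by linarith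
      _ ≤ y ^ (1 / 8 - 19 * η) := hlogs _ (by linarith)
      _ ≤ _ := mono (by linarith)
  have hell1 : (k : ℝ) * Real.log y + 1 ≤ y ^ (1 / 8 : ℝ) := by
    have : 0 ≤ (k : ℝ) * Real.log y := by positivity
    linarith
  have hcη : y ^ (-η) ≤ c := by
    rw [Real.rpow_neg hy0.le, inv_le_iff_one_le_mul₀ (by positivity)]
    exact h1c
  have hcond : ((k + 1 : ℕ) : ℝ) * Real.log y ≤ c * y ^ (1 / 8 : ℝ) := by
    calc _ ≤ y ^ (1 / 8 - 19 * η) := hf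
      _ ≤ y ^ (-η + 1 / 8) := mono (by linarith)
      _ ≤ _ := by rw [Real.rpow_add hy0]; gcongr
  have hk6 : (0 : ℝ) ≤ k / 6 := by positivity
  obtain ⟨hD0, hDl, hDu⟩ := ceil_rpow_bounds hy1 hk6
  obtain ⟨X, P0, ΨA, ΨB, S, VA, VB, E, hX1, hX, hP0l, hP0u, hA, hA', hB, hS0, hS, hVA, hVB, hE, hineq⟩ :=
    hmain Y k ⌈y ^ ((k : ℝ) / 6)⌉₊ hYY₁ hk0 hD0 hcond
  rw [← hyd] at hX hP0l hP0u hA hB hS hVA hVB hE hineq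
  have hP0pos : 0 < P0 := lt_of_lt_of_le (by positivity) hP0l
  have hPl : y ^ (1 - η) ≤ P0 := by
    refine le_trans ?_ hP0l
    rw [sub_eq_neg_add, Real.rpow_add hy0, Real.rpow_one]
    gcongr
  have hPu : P0 ≤ y ^ (1 + η) := by
    refine hP0u.trans ?_
    rw [add_comm, Real.rpow_add hy0, Real.rpow_one]
    gcongr
  have hC0 : 0 ≤ C := by linarith
  have hCη : C ≤ y ^ η := by linarith
  have hPk0 : 0 < P0 ^ k := by positivity
  have hPk1 : 0 < P0 ^ (k + 1) := by positivity
  have hlk0 : 0 ≤ (k : ℝ) * Real.log y := by positivity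
  have hA0 : 0 ≤ ΨA := by
    by_contra! h
    linarith [mul_nonpos_of_nonneg_of_nonpos (by linarith : 0 ≤ (k : ℝ) * Real.log y + 1) h.le]
  have hB0 : 0 ≤ ΨB := by
    by_contra! h
    linarith [mul_nonpos_of_nonneg_of_nonpos (by linarith : 0 ≤ 2 * ((k : ℝ) * Real.log y + 1)) h.le]
  have hkc : ((k + 1 : ℕ) : ℝ) = k + 1 := by push_cast; ring
  have hF0 : 0 ≤ ((k + 1 : ℕ) : ℝ) * Real.log y := by positivity
  have hYk : y ^ (k + 1) = y ^ ((k : ℝ) + 1) := by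
    rw [← hkc, Real.rpow_natCast]
  set F := (((k + 1 : ℕ) : ℝ) * Real.log y) ^ (k + 1) with hFd
  have hF : F ≤ y ^ ((1 / 8 - 19 * η) * ((k : ℝ) + 1)) := by
    rw [← hkc]
    exact pow_le_rpow hy0.le hF0 hf (k + 1)
  have hFnn : 0 ≤ F := by positivity
  have hcount := rpow_half_le_count (y := y) (K := k) (η := η) (κ := κ) (C := C) (X := X) (ΨA := ΨA)
    (ΨB := ΨB) (S := S) (VA := VA) (VB := VB) (E := E) (D := (⌈y ^ ((k : ℝ) / 6)⌉₊ : ℕ))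
    (U := Nat.card (unitSolutions (primeSet Y))) (Q := 2 * y * F ^ 3 * (y * y ^ (k + 1)))
    hy1 hη hη2 hkη h16 hC0 hκ h64 hX1 (hX.trans hYk.le)
    (rpow_sub_le_of_le_mul hy0 (rpow_le_pow hy0.le hPl k) hA hell1 hA0)
    (hA'.trans (pow_le_rpow hy0.le hP0pos.le hPu k))
    (rpow_sub_le_of_le_mul hy0 (by rw [← hkc]; exact rpow_le_pow hy0.le hPl (k + 1)) hB hell hB0)
    hS0 ?_ ?_ ?_ ?_ ?_ ?_ ?_ ?_ hDl hDu (Nat.cast_nonneg _) (by positivity) ?_ (hineq.trans_eq ?_)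
  · refine le_trans ?_ hcount
    rw [Real.rpow_def_of_pos hy0]
    refine Real.exp_le_exp.mpr ?_
    have : 4 * ((k : ℝ) / 2) ≤ Real.log y * (k / 2) := by gcongr
    linarith
  · refine hS.trans ((mul_le_rpow hy0 hPk1.le hF (pow_le_rpow hy0.le hP0pos.le hPu (k + 1))).trans (mono ?_))
    rw [hkc]
    linarith
  · rw [hVA]; positivity
  · rw [hVA]
    exact mul_le_rpow hy0 hPk0.le (mul_le_rpow hy0 (by positivity) hCη le_rfl)
      (pow_le_rpow hy0.le hP0pos.le hPu k)
  · rw [hVA, Real.rpow_add hy0, Real.rpow_add hy0, mul_assoc _ _ ΨA]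
    gcongr
    exact hA.trans (mul_le_mul_of_nonneg_right hell1 hA0)
  · rw [hVB]; positivity
  · rw [hVB, Real.rpow_add hy0, Real.rpow_add hy0, mul_assoc _ _ ΨB]
    gcongr
    exact hB.trans (mul_le_mul_of_nonneg_right hell hB0)
  · rw [hE]; positivity
  · rw [hE]
    have hb : C * (((k : ℝ) + 5) * Real.log y) * y ^ (1 / 2 + η) ≤ y ^ (5 / 8 - 17 * η) := by
      refine (mul_le_rpow hy0 (by positivity) (mul_le_rpow hy0 (by positivity) hCη h5) le_rfl).trans (mono ?_)
      linarith
    have := pow_le_rpow hy0.le (by positivity) hb (k + 1)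
    rw [hkc] at this
    exact mul_le_rpow hy0 (by positivity) hCη this
  · have hF3 : F ^ 3 ≤ y ^ ((1 / 8 - 19 * η) * ((k : ℝ) + 1) * (3 : ℕ)) := pow_le_rpow hy0.le hFnn hF 3
    have hy1' : y ≤ y ^ (1 : ℝ) := (Real.rpow_one y).ge
    refine (mul_le_rpow hy0 (by positivity) (mul_le_rpow hy0 (by positivity)
      (mul_le_rpow hy0 hy0.le h2 hy1') hF3) (mul_le_rpow hy0 (by positivity) hy1' hYk.le)).trans (mono ?_)
    have : 0 ≤ η * ((k : ℝ) + 1) := by positivity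
    push_cast
    linarith
  · ring

end Final

end SmoothCircle

theorem one_le_NSunit {s : ℕ} (hs : 0 < s)
    (hfin : {T : ℕ × ℕ × ℕ | 0 < T.1 ∧ 0 < T.2.1 ∧ T.1 + T.2.1 = T.2.2 ∧
      Nat.gcd T.1 (Nat.gcd T.2.1 T.2.2) = 1 ∧
      ∀ p : ℕ, p.Prime → p ∣ T.1 * T.2.1 * T.2.2 → ∃ i < s, Nat.nth Nat.Prime i = p}.Finite) :
    1 ≤ NSunit s := by
  unfold NSunit
  rw [Nat.card_coe_set_eq, Nat.succ_le_iff, Set.ncard_pos hfin]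
  refine ⟨(1, 1, 2), by norm_num, by norm_num, by norm_num, by norm_num, fun p hp hd => ⟨0, hs, ?_⟩⟩
  rw [Nat.nth_prime_zero_eq_two]
  exact ((Nat.prime_dvd_prime_iff_eq hp Nat.prime_two).mp (by simpa using hd)).symm

theorem finite_firstPrimes_solutions (s : ℕ) :
    {T : ℕ × ℕ × ℕ | 0 < T.1 ∧ 0 < T.2.1 ∧ T.1 + T.2.1 = T.2.2 ∧
      Nat.gcd T.1 (Nat.gcd T.2.1 T.2.2) = 1 ∧
      ∀ p : ℕ, p.Prime → p ∣ T.1 * T.2.1 * T.2.2 → ∃ i < s, Nat.nth Nat.Prime i = p}.Finite := by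
  refine (PadeUnit.unitSolutions_finite ((Finset.range s).image (Nat.nth Nat.Prime)) ?_).subset ?_
  · intro p hp
    obtain ⟨i, -, rfl⟩ := Finset.mem_image.mp hp
    exact Nat.prime_nth_prime i
  · rintro T ⟨h1, h2, h3, h4, h5⟩
    refine ⟨h1, h2, h3, h4, fun p hp hd => ?_⟩
    obtain ⟨i, hi, rfl⟩ := h5 p hp hd
    exact Finset.mem_image.mpr ⟨i, Finset.mem_range.mpr hi, rfl⟩

theorem card_unitSolutions_primeSet_le_NSunit (s : ℕ) :
    Nat.card (PadeUnit.unitSolutions (LGrowth.primeSet s)) ≤ NSunit s := by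
  refine Nat.card_mono (finite_firstPrimes_solutions s) ?_
  rintro T ⟨h1, h2, h3, h4, h5⟩
  refine ⟨h1, h2, h3, h4, fun p hp hd => ⟨Nat.count Nat.Prime p, ?_, Nat.nth_count hp⟩⟩
  exact (Nat.count_le _).trans_lt (LGrowth.mem_primeSet.mp (h5 p hp hd)).1

theorem sunit_equation_many_solutions (hGRH : GRH) :
    ∀ ε > (0 : ℝ), ∃ c > (0 : ℝ), ∀ s : ℕ, 0 < s →
      c * Real.exp ((s : ℝ) ^ ((1 : ℝ) / 8 - ε)) ≤ (NSunit s : ℝ) := by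
  intro ε hε
  have hη : 0 < min (ε / 20) (1 / 2000) := by positivity
  obtain ⟨Y₀, hY₀⟩ := SmoothCircle.exists_exp_le_card_unitSolutions hGRH hη (min_le_right _ _)
  have hexp : ∀ s : ℕ, 0 < s → (s : ℝ) ^ ((1 : ℝ) / 8 - ε) ≤ (s : ℝ) ^ (1 / 8 - 20 * min (ε / 20) (1 / 2000)) := by
    intro s hs
    refine Real.rpow_le_rpow_of_exponent_le (by exact_mod_cast hs) ?_
    linarith [min_le_left (ε / 20) (1 / 2000)]
  refine ⟨Real.exp (-(Y₀ : ℝ)), Real.exp_pos _, fun s hs => ?_⟩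
  have hs1 : (1 : ℝ) ≤ s := by exact_mod_cast hs
  rw [← Real.exp_add]
  by_cases h : Y₀ ≤ s
  · calc Real.exp (-(Y₀ : ℝ) + (s : ℝ) ^ ((1 : ℝ) / 8 - ε))
        ≤ Real.exp ((s : ℝ) ^ (1 / 8 - 20 * min (ε / 20) (1 / 2000))) := by
          refine Real.exp_le_exp.mpr ?_
          linarith [hexp s hs, (Nat.cast_nonneg Y₀ : (0 : ℝ) ≤ Y₀)]
      _ ≤ Nat.card (PadeUnit.unitSolutions (LGrowth.primeSet s)) := hY₀ s h
      _ ≤ NSunit s := by exact_mod_cast card_unitSolutions_primeSet_le_NSunit s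
  · have h1 : (s : ℝ) ^ ((1 : ℝ) / 8 - ε) ≤ s := by
      calc (s : ℝ) ^ ((1 : ℝ) / 8 - ε) ≤ (s : ℝ) ^ (1 : ℝ) :=
            Real.rpow_le_rpow_of_exponent_le hs1 (by linarith)
        _ = s := Real.rpow_one _
    have h2 : (s : ℝ) ≤ Y₀ := by exact_mod_cast (not_le.mp h).le
    calc Real.exp (-(Y₀ : ℝ) + (s : ℝ) ^ ((1 : ℝ) / 8 - ε)) ≤ 1 := Real.exp_le_one_iff.mpr (by linarith)
      _ ≤ NSunit s := by exact_mod_cast one_le_NSunit hs (finite_firstPrimes_solutions s)
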